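/- arXiv:0710.0642 — 3 statements merged into one kernel-verified Lean document; each statement's English description precedes it below -/
import Mathlib

section
/- There is an absolute constant C > 0 with the following property. Let N be a positive integer, Γ ⊆ ℤ/Nℤ a finite set of frequencies and δ ∈ (0,1] with B(Γ,δ) regular; let A ⊆ ℤ/Nℤ have relative density α := |A ∩ B(Γ,δ)|/|B(Γ,δ)| > 0 in B(Γ,δ); and suppose B ⊆ ℤ/Nℤ is nonempty with |A + B| ≤ K·|B| for a real K ≥ 1. Then at least one of the following holds. (1) There exist a finite set Λ ⊆ ℤ/Nℤ with |Λ| ≤ C·K^{3/4}·(1 + log α⁻¹), and reals δ'', ε > 0 with δ''⁻¹ ≤ (2·α⁻¹·K·(1+|Γ|))^C·δ⁻¹ and ε⁻¹ ≤ C·K·(1 + log α⁻¹), such that B(Γ,δ'') ∩ B(Λ,ε) ⊆ (A − A) + (B − B). (2) There exist a finite set Γ' ⊆ ℤ/Nℤ and δ'' > 0 with |Γ'| ≤ |Γ| + C·K^{1/4} and δ''⁻¹ ≤ (2·α⁻¹·K·(1+|Γ|))^C·δ⁻¹, such that B(Γ',δ'') is regular and there is x ∈ ℤ/Nℤ with |A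 ∩ (x + B(Γ',δ''))| ≥ α·(1 + 2⁻⁷·K^{−1/4})·|B(Γ',δ'')|. -/
open Finset Complex
open scoped Pointwise BigOperators ComplexConjugate

/-- Distance from a real number to the nearest integer. -/
noncomputable def nint (r : ℝ) : ℝ := |r - round r|

open Classical in
/-- The Bohr set `B(Γ, δ)` in `ℤ/Nℤ`: all `x` with `‖t x / N‖ ≤ δ` for every frequency
`t ∈ Γ`, where `‖·‖` is the distance to the nearest integer. -/
noncomputable def bohr (N : ℕ) [NeZero N] (Γ : Finset (ZMod N)) (δ : ℝ) : Finset (ZMod N) :=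
  Finset.univ.filter fun x => ∀ t ∈ Γ, nint (((t * x).val : ℝ) / N) ≤ δ

/-- Regularity of the Bohr set `B(Γ, δ)`. -/
def BohrRegular (N : ℕ) [NeZero N] (Γ : Finset (ZMod N)) (δ : ℝ) : Prop :=
  ∀ η : ℝ, (Γ.card : ℝ) * |η| ≤ ((2 : ℝ) ^ 4)⁻¹ →
    (1 - 2 ^ 4 * Γ.card * |η|) * (bohr N Γ δ).card ≤ ((bohr N Γ ((1 + η) * δ)).card : ℝ) ∧
    ((bohr N Γ ((1 + η) * δ)).card : ℝ) ≤ (1 + 2 ^ 4 * Γ.card * |η|) * (bohr N Γ δ).card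

/-- The character of `ℤ/Nℤ` associated with the frequency `t`, evaluated at `x`:
`γ_t(x) = e^{2πi t x / N}`. -/
noncomputable def chr (N : ℕ) [NeZero N] (t x : ZMod N) : ℂ :=
  Complex.exp (2 * Real.pi * Complex.I * (((t * x).val : ℕ) : ℂ) / N)

/-- The Fourier transform of the uniform probability measure `β_{Γ,δ}` on `B(Γ,δ)` at the
frequency `t`: `β̂_{Γ,δ}(t) = |B(Γ,δ)|⁻¹ Σ_{x ∈ B(Γ,δ)} e^{-2πi t x / N}`. -/
noncomputable def bohrFourier (N : ℕ) [NeZero N] (Γ : Finset (ZMod N)) (δ : ℝ) (t : ZMod N) : ℂ :=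
  ((bohr N Γ δ).card : ℂ)⁻¹ *
    ∑ x ∈ bohr N Γ δ, Complex.exp (-(2 * Real.pi * Complex.I * (((t * x).val : ℕ) : ℂ) / N))

/-- A finite set `Λ` in an abelian group is `S`-dissociated if the only `{-1,0,1}`-valued
assignment `m` on `Λ` with `Σ_{λ ∈ Λ} m(λ)·λ ∈ S` is `m ≡ 0`. -/
def SDissociated {G : Type*} [AddCommGroup G] (S : Set G) (Λ : Finset G) : Prop :=
  ∀ m : G → ℤ, (∀ l ∈ Λ, m l = -1 ∨ m l = 0 ∨ m l = 1) →
    (∑ l ∈ Λ, m l • l) ∈ S → ∀ l ∈ Λ, m l = 0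


lemma il_mem_bohr {N : ℕ} [NeZero N] {Γ : Finset (ZMod N)} {δ : ℝ} {x : ZMod N} :
    x ∈ bohr N Γ δ ↔ ∀ t ∈ Γ, ‖ZMod.toAddCircle (t * x)‖ ≤ δ := by
  classical
  unfold bohr
  rw [Finset.mem_filter]
  simp only [Finset.mem_univ, true_and, nint, ZMod.toAddCircle_apply, UnitAddCircle.norm_eq]

lemma il_zero_mem {N : ℕ} [NeZero N] {Γ : Finset (ZMod N)} {δ : ℝ} (h : 0 ≤ δ) :
    (0 : ZMod N) ∈ bohr N Γ δ := by
  rw [il_mem_bohr]; intro t _; simpa using h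

lemma il_bohr_pos {N : ℕ} [NeZero N] {Γ : Finset (ZMod N)} {δ : ℝ} (h : 0 ≤ δ) :
    0 < ((bohr N Γ δ).card : ℝ) := by
  exact_mod_cast Finset.card_pos.mpr ⟨0, il_zero_mem h⟩

lemma il_bohr_mono {N : ℕ} [NeZero N] {Γ : Finset (ZMod N)} {δ δ' : ℝ} (h : δ ≤ δ') :
    bohr N Γ δ ⊆ bohr N Γ δ' := by
  intro x; simp only [il_mem_bohr]; intro hx t ht; exact (hx t ht).trans h

lemma il_bohr_anti {N : ℕ} [NeZero N] {Γ Γ' : Finset (ZMod N)} {δ : ℝ} (h : Γ ⊆ Γ') :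
    bohr N Γ' δ ⊆ bohr N Γ δ := by
  intro x; simp only [il_mem_bohr]; intro hx t ht; exact hx t (h ht)

lemma il_bohr_add {N : ℕ} [NeZero N] {Γ : Finset (ZMod N)} {δ δ' : ℝ} {x y : ZMod N}
    (hx : x ∈ bohr N Γ δ) (hy : y ∈ bohr N Γ δ') : x + y ∈ bohr N Γ (δ + δ') := by
  rw [il_mem_bohr] at *
  intro t ht
  rw [mul_add, map_add]
  exact (norm_add_le _ _).trans (add_le_add (hx t ht) (hy t ht))

lemma il_bohr_neg {N : ℕ} [NeZero N] {Γ : Finset (ZMod N)} {δ : ℝ} {x : ZMod N}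
    (hx : x ∈ bohr N Γ δ) : -x ∈ bohr N Γ δ := by
  rw [il_mem_bohr] at *
  intro t ht
  rw [mul_neg, map_neg, norm_neg]; exact hx t ht

lemma il_bohr_sub {N : ℕ} [NeZero N] {Γ : Finset (ZMod N)} {δ δ' : ℝ} {x y : ZMod N}
    (hx : x ∈ bohr N Γ δ) (hy : y ∈ bohr N Γ δ') : x - y ∈ bohr N Γ (δ + δ') := by
  rw [sub_eq_add_neg]; exact il_bohr_add hx (il_bohr_neg hy)

/-- The standard character. -/
noncomputable def ilE {N : ℕ} [NeZero N] (z : ZMod N) : ℂ := ZMod.stdAddChar z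

lemma ilE_zero {N : ℕ} [NeZero N] : ilE (0 : ZMod N) = 1 := by simp [ilE]
lemma ilE_add {N : ℕ} [NeZero N] (x y : ZMod N) : ilE (x + y) = ilE x * ilE y := by
  simp [ilE, AddChar.map_add_eq_mul]
lemma ilE_norm {N : ℕ} [NeZero N] (x : ZMod N) : ‖ilE x‖ = 1 := by
  simp [ilE]
lemma ilE_neg {N : ℕ} [NeZero N] (x : ZMod N) : ilE (-x) = conj (ilE x) := by
  simp [ilE, AddChar.map_neg_eq_conj]

lemma ilE_sub_one {N : ℕ} [NeZero N] (z : ZMod N) :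
    ‖ilE z - 1‖ ≤ 2 * Real.pi * ‖ZMod.toAddCircle z‖ := by
  set u : ℝ := (z.val : ℝ) / N with hu
  have h1 : ‖ZMod.toAddCircle z‖ = |u - round u| := by
    rw [ZMod.toAddCircle_apply, UnitAddCircle.norm_eq]
  have h2 : ilE z = Complex.exp (Complex.I * ((2 * Real.pi * (u - round u) : ℝ) : ℂ)) := by
    have : ilE z = Complex.exp (2 * Real.pi * Complex.I * z.val / N) := by
      have := ZMod.stdAddChar_coe (N := N) (z.val : ℤ)
      simpa [ilE] using this
    rw [this, Complex.exp_eq_exp_iff_exists_int]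
    refine ⟨round u, ?_⟩
    rw [hu]; push_cast; ring
  rw [h2, h1]
  refine Real.norm_exp_I_mul_ofReal_sub_one_le.trans ?_
  rw [Real.norm_eq_abs, abs_mul, abs_of_pos (by positivity)]

lemma ilE_sum {N : ℕ} [NeZero N] (z : ZMod N) :
    ∑ t : ZMod N, ilE (t * z) = if z = 0 then (N : ℂ) else 0 := by
  have := AddChar.sum_mulShift z (ZMod.isPrimitive_stdAddChar N)
  simpa [ilE] using this

lemma ilE_smul {N : ℕ} [NeZero N] (s : Finset (ZMod N)) (m : ZMod N → ℤ) (x : ZMod N)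
    (hm : ∀ l ∈ s, m l = -1 ∨ m l = 0 ∨ m l = 1) :
    ‖ilE ((∑ l ∈ s, m l • l) * x) - 1‖ ≤ ∑ l ∈ s, ‖ilE (l * x) - 1‖ := by
  classical
  induction s using Finset.induction_on with
  | empty => simp [ilE_zero]
  | insert a s ha ih =>
    rw [Finset.sum_insert ha, Finset.sum_insert ha, add_mul, ilE_add]
    have ih' := ih (fun l hl => hm l (Finset.mem_insert_of_mem hl))
    have h1 : ‖ilE ((m a • a) * x) - 1‖ ≤ ‖ilE (a * x) - 1‖ := by
      rcases hm a (Finset.mem_insert_self _ _) with h | h | h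
      · rw [h]; simp only [neg_smul, one_smul, neg_mul, ilE_neg]
        rw [← Complex.norm_conj]; simp
      · rw [h]; simp [ilE_zero]
      · rw [h]; simp
    calc ‖ilE ((m a • a) * x) * ilE ((∑ l ∈ s, m l • l) * x) - 1‖
        = ‖(ilE ((m a • a) * x) - 1) * ilE ((∑ l ∈ s, m l • l) * x)
            + (ilE ((∑ l ∈ s, m l • l) * x) - 1)‖ := by congr 1; ring
      _ ≤ _ := by
        refine (norm_add_le _ _).trans ?_
        rw [norm_mul, ilE_norm, mul_one]
        exact add_le_add h1 ih'


lemma il_vitali (φ : ℝ → ℝ) (hφ : Monotone φ) (a b c : ℝ) (hc : 0 < c) (hab : a ≤ b)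
    (hbad : ∀ s ∈ Set.Icc a b, ∃ p q, p < q ∧ p ≤ s ∧ s ≤ q ∧ q - p ≤ 1/10 ∧
      c * (q - p) ≤ φ q - φ p) :
    c * (b - a) ≤ 4 * (φ (b + 1/5) - φ (a - 1/5)) := by
  choose! p q hpq hps hsq hl hinc using hbad
  have hball : ∀ s, Metric.closedBall ((p s + q s)/2) ((q s - p s)/2) = Set.Icc (p s) (q s) := by
    intro s; rw [Real.closedBall_eq_Icc]; congr 1 <;> ring
  obtain ⟨u, hut, hdis, hcov⟩ := Vitali.exists_disjoint_subfamily_covering_enlargement_closedBall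
    (Set.Icc a b) (fun s => (p s + q s)/2) (fun s => (q s - p s)/2) (1/20)
    (fun s hs => by have := hl s hs; linarith) 4 (by norm_num)
  have hdis' : u.PairwiseDisjoint fun s => Set.Icc (p s) (q s) := by
    simpa only [hball] using hdis
  have hcount : u.Countable := by
    refine hdis'.countable_of_nonempty_interior ?_
    intro s hs
    rw [interior_Icc]
    exact Set.nonempty_Ioo.mpr (hpq s (hut hs))
  have hcov' : Set.Icc a b ⊆ ⋃ s ∈ u, Metric.closedBall ((p s + q s)/2) (4 * ((q s - p s)/2)) := by
    intro s hs
    obtain ⟨t, ht, hsub⟩ := hcov s hs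
    simp only [Set.mem_iUnion]
    refine ⟨t, ht, hsub ?_⟩
    rw [hball]; exact ⟨hps s hs, hsq s hs⟩
  set f := hφ.stieltjesFunction with hf
  have hI : ∀ s ∈ u, ENNReal.ofReal (4 * (q s - p s)) ≤
      ENNReal.ofReal (4 / c) * f.measure (Set.Icc (p s) (q s)) := by
    intro s hs
    rw [StieltjesFunction.measure_Icc, ← ENNReal.ofReal_mul (by positivity)]
    apply ENNReal.ofReal_le_ofReal
    have h1 : φ (q s) ≤ f (q s) := hφ.le_rightLim le_rfl
    have h2 : Function.leftLim f (p s) ≤ φ (p s) := by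
      refine le_of_tendsto (f.mono.tendsto_leftLim (p s)) ?_
      filter_upwards [self_mem_nhdsWithin] with x hx
      exact hφ.rightLim_le hx
    have h3 := hinc s (hut hs)
    rw [div_mul_eq_mul_div, le_div_iff₀ hc]
    nlinarith
  have hmain : ENNReal.ofReal (b - a) ≤ ENNReal.ofReal (4 / c * (φ (b + 1/5) - φ (a - 1/5))) := by
    calc ENNReal.ofReal (b - a) = MeasureTheory.volume (Set.Icc a b) := by rw [Real.volume_Icc]
      _ ≤ MeasureTheory.volume (⋃ s ∈ u,
            Metric.closedBall ((p s + q s)/2) (4 * ((q s - p s)/2))) :=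
          MeasureTheory.measure_mono hcov'
      _ ≤ ∑' s : u, MeasureTheory.volume
            (Metric.closedBall ((p s + q s)/2) (4 * ((q s - p s)/2))) :=
          MeasureTheory.measure_biUnion_le _ hcount _
      _ = ∑' s : u, ENNReal.ofReal (4 * (q s - p s)) := by
          congr 1; ext s; rw [Real.volume_closedBall]; congr 1; ring
      _ ≤ ∑' s : u, ENNReal.ofReal (4 / c) * f.measure (Set.Icc (p s) (q s)) :=
          ENNReal.tsum_le_tsum (fun s => hI s s.2)
      _ = ENNReal.ofReal (4 / c) * f.measure (⋃ s ∈ u, Set.Icc (p s) (q s)) := by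
          rw [ENNReal.tsum_mul_left, MeasureTheory.measure_biUnion hcount hdis'
            (fun _ _ => measurableSet_Icc)]
      _ ≤ ENNReal.ofReal (4 / c) * f.measure (Set.Ioc (a - 1/5) (b + 1/10)) := by
          gcongr
          refine Set.iUnion₂_subset fun s hs x hx => ?_
          have := hl s (hut hs); have h2 := hps s (hut hs); have h3 := hsq s (hut hs)
          have h4 := hut hs
          exact ⟨by linarith [hx.1, h4.1], by linarith [hx.2, h4.2]⟩
      _ ≤ _ := by
          rw [StieltjesFunction.measure_Ioc, ← ENNReal.ofReal_mul (by positivity)]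
          apply ENNReal.ofReal_le_ofReal
          have h1 : f (b + 1/10) ≤ φ (b + 1/5) := hφ.rightLim_le (by linarith)
          have h2 : φ (a - 1/5) ≤ f (a - 1/5) := hφ.le_rightLim le_rfl
          gcongr
  have hab0 : 0 ≤ b - a := by linarith
  have hnn : 0 ≤ φ (b + 1/5) - φ (a - 1/5) := by
    have := hφ (show a - 1/5 ≤ b + 1/5 by linarith); linarith
  rw [ENNReal.ofReal_le_ofReal_iff (by positivity)] at hmain
  rw [div_mul_eq_mul_div, le_div_iff₀ hc] at hmain
  linarith

lemma il_rep {N : ℕ} [NeZero N] (z : ZMod N) :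
    ∃ r : ℝ, ZMod.toAddCircle z = (r : UnitAddCircle) ∧ |r| = ‖ZMod.toAddCircle z‖ := by
  refine ⟨(z.val : ℝ) / N - round ((z.val : ℝ) / N), ?_, ?_⟩
  · rw [ZMod.toAddCircle_apply]
    symm
    rw [AddCircle.coe_sub, sub_eq_self, AddCircle.coe_eq_zero_iff]
    exact ⟨round ((z.val : ℝ) / N), by simp⟩
  · rw [ZMod.toAddCircle_apply, UnitAddCircle.norm_eq]

lemma il_norm_coe (r : ℝ) : ‖(r : UnitAddCircle)‖ ≤ |r| := by
  rw [UnitAddCircle.norm_eq]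
  simpa using round_le r 0

lemma il_doubling {N : ℕ} [NeZero N] (Γ : Finset (ZMod N)) (δ : ℝ) :
    (bohr N Γ (2 * δ)).card ≤ (bohr N Γ δ).card * 4 ^ Γ.card := by
  classical
  choose r hr hr' using fun z : ZMod N => il_rep z
  let c : ZMod N → (Γ → Fin 4) := fun x t =>
    if r (t * x) < -δ then 0 else if r (t * x) < 0 then 1 else if r (t * x) < δ then 2 else 3
  have h := Finset.card_le_mul_card_image_of_maps_to (f := c) (s := bohr N Γ (2 * δ))
    (t := Finset.univ) (fun _ _ => Finset.mem_univ _) (bohr N Γ δ).card ?_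
  · simpa using h
  · intro k _
    rcases Finset.eq_empty_or_nonempty ((bohr N Γ (2 * δ)).filter fun a => c a = k) with h0 | ⟨x0, hx0⟩
    · rw [h0]; simp
    · refine Finset.card_le_card_of_injOn (fun x => x - x0) ?_ (fun x _ y _ h => by simpa using h)
      intro x hx
      simp only [Finset.coe_filter, Set.mem_ofPred_eq, Finset.mem_filter] at hx hx0
      simp only [Finset.mem_coe]
      rw [il_mem_bohr]
      intro t ht
      have e1 := il_mem_bohr.mp hx.1 t ht
      have e0 := il_mem_bohr.mp hx0.1 t ht
      rw [← hr', abs_le] at e1 e0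
      have hc : c x ⟨t, ht⟩ = c x0 ⟨t, ht⟩ := by rw [hx.2, hx0.2]
      rw [mul_sub, map_sub, hr, hr (t * x0), ← AddCircle.coe_sub]
      refine (il_norm_coe _).trans ?_
      rw [abs_le]
      simp only [c] at hc
      split_ifs at hc <;> first | (exfalso; revert hc; decide) | constructor <;> linarith

lemma il_bad {N : ℕ} [NeZero N] (Γ : Finset (ZMod N)) (s : ℝ) (hg : 1 ≤ Γ.card)
    (h : ¬ BohrRegular N Γ (Real.exp s)) :
    ∃ p q, p < q ∧ p ≤ s ∧ s ≤ q ∧ q - p ≤ 1/10 ∧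
      (11 * Γ.card : ℝ) * (q - p) ≤ Real.log ((bohr N Γ (Real.exp q)).card)
        - Real.log ((bohr N Γ (Real.exp p)).card) := by
  unfold BohrRegular at h
  push Not at h
  obtain ⟨η, hη, hv⟩ := h
  have hg' : (1 : ℝ) ≤ Γ.card := by exact_mod_cast hg
  set g : ℝ := (Γ.card : ℝ) with hgdef
  have hηs : |η| ≤ 1/16 := by
    have := abs_nonneg η
    norm_num at hη
    nlinarith
  have hab := abs_le.mp hηs
  have h1η : 0 < 1 + η := by linarith
  have hB : ∀ r, 0 < ((bohr N Γ (Real.exp r)).card : ℝ) := fun r => il_bohr_pos (Real.exp_pos r).le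
  have hexp : (1 + η) * Real.exp s = Real.exp (s + Real.log (1 + η)) := by
    rw [Real.exp_add, Real.exp_log h1η, mul_comm]
  rw [hexp] at hv
  have hlog2 : (0.6931471803 : ℝ) < Real.log 2 := Real.log_two_gt_d9
  rcases lt_trichotomy η 0 with hn | hz | hp
  · -- left interval
    have hlt : Real.log (1 + η) < 0 := Real.log_neg h1η (by linarith)
    have habs : |η| = -η := abs_of_neg hn
    rw [habs] at hη hv
    have hmono : ((bohr N Γ (Real.exp (s + Real.log (1 + η)))).card : ℝ) ≤
        (bohr N Γ (Real.exp s)).card := by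
      exact_mod_cast Finset.card_le_card (il_bohr_mono (Real.exp_le_exp.mpr (by linarith)))
    have hv1 : ((bohr N Γ (Real.exp (s + Real.log (1 + η)))).card : ℝ) <
        (1 - 2 ^ 4 * g * -η) * (bohr N Γ (Real.exp s)).card := by
      by_contra hcon
      have := hv (not_lt.mp hcon)
      have h3 : 0 ≤ 2 ^ 4 * g * -η * (bohr N Γ (Real.exp s)).card := by
        have := hB s
        have : 0 < -η := by linarith
        positivity
      nlinarith
    have hy : 0 < 1 - 2 ^ 4 * g * -η := by
      by_contra hcon
      have := hB (s + Real.log (1 + η))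
      have h3 := hB s
      nlinarith
    have hl := Real.log_lt_log (hB _) hv1
    rw [Real.log_mul hy.ne' (hB s).ne'] at hl
    have h4 : Real.log (1 - 2 ^ 4 * g * -η) ≤ - (2 ^ 4 * g * -η) := by
      have := Real.log_le_sub_one_of_pos hy; linarith
    have h5 : 1 - (1 + η)⁻¹ ≤ Real.log (1 + η) := Real.one_sub_inv_le_log_of_pos h1η
    have h6 : (16/15) * η ≤ 1 - (1 + η)⁻¹ := by
      have : 1 - (1 + η)⁻¹ = η / (1 + η) := by field_simp; ring
      rw [this, le_div_iff₀ h1η]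
      nlinarith
    refine ⟨s + Real.log (1 + η), s, by linarith, by linarith, le_rfl, by linarith, ?_⟩
    have h7 : g * (16/15 * η) ≤ g * Real.log (1 + η) := by gcongr; linarith
    have h8 : g * η ≤ 0 := by nlinarith
    nlinarith
  · exfalso
    subst hz
    simp at hv
  · have hlt : 0 < Real.log (1 + η) := Real.log_pos (by linarith)
    have habs : |η| = η := abs_of_pos hp
    rw [habs] at hη hv
    have hmono : ((bohr N Γ (Real.exp s)).card : ℝ) ≤
        (bohr N Γ (Real.exp (s + Real.log (1 + η)))).card := by
      exact_mod_cast Finset.card_le_card (il_bohr_mono (Real.exp_le_exp.mpr (by linarith)))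
    have hv1 := hv (by
      have h3 : 0 ≤ 2 ^ 4 * g * η * (bohr N Γ (Real.exp s)).card := by
        have := hB s
        positivity
      nlinarith)
    have hy : 0 < 1 + 2 ^ 4 * g * η := by positivity
    have hl := Real.log_lt_log (by have := hB s; positivity) hv1
    rw [Real.log_mul hy.ne' (hB s).ne'] at hl
    have hy1 : 2 ^ 4 * g * η ≤ 1 := by norm_num at hη ⊢; linarith
    have h4 : (2 ^ 4 * g * η) * Real.log 2 ≤ Real.log (1 + 2 ^ 4 * g * η) := by
      have hcc := strictConcaveOn_log_Ioi.concaveOn.2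
      have hcv := hcc (show (1 : ℝ) ∈ Set.Ioi 0 by simp) (show (2 : ℝ) ∈ Set.Ioi 0 by simp)
        (show 0 ≤ 1 - 2 ^ 4 * g * η by linarith) (show 0 ≤ 2 ^ 4 * g * η by positivity) (by ring)
      simp only [smul_eq_mul, Real.log_one, mul_zero, zero_add, mul_one] at hcv
      rw [show 1 + 2 ^ 4 * g * η = (1 - 2 ^ 4 * g * η) + 2 ^ 4 * g * η * 2 by ring]
      exact hcv
    have h5 : Real.log (1 + η) ≤ η := by
      have := Real.log_le_sub_one_of_pos h1η; linarith
    refine ⟨s, s + Real.log (1 + η), by linarith, le_rfl, by linarith, by linarith, ?_⟩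
    have h7 : g * Real.log (1 + η) ≤ g * η := by gcongr
    have h8 : 0 ≤ g * η := by positivity
    nlinarith

lemma il_regular {N : ℕ} [NeZero N] (Γ : Finset (ZMod N)) {δ₀ : ℝ} (h0 : 0 < δ₀) :
    ∃ δ₁, δ₀ / 16 ≤ δ₁ ∧ δ₁ ≤ δ₀ ∧ BohrRegular N Γ δ₁ := by
  have hlog2 : (0.6931471803 : ℝ) < Real.log 2 := Real.log_two_gt_d9
  rcases Nat.eq_zero_or_pos Γ.card with hz | hg
  · refine ⟨δ₀, by linarith, le_rfl, ?_⟩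
    have : Γ = ∅ := Finset.card_eq_zero.mp hz
    subst this
    have hb : ∀ r, bohr N ∅ r = Finset.univ := by
      intro r; ext x; simp [il_mem_bohr]
    intro η _
    simp [hb]
  by_contra hcon
  push Not at hcon
  have hg' : (1 : ℝ) ≤ Γ.card := by exact_mod_cast hg
  set b := Real.log δ₀ with hb
  set a := b + 2/5 - 4 * Real.log 2 with ha
  have he16 : Real.exp (4 * Real.log 2) = 16 := by
    rw [show (4 : ℝ) * Real.log 2 = Real.log (2 ^ 4) by rw [Real.log_pow]; norm_num,
      Real.exp_log (by norm_num)]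
    norm_num
  have hB : ∀ r, 0 < ((bohr N Γ (Real.exp r)).card : ℝ) := fun r => il_bohr_pos (Real.exp_pos r).le
  have hv := il_vitali (fun s => Real.log ((bohr N Γ (Real.exp s)).card)) (by
      intro x y hxy
      apply Real.log_le_log (hB x)
      exact_mod_cast Finset.card_le_card (il_bohr_mono (Real.exp_le_exp.mpr hxy)))
    a b (11 * Γ.card) (by positivity) (by linarith) (by
      intro s hs
      apply il_bad Γ s hg
      apply hcon
      · have : δ₀ / 16 = Real.exp (b - 4 * Real.log 2) := by
          rw [Real.exp_sub, he16, hb, Real.exp_log h0]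
        rw [this]; apply Real.exp_le_exp.mpr; linarith [hs.1]
      · rw [← Real.exp_log h0]; exact Real.exp_le_exp.mpr hs.2)
  have hE : Real.exp (b + 1/5) = 2 * (2 * (2 * (2 * Real.exp (a - 1/5)))) := by
    have : b + 1/5 = (a - 1/5) + 4 * Real.log 2 := by rw [ha]; ring
    rw [this, Real.exp_add, he16]; ring
  have hd : ((bohr N Γ (Real.exp (b + 1/5))).card : ℝ) ≤
      (bohr N Γ (Real.exp (a - 1/5))).card * (256 : ℝ) ^ Γ.card := by
    rw [hE]
    set e := Real.exp (a - 1/5)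
    have h1 := il_doubling Γ (2 * (2 * (2 * e)))
    have h2 := il_doubling Γ (2 * (2 * e))
    have h3 := il_doubling Γ (2 * e)
    have h4 := il_doubling Γ e
    have h256 : (256 : ℕ) ^ Γ.card = 4 ^ Γ.card * 4 ^ Γ.card * 4 ^ Γ.card * 4 ^ Γ.card := by
      rw [← mul_pow, ← mul_pow, ← mul_pow]; norm_num
    have : (bohr N Γ (2 * (2 * (2 * (2 * e))))).card ≤ (bohr N Γ e).card * 256 ^ Γ.card := by
      rw [h256]
      calc _ ≤ _ := h1
        _ ≤ _ := Nat.mul_le_mul_right _ h2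
        _ ≤ _ := Nat.mul_le_mul_right _ (Nat.mul_le_mul_right _ h3)
        _ ≤ _ := Nat.mul_le_mul_right _ (Nat.mul_le_mul_right _ (Nat.mul_le_mul_right _ h4))
        _ = _ := by ring
    exact_mod_cast this
  have hl := Real.log_le_log (hB _) hd
  rw [Real.log_mul (hB _).ne' (by positivity), Real.log_pow,
    show (256 : ℝ) = 2 ^ 8 by norm_num, Real.log_pow] at hl
  push_cast at hl
  have : b - a = 4 * Real.log 2 - 2/5 := by rw [ha]; ring
  rw [this] at hv
  nlinarith


/-- Fourier sum of a finite set. -/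
noncomputable def ilF {N : ℕ} [NeZero N] (A : Finset (ZMod N)) (t : ZMod N) : ℂ :=
  ∑ a ∈ A, ilE (t * a)

lemma ilF_normSq {N : ℕ} [NeZero N] (A : Finset (ZMod N)) (t : ZMod N) :
    ((‖ilF A t‖ ^ 2 : ℝ) : ℂ) = ∑ p ∈ A ×ˢ A, ilE (t * (p.1 - p.2)) := by
  have h : ((‖ilF A t‖ ^ 2 : ℝ) : ℂ) = ilF A t * conj (ilF A t) := by
    rw [Complex.mul_conj, Complex.normSq_eq_norm_sq]
  rw [h, ilF, map_sum, Finset.sum_mul_sum, Finset.sum_product]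
  refine Finset.sum_congr rfl fun a _ => Finset.sum_congr rfl fun b _ => ?_
  rw [← ilE_neg, ← ilE_add]; congr 1; ring

lemma ilF_parseval {N : ℕ} [NeZero N] (A : Finset (ZMod N)) :
    ∑ t : ZMod N, ‖ilF A t‖ ^ 2 = N * A.card := by
  have : ((∑ t : ZMod N, ‖ilF A t‖ ^ 2 : ℝ) : ℂ) = ((N * A.card : ℝ) : ℂ) := by
    rw [Complex.ofReal_sum]
    simp_rw [ilF_normSq]
    rw [Finset.sum_comm]
    simp_rw [ilE_sum, sub_eq_zero]
    rw [Finset.sum_product]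
    simp
    ring
  exact_mod_cast this

lemma ilF_quad {N : ℕ} [NeZero N] (A B : Finset (ZMod N)) (x : ZMod N) :
    ∑ t : ZMod N, ((‖ilF A t‖ ^ 2 * ‖ilF B t‖ ^ 2 : ℝ) : ℂ) * ilE (t * x) =
      N * (((A ×ˢ A) ×ˢ (B ×ˢ B)).filter
        (fun p => p.1.1 - p.1.2 + (p.2.1 - p.2.2) + x = 0)).card := by
  have : ∀ t : ZMod N, ((‖ilF A t‖ ^ 2 * ‖ilF B t‖ ^ 2 : ℝ) : ℂ) * ilE (t * x) =
      ∑ p ∈ (A ×ˢ A) ×ˢ (B ×ˢ B), ilE (t * (p.1.1 - p.1.2 + (p.2.1 - p.2.2) + x)) := by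
    intro t
    rw [Complex.ofReal_mul, ilF_normSq, ilF_normSq, Finset.sum_mul_sum,
      Finset.sum_product (A ×ˢ A) (B ×ˢ B), Finset.sum_mul]
    refine Finset.sum_congr rfl fun a _ => ?_
    rw [Finset.sum_mul]
    refine Finset.sum_congr rfl fun b _ => ?_
    rw [← ilE_add, ← ilE_add]; congr 1; ring
  simp_rw [this]
  rw [Finset.sum_comm]
  simp_rw [ilE_sum]
  rw [← Finset.sum_filter, Finset.sum_const, nsmul_eq_mul, mul_comm]

lemma il_case1 {N : ℕ} [NeZero N] (A B : Finset (ZMod N)) (K : ℝ) (hA : A.Nonempty)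
    (hB : B.Nonempty) (hK : 1 ≤ K) (hAB : ((A + B).card : ℝ) ≤ K * B.card) (x : ZMod N)
    (h : ∀ t, (A.card : ℝ) ^ 2 ≤ 4 * K * ‖ilF A t‖ ^ 2 → ‖ilE (t * x) - 1‖ ≤ 1 / 2) :
    x ∈ (A - A) + (B - B) := by
  by_contra hx
  have hN : (0 : ℝ) < N := by exact_mod_cast NeZero.pos N
  have hA' : (0 : ℝ) < A.card := by exact_mod_cast hA.card_pos
  have hB' : (0 : ℝ) < B.card := by exact_mod_cast hB.card_pos
  have h1 := ilF_quad A B x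
  have hempty : ((A ×ˢ A) ×ˢ (B ×ˢ B)).filter
        (fun p => p.1.1 - p.1.2 + (p.2.1 - p.2.2) + x = 0) = ∅ := by
    rw [Finset.filter_eq_empty_iff]
    rintro ⟨⟨a, a'⟩, ⟨b, b'⟩⟩ hp heq
    simp only [Finset.mem_product] at hp heq
    apply hx
    rw [Finset.mem_add]
    refine ⟨a' - a, Finset.sub_mem_sub hp.1.2 hp.1.1, b' - b, Finset.sub_mem_sub hp.2.2 hp.2.1, ?_⟩
    linear_combination -heq
  rw [hempty] at h1
  have h1re : ∑ t : ZMod N, (‖ilF A t‖ ^ 2 * ‖ilF B t‖ ^ 2) * (ilE (t * x)).re = 0 := by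
    have := congrArg Complex.re h1
    simpa only [Complex.re_sum, Complex.re_ofReal_mul, Finset.card_empty, Nat.cast_zero, mul_zero,
      Complex.zero_re] using this
  have h2 := ilF_quad A B 0
  have hen : (((A ×ˢ A) ×ˢ (B ×ˢ B)).filter
        (fun p => p.1.1 - p.1.2 + (p.2.1 - p.2.2) + 0 = 0)).card = A.addEnergy B := by
    unfold Finset.addEnergy
    congr 1
    apply Finset.filter_congr
    rintro ⟨⟨a, a'⟩, ⟨b, b'⟩⟩ _
    simp only
    constructor <;> intro h <;> linear_combination h
  rw [hen] at h2
  have h2re : ∑ t : ZMod N, (‖ilF A t‖ ^ 2 * ‖ilF B t‖ ^ 2) = N * A.addEnergy B := by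
    have : ((∑ t : ZMod N, (‖ilF A t‖ ^ 2 * ‖ilF B t‖ ^ 2) : ℝ) : ℂ)
        = ((N * A.addEnergy B : ℝ) : ℂ) := by
      rw [Complex.ofReal_sum]
      simp only [mul_zero, ilE_zero, mul_one] at h2
      rw [h2]; push_cast; rfl
    exact_mod_cast this
  have hE : (A.card : ℝ) ^ 2 * B.card ≤ K * A.addEnergy B := by
    have := Finset.le_card_add_mul_addEnergy A B
    have h3 : (A.card : ℝ) ^ 2 * (B.card : ℝ) ^ 2 ≤ (A + B).card * A.addEnergy B := by
      exact_mod_cast this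
    have h4 : ((A + B).card : ℝ) * A.addEnergy B ≤ K * B.card * A.addEnergy B := by gcongr
    have : (B.card : ℝ) * ((A.card : ℝ) ^ 2 * B.card) ≤ B.card * (K * A.addEnergy B) := by nlinarith
    exact le_of_mul_le_mul_left this hB'
  have hpt : ∀ t : ZMod N, (‖ilF A t‖ ^ 2 * ‖ilF B t‖ ^ 2) / 2
      - 3 / 2 * ((A.card : ℝ) ^ 2 / (4 * K)) * ‖ilF B t‖ ^ 2 ≤
      (‖ilF A t‖ ^ 2 * ‖ilF B t‖ ^ 2) * (ilE (t * x)).re := by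
    intro t
    have hP : 0 ≤ ‖ilF B t‖ ^ 2 := by positivity
    have hQ : 0 ≤ ‖ilF A t‖ ^ 2 := by positivity
    have hR : 0 ≤ (A.card : ℝ) ^ 2 / (4 * K) := by positivity
    have hPQ : 0 ≤ ‖ilF A t‖ ^ 2 * ‖ilF B t‖ ^ 2 := by positivity
    have hPR := mul_nonneg hR hP
    by_cases hs : (A.card : ℝ) ^ 2 ≤ 4 * K * ‖ilF A t‖ ^ 2
    · have h5 := h t hs
      have h6 : 1 / 2 ≤ (ilE (t * x)).re := by
        have := (Complex.abs_re_le_norm (ilE (t * x) - 1)).trans h5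
        simp only [Complex.sub_re, Complex.one_re] at this
        have := (abs_le.mp this).1
        linarith
      nlinarith
    · have h5 : ‖ilF A t‖ ^ 2 ≤ (A.card : ℝ) ^ 2 / (4 * K) := by
        rw [le_div_iff₀ (by positivity)]; linarith
      have h6 : -1 ≤ (ilE (t * x)).re := by
        have := Complex.abs_re_le_norm (ilE (t * x))
        rw [ilE_norm] at this
        exact (abs_le.mp this).1
      have h7 := mul_le_mul_of_nonneg_right h5 hP
      nlinarith
  have hsum := Finset.sum_le_sum (fun t (_ : t ∈ (Finset.univ : Finset (ZMod N))) => hpt t)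
  rw [h1re, Finset.sum_sub_distrib, ← Finset.sum_div, h2re, ← Finset.mul_sum, ilF_parseval] at hsum
  have h8 : (A.card : ℝ) ^ 2 / (4 * K) * B.card ≤ A.addEnergy B / 4 := by
    rw [div_mul_eq_mul_div, div_le_iff₀ (by positivity)]
    linarith
  have h9 : (0 : ℝ) < A.addEnergy B := by
    have : 0 < (A.card : ℝ) ^ 2 * B.card := by positivity
    by_contra hc
    nlinarith
  have h10 : (N : ℝ) * (A.addEnergy B / 2 - 3 / 2 * ((A.card : ℝ) ^ 2 / (4 * K) * B.card)) ≤ 0 := by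
    linarith
  have h11 : 0 < A.addEnergy B / 2 - 3 / 2 * ((A.card : ℝ) ^ 2 / (4 * K) * B.card) := by linarith
  have := mul_pos hN h11
  linarith

lemma il_spec_small {N : ℕ} [NeZero N] (Γ : Finset (ZMod N)) {δ₁ : ℝ} (h1 : 0 < δ₁)
    (hreg : BohrRegular N Γ δ₁) (t x : ZMod N)
    (ht : ((bohr N Γ δ₁).card : ℝ) / 3 ≤ ‖ilF (bohr N Γ δ₁) t‖)
    (hx : x ∈ bohr N Γ (δ₁ / (256 * (1 + Γ.card)))) :
    ‖ilE (t * x) - 1‖ ≤ 3 / 8 := by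
  set D := bohr N Γ δ₁ with hD
  set I := D.image (fun y => x + y) with hI
  have hb : 0 < (D.card : ℝ) := il_bohr_pos h1.le
  have hIc : I.card = D.card := Finset.card_image_of_injective _ (add_right_injective x)
  set η : ℝ := 1 / (256 * (1 + Γ.card)) with hη
  have hη0 : 0 < η := by positivity
  have hgη : (Γ.card : ℝ) * η ≤ 1 / 256 := by
    rw [hη, mul_one_div, div_le_iff₀ (by positivity)]; linarith
  have hr := (hreg η (by rw [abs_of_pos hη0]; norm_num; linarith)).2
  rw [abs_of_pos hη0] at hr
  have hun : I ∪ D ⊆ bohr N Γ ((1 + η) * δ₁) := by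
    apply Finset.union_subset
    · intro z hz
      rw [hI, Finset.mem_image] at hz
      obtain ⟨y, hy, rfl⟩ := hz
      have := il_bohr_add hx hy
      convert this using 2
      rw [hη]; ring
    · apply il_bohr_mono; nlinarith
  have hc1 : ((I \ D).card : ℝ) ≤ 1 / 16 * D.card := by
    have e1 : ((I \ D).card : ℝ) + D.card = (I ∪ D).card := by
      exact_mod_cast Finset.card_sdiff_add_card I D
    have e2 : ((I ∪ D).card : ℝ) ≤ (bohr N Γ ((1 + η) * δ₁)).card := by
      exact_mod_cast Finset.card_le_card hun
    nlinarith
  have hc2 : ((D \ I).card : ℝ) ≤ 1 / 16 * D.card := by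
    have e1 : (D \ I).card = (I \ D).card := Finset.card_sdiff_comm hIc.symm
    rw [e1]; exact hc1
  have hdiff : (ilE (t * x) - 1) * ilF D t = ∑ z ∈ I \ D, ilE (t * z) - ∑ z ∈ D \ I, ilE (t * z) := by
    rw [Finset.sum_sdiff_sub_sum_sdiff, hI, Finset.sum_image (fun a _ b _ h => add_right_injective x h)]
    simp_rw [mul_add, ilE_add]
    rw [← Finset.mul_sum]; unfold ilF; ring
  have hs : ∀ S : Finset (ZMod N), ‖∑ z ∈ S, ilE (t * z)‖ ≤ S.card := by
    intro S
    refine (norm_sum_le _ _).trans ?_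
    simp [ilE_norm]
  have hn : ‖ilE (t * x) - 1‖ * ‖ilF D t‖ ≤ 1 / 8 * D.card := by
    rw [← norm_mul, hdiff]
    refine (norm_sub_le _ _).trans ?_
    have := hs (I \ D); have := hs (D \ I)
    linarith
  have h3 : ‖ilE (t * x) - 1‖ * (D.card / 3) ≤ 1 / 8 * D.card :=
    (mul_le_mul_of_nonneg_left ht (norm_nonneg _)).trans hn
  have : ‖ilE (t * x) - 1‖ * D.card ≤ 3 / 8 * D.card := by linarith
  exact le_of_mul_le_mul_right this hb

lemma il_diss_mono {N : ℕ} {T : Set (ZMod N)} {Λ S : Finset (ZMod N)}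
    (h : SDissociated T Λ) (hS : S ⊆ Λ) : SDissociated T S := by
  classical
  intro m hm hsum l hl
  have := h (fun z => if z ∈ S then m z else 0) (by
    intro l hl
    by_cases hlS : l ∈ S
    · simpa [hlS] using hm l hlS
    · simp [hlS]) (by
    have e : ∑ l ∈ Λ, (if l ∈ S then m l else 0) • l = ∑ l ∈ S, m l • l := by
      rw [← Finset.sum_subset hS]
      · exact Finset.sum_congr rfl (fun z hz => by simp [hz])
      · intro z _ hz; simp [hz]
    rw [e]; exact hsum) l (hS hl)
  simpa [hl] using this

lemma il_cover {N : ℕ} [NeZero N] {T : Set (ZMod N)} (hT0 : (0 : ZMod N) ∈ T)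
    (hTn : ∀ t ∈ T, -t ∈ T)
    {Λ : Finset (ZMod N)} (γ : ZMod N) (h : SDissociated T Λ)
    (hmax : γ ∉ Λ → ¬ SDissociated T (insert γ Λ)) (x : ZMod N) (c : ℝ)
    (hc : ∀ t ∈ T, ‖ilE (t * x) - 1‖ ≤ c) :
    ‖ilE (γ * x) - 1‖ ≤ c + ∑ l ∈ Λ, ‖ilE (l * x) - 1‖ := by
  classical
  have hc0 : 0 ≤ c := (norm_nonneg _).trans (hc 0 hT0)
  by_cases hγ : γ ∈ Λ
  · have := Finset.single_le_sum (f := fun l => ‖ilE (l * x) - 1‖) (fun l _ => norm_nonneg _) hγ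
    linarith
  · have hnd := hmax hγ
    unfold SDissociated at hnd
    push Not at hnd
    obtain ⟨m, hm, hsum, l, hl, hml⟩ := hnd
    rw [Finset.sum_insert hγ] at hsum
    have hmΛ : ∀ l ∈ Λ, m l = -1 ∨ m l = 0 ∨ m l = 1 := fun l hl => hm l (Finset.mem_insert_of_mem hl)
    have key : ∀ (t s : ZMod N), γ = t + s → ‖ilE (t * x) - 1‖ ≤ c →
        ‖ilE (s * x) - 1‖ ≤ ∑ l ∈ Λ, ‖ilE (l * x) - 1‖ →
        ‖ilE (γ * x) - 1‖ ≤ c + ∑ l ∈ Λ, ‖ilE (l * x) - 1‖ := by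
      intro t s hts h1 h2
      rw [hts, add_mul, ilE_add]
      calc ‖ilE (t * x) * ilE (s * x) - 1‖
          = ‖(ilE (t * x) - 1) * ilE (s * x) + (ilE (s * x) - 1)‖ := by congr 1; ring
        _ ≤ _ := by
          refine (norm_add_le _ _).trans ?_
          rw [norm_mul, ilE_norm, mul_one]
          exact add_le_add h1 h2
    have hneg : ‖ilE ((-∑ l ∈ Λ, m l • l) * x) - 1‖ ≤ ∑ l ∈ Λ, ‖ilE (l * x) - 1‖ := by
      have := ilE_smul Λ (fun l => - m l) x (by
        intro l hl
        rcases hmΛ l hl with h | h | h <;> simp [h])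
      simpa [neg_smul, Finset.sum_neg_distrib] using this
    rcases hm γ (Finset.mem_insert_self _ _) with h1 | h1 | h1
    · refine key (-(m γ • γ + ∑ l ∈ Λ, m l • l)) (∑ l ∈ Λ, m l • l) ?_ (hc _ (hTn _ hsum))
        (ilE_smul Λ m x hmΛ)
      rw [h1]; simp
    · exfalso
      rw [h1, zero_smul, zero_add] at hsum
      have := h m hmΛ hsum
      rcases Finset.mem_insert.mp hl with rfl | hl'
      · exact hml h1
      · exact hml (this l hl')
    · refine key (m γ • γ + ∑ l ∈ Λ, m l • l) (-∑ l ∈ Λ, m l • l) ?_ (hc _ hsum) hneg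
      rw [h1]; simp


lemma il_prod_lower {ι : Type*} (Λ : Finset ι) (z : ι → ℝ) (c : ℝ)
    (hz : ∀ l ∈ Λ, |z l| ≤ c) (hc : c ≤ 1/2) :
    1 + ∑ l ∈ Λ, (z l - 2 * c ^ 2) ≤ ∏ l ∈ Λ, (1 + z l) := by
  have h1 : ∏ l ∈ Λ, Real.exp (z l - 2 * c ^ 2) ≤ ∏ l ∈ Λ, (1 + z l) := by
    apply Finset.prod_le_prod (fun _ _ => (Real.exp_pos _).le)
    intro l hl
    have h := abs_le.mp (hz l hl)
    have hp : 0 < 1 + z l := by linarith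
    rw [← Real.le_log_iff_exp_le hp]
    refine le_trans ?_ (Real.one_sub_inv_le_log_of_pos hp)
    have e : 1 - (1 + z l)⁻¹ = z l / (1 + z l) := by field_simp; ring
    rw [e, le_div_iff₀ hp]
    have hzc : z l ^ 2 ≤ c ^ 2 := by
      rw [← sq_abs (z l)]; exact pow_le_pow_left₀ (abs_nonneg _) (hz l hl) 2
    nlinarith [sq_nonneg c]
  rw [← Real.exp_sum] at h1
  have := Real.add_one_le_exp (∑ l ∈ Λ, (z l - 2 * c ^ 2))
  linarith

lemma il_choose {ι α : Type*} [DecidableEq ι] (A : Finset α) (hA : A.Nonempty) (Λ : Finset ι)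
    (X : ι → α → ℝ) (hX : ∀ l a, |X l a| ≤ 1) (m : ℝ) (hm : 1 ≤ m)
    (hd1 : 32 * m ^ 3 ≤ Λ.card) (hd2 : (Λ.card : ℝ) ≤ 33 * m ^ 3)
    (hbig : ∀ l ∈ Λ, (A.card : ℝ) / (2 * m ^ 2) ≤ ∑ a ∈ A, X l a) (s₀ : ℕ) (hs : 64 * m ≤ s₀) :
    ∃ S ⊆ Λ, S.card ≤ s₀ ∧
      (1 + 1 / (2 * m)) * A.card ≤ ∑ a ∈ A, ∏ l ∈ S, (1 + X l a / 2) := by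
  by_contra hcon
  push Not at hcon
  have hA' : (0 : ℝ) < A.card := by exact_mod_cast hA.card_pos
  have hm0 : 0 < m := by linarith
  set t : ℝ := 1 / (4 * m ^ 2) with ht
  have ht0 : 0 < t := by positivity
  have ht1 : t ≤ 1 / 4 := by
    rw [ht, div_le_div_iff₀ (by positivity) (by norm_num)]; nlinarith
  have htm : t * (4 * m ^ 2) = 1 := by rw [ht]; field_simp
  set d : ℝ := (Λ.card : ℝ) with hd
  -- lower bound
  have hlow : (1 + 1 / m) * A.card ≤ ∑ a ∈ A, ∏ l ∈ Λ, (1 + t * X l a / 2) := by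
    have h1 : ∑ a ∈ A, (1 + ∑ l ∈ Λ, (t * X l a / 2 - 2 * (t / 2) ^ 2)) ≤
        ∑ a ∈ A, ∏ l ∈ Λ, (1 + t * X l a / 2) := by
      apply Finset.sum_le_sum
      intro a _
      apply il_prod_lower Λ (fun l => t * X l a / 2) (t / 2) _ (by linarith)
      intro l _
      simp only [abs_div, abs_mul, abs_of_pos ht0, abs_two]
      have := hX l a
      nlinarith
    refine le_trans ?_ h1
    rw [Finset.sum_add_distrib, Finset.sum_comm]
    have h2 : ∑ l ∈ Λ, (t ^ 2 / 2 * A.card) ≤ ∑ l ∈ Λ, ∑ a ∈ A, (t * X l a / 2 - 2 * (t / 2) ^ 2) := by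
      apply Finset.sum_le_sum
      intro l hl
      rw [Finset.sum_sub_distrib, ← Finset.sum_div, ← Finset.mul_sum]
      have h3 := hbig l hl
      have h4 : (A.card : ℝ) / (2 * m ^ 2) = 2 * t * A.card := by rw [ht]; field_simp; norm_num
      rw [h4] at h3
      simp only [Finset.sum_const, nsmul_eq_mul]
      nlinarith
    simp only [Finset.sum_const, nsmul_eq_mul, mul_one] at h2 ⊢
    have h5 : 1 / m ≤ d * (t ^ 2 / 2) := by
      rw [div_le_iff₀ hm0]
      have : 32 * m ^ 3 * (t ^ 2 / 2) * m = 1 := by rw [ht]; field_simp; norm_num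
      calc (1 : ℝ) = 32 * m ^ 3 * (t ^ 2 / 2) * m := this.symm
        _ ≤ d * (t ^ 2 / 2) * m := by gcongr
    have h6 := mul_le_mul_of_nonneg_right h5 hA'.le
    linarith
  -- expansion
  have hexp : ∑ a ∈ A, ∏ l ∈ Λ, (1 + t * X l a / 2) =
      ∑ S ∈ Λ.powerset, (t ^ S.card * (1 - t) ^ (Λ \ S).card) *
        ∑ a ∈ A, ∏ l ∈ S, (1 + X l a / 2) := by
    simp_rw [Finset.mul_sum]
    rw [Finset.sum_comm]
    apply Finset.sum_congr rfl
    intro a _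
    have : ∀ l, 1 + t * X l a / 2 = t * (1 + X l a / 2) + (1 - t) := by intro l; ring
    simp_rw [this]
    rw [Finset.prod_add]
    apply Finset.sum_congr rfl
    intro S _
    rw [Finset.prod_mul_distrib, Finset.prod_const, Finset.prod_const]; ring
  have hF : ∀ S ∈ Λ.powerset, ∑ a ∈ A, ∏ l ∈ S, (1 + X l a / 2) ≤
      (1 + 1 / (2 * m)) * A.card + 3 ^ S.card * ((2 ^ s₀)⁻¹ * A.card) := by
    intro S hS
    by_cases hc : S.card ≤ s₀
    · have := hcon S (Finset.mem_powerset.mp hS) hc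
      have h0 : 0 ≤ (3 : ℝ) ^ S.card * ((2 ^ s₀)⁻¹ * A.card) := by positivity
      linarith
    · have h1 : ∑ a ∈ A, ∏ l ∈ S, (1 + X l a / 2) ≤ ∑ a ∈ A, (3 / 2 : ℝ) ^ S.card := by
        apply Finset.sum_le_sum
        intro a _
        rw [← Finset.prod_const]
        apply Finset.prod_le_prod
        · intro l _; have := abs_le.mp (hX l a); linarith
        · intro l _; have := abs_le.mp (hX l a); linarith
      rw [Finset.sum_const, nsmul_eq_mul] at h1
      have h2 : (3 / 2 : ℝ) ^ S.card ≤ 3 ^ S.card * (2 ^ s₀)⁻¹ := by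
        rw [div_pow, div_eq_mul_inv]
        gcongr
        · norm_num
        · omega
      have h3 : (A.card : ℝ) * (3 / 2 : ℝ) ^ S.card ≤ A.card * (3 ^ S.card * (2 ^ s₀)⁻¹) := by gcongr
      have h4 : 0 ≤ (1 + 1 / (2 * m)) * A.card := by positivity
      linarith
  have hup : ∑ S ∈ Λ.powerset, (t ^ S.card * (1 - t) ^ (Λ \ S).card) *
        ∑ a ∈ A, ∏ l ∈ S, (1 + X l a / 2) ≤
      ∑ S ∈ Λ.powerset, (t ^ S.card * (1 - t) ^ (Λ \ S).card) *
        ((1 + 1 / (2 * m)) * A.card + 3 ^ S.card * ((2 ^ s₀)⁻¹ * A.card)) := by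
    apply Finset.sum_le_sum
    intro S hS
    apply mul_le_mul_of_nonneg_left (hF S hS)
    have : 0 ≤ 1 - t := by linarith
    positivity
  have hs1 : ∑ S ∈ Λ.powerset, t ^ S.card * (1 - t) ^ (Λ \ S).card = 1 := by
    have := Finset.prod_add (fun _ : ι => t) (fun _ => 1 - t) Λ
    simp only [Finset.prod_const] at this
    rw [← this]; simp
  have hs2 : ∑ S ∈ Λ.powerset, (t ^ S.card * (1 - t) ^ (Λ \ S).card) * 3 ^ S.card
      = (1 + 2 * t) ^ Λ.card := by
    have := Finset.prod_add (fun _ : ι => t * 3) (fun _ => 1 - t) Λ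
    simp only [Finset.prod_const] at this
    rw [show 1 + 2 * t = t * 3 + (1 - t) by ring, this]
    apply Finset.sum_congr rfl
    intro S _
    rw [mul_pow]; ring
  have hs3 : ∑ S ∈ Λ.powerset, (t ^ S.card * (1 - t) ^ (Λ \ S).card) *
        ((1 + 1 / (2 * m)) * A.card + 3 ^ S.card * ((2 ^ s₀)⁻¹ * A.card))
      = (1 + 1 / (2 * m)) * A.card + (1 + 2 * t) ^ Λ.card * ((2 ^ s₀)⁻¹ * A.card) := by
    simp_rw [mul_add, ← mul_assoc]
    rw [Finset.sum_add_distrib, ← hs2]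
    simp_rw [← Finset.sum_mul]
    rw [hs1]; ring
  have htail : (1 + 2 * t) ^ Λ.card * (2 ^ s₀)⁻¹ < 1 / (2 * m) := by
    have h1 : (1 + 2 * t) ^ Λ.card ≤ Real.exp (17 * m) := by
      calc (1 + 2 * t) ^ Λ.card ≤ (Real.exp (2 * t)) ^ Λ.card := by
            gcongr; have := Real.add_one_le_exp (2 * t); linarith
        _ = Real.exp (d * (2 * t)) := by rw [← Real.exp_nat_mul]
        _ ≤ Real.exp (17 * m) := by
            apply Real.exp_le_exp.mpr
            calc d * (2 * t) ≤ 33 * m ^ 3 * (2 * t) := by gcongr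
              _ = 33 / 2 * m := by rw [ht]; field_simp; norm_num
              _ ≤ 17 * m := by linarith
    have h2 : Real.exp (32 * m) ≤ 2 ^ s₀ := by
      have : (2 : ℝ) ^ s₀ = Real.exp (s₀ * Real.log 2) := by
        rw [Real.exp_nat_mul, Real.exp_log (by norm_num)]
      rw [this]
      apply Real.exp_le_exp.mpr
      have := Real.log_two_gt_d9
      nlinarith
    have h3 : 2 * m < Real.exp (15 * m) := by
      have := Real.add_one_le_exp (15 * m); linarith
    rw [← div_eq_mul_inv, div_lt_div_iff₀ (by positivity) (by positivity), one_mul]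
    calc (1 + 2 * t) ^ Λ.card * (2 * m) ≤ Real.exp (17 * m) * (2 * m) := by gcongr
      _ < Real.exp (17 * m) * Real.exp (15 * m) := by gcongr
      _ = Real.exp (32 * m) := by rw [← Real.exp_add]; congr 1; ring
      _ ≤ 2 ^ s₀ := h2
  have hfin := mul_lt_mul_of_pos_right htail hA'
  have e : (1 : ℝ) / m = 1 / (2 * m) + 1 / (2 * m) := by field_simp; norm_num
  rw [hexp] at hlow
  rw [hs3] at hup
  rw [e] at hlow
  linarith

lemma il_kernel {N : ℕ} [NeZero N] (Γ : Finset (ZMod N)) {δ₁ : ℝ} (h1 : 0 < δ₁) (k : ℕ) :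
    ∃ κ : ZMod N → ℝ, (∀ z, 0 ≤ κ z) ∧ (∀ z, κ z ≠ 0 → z ∈ bohr N Γ (k * δ₁)) ∧ ∑ z, κ z = 1 ∧
      ∀ t, ∑ z, (κ z : ℂ) * ilE (t * z) = (ilF (bohr N Γ δ₁) t / (bohr N Γ δ₁).card) ^ k := by
  classical
  set D := bohr N Γ δ₁ with hD
  have hb : 0 < (D.card : ℝ) := il_bohr_pos h1.le
  induction k with
  | zero =>
    refine ⟨fun z => if z = 0 then 1 else 0, ?_, ?_, ?_, ?_⟩
    · intro z; positivity
    · intro z hz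
      have : z = 0 := by by_contra h; simp [h] at hz
      rw [this]; exact il_zero_mem (by simp)
    · simp
    · intro t
      rw [Finset.sum_eq_single 0]
      · simp [ilE_zero]
      · intro b _ hb; simp [hb]
      · simp
  | succ k ih =>
    obtain ⟨κ, h0, hs, h1', hf⟩ := ih
    refine ⟨fun z => (D.card : ℝ)⁻¹ * ∑ y ∈ D, κ (z - y), ?_, ?_, ?_, ?_⟩
    · intro z
      have : 0 ≤ ∑ y ∈ D, κ (z - y) := Finset.sum_nonneg (fun y _ => h0 _)
      positivity
    · intro z hz
      have : ∃ y ∈ D, κ (z - y) ≠ 0 := by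
        by_contra h
        push Not at h
        apply hz
        simp only
        rw [Finset.sum_eq_zero h, mul_zero]
      obtain ⟨y, hy, hy'⟩ := this
      have := il_bohr_add (hs _ hy') hy
      rw [sub_add_cancel] at this
      convert this using 2
      push_cast; ring
    · rw [← Finset.mul_sum, Finset.sum_comm]
      have : ∀ y ∈ D, ∑ z, κ (z - y) = 1 := by
        intro y _
        rw [← h1']
        exact Fintype.sum_equiv (Equiv.subRight y) _ _ (fun z => rfl)
      rw [Finset.sum_congr rfl this]
      simp
      field_simp
    · intro t
      have : ∀ y ∈ D, ∑ z, (κ (z - y) : ℂ) * ilE (t * z) = ilE (t * y) *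
          (ilF D t / D.card) ^ k := by
        intro y _
        rw [← hf t, Finset.mul_sum]
        refine Fintype.sum_equiv (Equiv.subRight y) _ _ (fun z => ?_)
        simp only [Equiv.subRight_apply]
        rw [show t * z = t * y + t * (z - y) by ring, ilE_add]; ring
      calc ∑ z, (((D.card : ℝ)⁻¹ * ∑ y ∈ D, κ (z - y) : ℝ) : ℂ) * ilE (t * z)
          = ∑ z, ∑ y ∈ D, (D.card : ℂ)⁻¹ * ((κ (z - y) : ℂ) * ilE (t * z)) := by
            apply Finset.sum_congr rfl; intro z _
            push_cast
            rw [Finset.mul_sum, Finset.sum_mul]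
            apply Finset.sum_congr rfl; intro y _; ring
        _ = (D.card : ℂ)⁻¹ * ∑ y ∈ D, ∑ z, (κ (z - y) : ℂ) * ilE (t * z) := by
            rw [Finset.sum_comm, Finset.mul_sum]
            apply Finset.sum_congr rfl; intro y _; rw [Finset.mul_sum]
        _ = (D.card : ℂ)⁻¹ * (ilF D t * (ilF D t / D.card) ^ k) := by
            rw [Finset.sum_congr rfl this, ← Finset.sum_mul]; rfl
        _ = _ := by rw [pow_succ]; ring

/-- Riesz product. -/
noncomputable def ilP {N : ℕ} [NeZero N] (ω : ZMod N → ℂ) (S : Finset (ZMod N)) (x : ZMod N) : ℝ :=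
  ∏ l ∈ S, (1 + (ω l * ilE (l * x)).re / 2)

lemma ilP_insert {N : ℕ} [NeZero N] (ω : ZMod N → ℂ) (S : Finset (ZMod N)) (x l : ZMod N)
    (hl : l ∉ S) : (ilP ω (insert l S) x : ℂ) = ilP ω S x
      + ω l / 4 * (ilE (l * x) * ilP ω S x) + conj (ω l) / 4 * (ilE (-l * x) * ilP ω S x) := by
  unfold ilP
  rw [Finset.prod_insert hl]
  have : (((ω l * ilE (l * x)).re : ℝ) : ℂ) =
      (ω l * ilE (l * x) + conj (ω l) * ilE (-l * x)) / 2 := by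
    rw [neg_mul, ilE_neg, ← map_mul, Complex.add_conj]; push_cast; ring
  push_cast
  rw [this]; ring

lemma il_riesz1 {N : ℕ} [NeZero N] (T : Set (ZMod N)) (κ : ZMod N → ℝ) (τ : ℝ)
    (hκ : ∀ t, t ∉ T → ‖∑ z, (κ z : ℂ) * ilE (t * z)‖ ≤ τ)
    (ω : ZMod N → ℂ) (hω : ∀ l, ‖ω l‖ = 1) (x : ZMod N) (S : Finset (ZMod N)) :
    ∀ r : ZMod N, (∀ m : ZMod N → ℤ, (∀ l ∈ S, m l = -1 ∨ m l = 0 ∨ m l = 1) →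
      r + ∑ l ∈ S, m l • l ∉ T) →
      ‖∑ z, (κ z : ℂ) * (ilE (r * (x + z)) * ilP ω S (x + z))‖ ≤ (3/2) ^ S.card * τ := by
  classical
  induction S using Finset.induction_on with
  | empty =>
    intro r hr
    have h := hκ r (by simpa using hr (fun _ => 0) (by simp))
    simp only [ilP, Finset.prod_empty, Complex.ofReal_one, mul_one, Finset.card_empty, pow_zero,
      one_mul, mul_add, ilE_add]
    have : ∑ z, (κ z : ℂ) * (ilE (r * x) * ilE (r * z)) = ilE (r * x) * ∑ z, (κ z : ℂ) * ilE (r * z) := by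
      rw [Finset.mul_sum]; apply Finset.sum_congr rfl; intro z _; ring
    rw [this, norm_mul, ilE_norm, one_mul]; exact h
  | insert l S hl ih =>
    intro r hr
    have step : ∀ j : ℤ, (j = -1 ∨ j = 0 ∨ j = 1) →
        ‖∑ z, (κ z : ℂ) * (ilE ((r + j • l) * (x + z)) * ilP ω S (x + z))‖ ≤ (3/2) ^ S.card * τ := by
      intro j hj
      apply ih
      intro m hm
      have := hr (Function.update m l j) (by
        intro l' hl'
        by_cases h : l' = l
        · subst h; simpa using hj
        · rw [Function.update_of_ne h]; exact hm l' (Finset.mem_of_mem_insert_of_ne hl' h))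
      rw [Finset.sum_insert hl, Function.update_self, ← add_assoc] at this
      convert this using 2
      congr 1
      apply Finset.sum_congr rfl
      intro l' hl'
      rw [Function.update_of_ne (by rintro rfl; exact hl hl')]
    have h0 := step 0 (by simp)
    have h1 := step 1 (by simp)
    have h2 := step (-1) (by simp)
    have e : ∑ z, (κ z : ℂ) * (ilE (r * (x + z)) * ilP ω (insert l S) (x + z)) =
        ∑ z, (κ z : ℂ) * (ilE ((r + (0 : ℤ) • l) * (x + z)) * ilP ω S (x + z))
        + ω l / 4 * ∑ z, (κ z : ℂ) * (ilE ((r + (1 : ℤ) • l) * (x + z)) * ilP ω S (x + z))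
        + conj (ω l) / 4 *
          ∑ z, (κ z : ℂ) * (ilE ((r + (-1 : ℤ) • l) * (x + z)) * ilP ω S (x + z)) := by
      rw [Finset.mul_sum, Finset.mul_sum, ← Finset.sum_add_distrib, ← Finset.sum_add_distrib]
      apply Finset.sum_congr rfl
      intro z _
      rw [ilP_insert _ _ _ _ hl]
      simp only [zero_smul, add_zero, one_smul, neg_smul, add_mul, ilE_add]
      ring
    rw [e, Finset.card_insert_of_notMem hl, pow_succ]
    refine (norm_add₃_le).trans ?_
    rw [norm_mul, norm_mul, norm_div, norm_div, Complex.norm_conj, hω]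
    norm_num at h0 h1 h2 ⊢
    linarith

lemma il_riesz2 {N : ℕ} [NeZero N] (T : Set (ZMod N)) (κ : ZMod N → ℝ) (τ : ℝ) (hτ : 0 ≤ τ)
    (hκ1 : ∑ z, κ z = 1)
    (hκ : ∀ t, t ∉ T → ‖∑ z, (κ z : ℂ) * ilE (t * z)‖ ≤ τ)
    (ω : ZMod N → ℂ) (hω : ∀ l, ‖ω l‖ = 1) (x : ZMod N) (S : Finset (ZMod N)) :
    SDissociated T S →
      ‖∑ z, (κ z : ℂ) * ilP ω S (x + z) - 1‖ ≤ (3/2) ^ S.card * τ := by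
  classical
  induction S using Finset.induction_on with
  | empty =>
    intro _
    have : ∑ z, (κ z : ℂ) = 1 := by exact_mod_cast hκ1
    simp [ilP, this, hτ]
  | insert l S hl ih =>
    intro hd
    have h0 := ih (il_diss_mono hd (Finset.subset_insert _ _))
    have step : ∀ j : ℤ, (j = -1 ∨ j = 1) →
        ‖∑ z, (κ z : ℂ) * (ilE ((j • l) * (x + z)) * ilP ω S (x + z))‖ ≤ (3/2) ^ S.card * τ := by
      intro j hj
      apply il_riesz1 T κ τ hκ ω hω x S
      intro m hm hmem
      have := hd (Function.update m l j) (by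
        intro l' hl'
        by_cases h : l' = l
        · subst h; rw [Function.update_self]; tauto
        · rw [Function.update_of_ne h]; exact hm l' (Finset.mem_of_mem_insert_of_ne hl' h)) (by
        rw [Finset.sum_insert hl, Function.update_self]
        convert hmem using 2
        apply Finset.sum_congr rfl
        intro l' hl'
        rw [Function.update_of_ne (by rintro rfl; exact hl hl')]) l (Finset.mem_insert_self _ _)
      rw [Function.update_self] at this
      omega
    have h1 := step 1 (by simp)
    have h2 := step (-1) (by simp)
    have e : ∑ z, (κ z : ℂ) * ilP ω (insert l S) (x + z) - 1 =
        (∑ z, (κ z : ℂ) * ilP ω S (x + z) - 1)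
        + ω l / 4 * ∑ z, (κ z : ℂ) * (ilE (((1 : ℤ) • l) * (x + z)) * ilP ω S (x + z))
        + conj (ω l) / 4 *
          ∑ z, (κ z : ℂ) * (ilE (((-1 : ℤ) • l) * (x + z)) * ilP ω S (x + z)) := by
      have : ∑ z, (κ z : ℂ) * ilP ω (insert l S) (x + z) =
        ∑ z, (κ z : ℂ) * ilP ω S (x + z)
        + ω l / 4 * ∑ z, (κ z : ℂ) * (ilE (((1 : ℤ) • l) * (x + z)) * ilP ω S (x + z))
        + conj (ω l) / 4 *
          ∑ z, (κ z : ℂ) * (ilE (((-1 : ℤ) • l) * (x + z)) * ilP ω S (x + z)) := by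
        rw [Finset.mul_sum, Finset.mul_sum, ← Finset.sum_add_distrib, ← Finset.sum_add_distrib]
        apply Finset.sum_congr rfl
        intro z _
        rw [ilP_insert _ _ _ _ hl]
        simp only [one_smul, neg_smul]
        ring
      rw [this]; ring
    rw [e, Finset.card_insert_of_notMem hl, pow_succ]
    refine (norm_add₃_le).trans ?_
    rw [norm_mul, norm_mul, norm_div, norm_div, Complex.norm_conj, hω]
    norm_num at h0 h1 h2 ⊢
    linarith

lemma il_final {N : ℕ} [NeZero N] (κ P : ZMod N → ℝ) (A A' B0 B1 E : Finset (ZMod N))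
    (θ e1 e2 : ℝ) (hκ0 : ∀ z, 0 ≤ κ z) (hκ1 : ∑ z, κ z = 1) (hP0 : ∀ x, 0 ≤ P x)
    (hP : ∀ x, ∑ z, κ z * P (x + z) ≤ 1 + e1)
    (hsup : ∀ z, κ z ≠ 0 → ∀ y ∈ B0, y - z ∈ B1)
    (hE : ∀ a ∈ A', ∀ y ∈ E, a - y ∈ B0) (hA : A' ⊆ A)
    (hPy : ∀ a ∈ A', ∀ y ∈ E, (1 - e2) * P a ≤ P (a - y))
    (hEne : E.Nonempty) (hθ0 : 0 ≤ θ)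
    (hθ : ∀ x : ZMod N, ((A ∩ E.image (fun y => x + y)).card : ℝ) ≤ θ * E.card) :
    (1 - e2) * ∑ a ∈ A', P a ≤ θ * (1 + e1) * B1.card := by
  classical
  have hE' : (0 : ℝ) < E.card := by exact_mod_cast hEne.card_pos
  set h : ZMod N → ℝ := fun x => ((A ∩ E.image (fun y => x + y)).card : ℝ) with hh
  have hh0 : ∀ x, 0 ≤ h x := fun x => Nat.cast_nonneg _
  have hhs : ∀ x, h x = ∑ y ∈ E, if x + y ∈ A then (1 : ℝ) else 0 := by
    intro x
    simp only [hh]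
    rw [Finset.sum_boole, Finset.inter_comm, ← Finset.filter_mem_eq_inter, Finset.filter_image,
      Finset.card_image_of_injective _ (add_right_injective x)]
  have up : ∑ x ∈ B1, ∑ z, κ z * (P (x + z) * h (x + z)) ≤ θ * E.card * (1 + e1) * B1.card := by
    have : ∀ x ∈ B1, ∑ z, κ z * (P (x + z) * h (x + z)) ≤ θ * E.card * (1 + e1) := by
      intro x _
      calc ∑ z, κ z * (P (x + z) * h (x + z)) ≤ ∑ z, θ * E.card * (κ z * P (x + z)) := by
            apply Finset.sum_le_sum; intro z _
            have h1 := hθ (x + z)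
            have h2 : 0 ≤ κ z * P (x + z) := mul_nonneg (hκ0 _) (hP0 _)
            have := mul_le_mul_of_nonneg_left h1 h2
            simp only [hh]
            linarith
        _ = θ * E.card * ∑ z, κ z * P (x + z) := by rw [Finset.mul_sum]
        _ ≤ _ := mul_le_mul_of_nonneg_left (hP x) (by positivity)
    have := Finset.sum_le_sum this
    rw [Finset.sum_const, nsmul_eq_mul] at this
    linarith
  have low1 : ∑ u ∈ B0, P u * h u ≤ ∑ x ∈ B1, ∑ z, κ z * (P (x + z) * h (x + z)) := by
    rw [Finset.sum_comm]
    have : ∀ z ∈ (Finset.univ : Finset (ZMod N)), κ z * ∑ u ∈ B0, P u * h u ≤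
        ∑ x ∈ B1, κ z * (P (x + z) * h (x + z)) := by
      intro z _
      by_cases hz : κ z = 0
      · simp [hz]
      rw [← Finset.mul_sum]
      apply mul_le_mul_of_nonneg_left _ (hκ0 z)
      have e : ∑ u ∈ B0, P u * h u = ∑ x ∈ B0.image (fun y => y - z), P (x + z) * h (x + z) := by
        rw [Finset.sum_image (fun a _ b _ hab => sub_left_injective hab)]
        simp
      rw [e]
      apply Finset.sum_le_sum_of_subset_of_nonneg
      · intro w hw
        obtain ⟨y, hy, rfl⟩ := Finset.mem_image.mp hw
        exact hsup z hz y hy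
      · intro i _ _; exact mul_nonneg (hP0 _) (hh0 _)
    have := Finset.sum_le_sum this
    rw [← Finset.sum_mul, hκ1, one_mul] at this
    exact this
  have low2 : E.card * ((1 - e2) * ∑ a ∈ A', P a) ≤ ∑ u ∈ B0, P u * h u := by
    have e : ∑ u ∈ B0, P u * h u = ∑ y ∈ E, ∑ u ∈ B0, P u * (if u + y ∈ A then (1 : ℝ) else 0) := by
      rw [Finset.sum_comm]
      apply Finset.sum_congr rfl; intro u _; rw [hhs, Finset.mul_sum]
    rw [e, ← nsmul_eq_mul, ← Finset.sum_const]
    apply Finset.sum_le_sum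
    intro y hy
    calc (1 - e2) * ∑ a ∈ A', P a ≤ ∑ a ∈ A', P (a - y) := by
          rw [Finset.mul_sum]; exact Finset.sum_le_sum (fun a ha => hPy a ha y hy)
      _ = ∑ u ∈ A'.image (fun a => a - y), P u * (if u + y ∈ A then (1 : ℝ) else 0) := by
          rw [Finset.sum_image (fun a _ b _ hab => sub_left_injective hab)]
          apply Finset.sum_congr rfl
          intro a ha
          simp [hA ha]
      _ ≤ _ := by
          apply Finset.sum_le_sum_of_subset_of_nonneg
          · intro w hw
            obtain ⟨a, ha, rfl⟩ := Finset.mem_image.mp hw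
            exact hE a ha y hy
          · intro i _ _; exact mul_nonneg (hP0 _) (by positivity)
  have : E.card * ((1 - e2) * ∑ a ∈ A', P a) ≤ E.card * (θ * (1 + e1) * B1.card) := by linarith
  exact le_of_mul_le_mul_left this hE'


lemma ilF_neg {N : ℕ} [NeZero N] (A : Finset (ZMod N)) (t : ZMod N) :
    ‖ilF A (-t)‖ = ‖ilF A t‖ := by
  have : ilF A (-t) = conj (ilF A t) := by
    unfold ilF
    rw [map_sum]
    apply Finset.sum_congr rfl
    intro a _
    rw [neg_mul, ilE_neg]
  rw [this, Complex.norm_conj]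

lemma ilF_zero {N : ℕ} [NeZero N] (A : Finset (ZMod N)) : ‖ilF A 0‖ = A.card := by
  simp [ilF, ilE_zero]

lemma il_maxdiss {N : ℕ} [NeZero N] (T : Set (ZMod N)) (Q : ZMod N → Prop) :
    ∃ Λ : Finset (ZMod N), (∀ l ∈ Λ, Q l) ∧ SDissociated T Λ ∧
      ∀ γ, Q γ → γ ∉ Λ → ¬ SDissociated T (insert γ Λ) := by
  classical
  set F := (Finset.univ : Finset (Finset (ZMod N))).filter
    (fun Λ => (∀ l ∈ Λ, Q l) ∧ SDissociated T Λ) with hF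
  have hne : F.Nonempty := ⟨∅, by
    rw [hF, Finset.mem_filter]
    refine ⟨Finset.mem_univ _, by simp, ?_⟩
    intro m _ _ l hl
    simp at hl⟩
  obtain ⟨Λ, hΛ, hmax⟩ := Finset.exists_max_image F Finset.card hne
  rw [hF, Finset.mem_filter] at hΛ
  refine ⟨Λ, hΛ.2.1, hΛ.2.2, ?_⟩
  intro γ hγ hn hd
  have := hmax (insert γ Λ) (by
    rw [hF, Finset.mem_filter]
    refine ⟨Finset.mem_univ _, ?_, hd⟩
    intro l hl
    rcases Finset.mem_insert.mp hl with rfl | h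
    · exact hγ
    · exact hΛ.2.1 l h)
  rw [Finset.card_insert_of_notMem hn] at this
  omega

lemma il_small {N : ℕ} [NeZero N] (Γ : Finset (ZMod N)) {δ₁ m : ℝ} (h1 : 0 < δ₁) (hm : 1 ≤ m)
    (hreg : BohrRegular N Γ δ₁) (A B : Finset (ZMod N)) (hA : A.Nonempty) (hB : B.Nonempty)
    (hAB : ((A + B).card : ℝ) ≤ m ^ 4 * B.card) (Λ : Finset (ZMod N))
    (hd : SDissociated {t | ((bohr N Γ δ₁).card : ℝ) / 3 ≤ ‖ilF (bohr N Γ δ₁) t‖} Λ)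
    (hmax : ∀ γ, (A.card : ℝ) ^ 2 ≤ 4 * m ^ 4 * ‖ilF A γ‖ ^ 2 → γ ∉ Λ →
      ¬ SDissociated {t | ((bohr N Γ δ₁).card : ℝ) / 3 ≤ ‖ilF (bohr N Γ δ₁) t‖} (insert γ Λ))
    (hΛ : (Λ.card : ℝ) ≤ 33 * m ^ 3) :
    bohr N Γ (δ₁ / (256 * (1 + Γ.card))) ∩ bohr N Λ (1 / (2048 * m ^ 4)) ⊆ (A - A) + (B - B) := by
  intro x hx
  obtain ⟨hx1, hx2⟩ := Finset.mem_inter.mp hx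
  have hm4 : 1 ≤ m ^ 4 := one_le_pow₀ hm
  have hb : 0 < ((bohr N Γ δ₁).card : ℝ) := il_bohr_pos h1.le
  apply il_case1 A B (m ^ 4) hA hB hm4 hAB
  intro t ht
  have h2 := il_cover (T := {t | ((bohr N Γ δ₁).card : ℝ) / 3 ≤ ‖ilF (bohr N Γ δ₁) t‖})
    (by rw [Set.mem_ofPred_eq, ilF_zero]; linarith)
    (by intro t ht; rw [Set.mem_ofPred_eq, ilF_neg]; exact ht) t hd (hmax t ht) x (3 / 8)
    (fun t ht => il_spec_small Γ h1 hreg t x ht hx1)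
  have h3 : ∑ l ∈ Λ, ‖ilE (l * x) - 1‖ ≤ ∑ l ∈ Λ, 2 * Real.pi * (1 / (2048 * m ^ 4)) := by
    apply Finset.sum_le_sum
    intro l hl
    refine (ilE_sub_one _).trans ?_
    have := il_mem_bohr.mp hx2 l hl
    have := Real.pi_pos
    gcongr
  rw [Finset.sum_const, nsmul_eq_mul] at h3
  have h4 : (Λ.card : ℝ) * (2 * Real.pi * (1 / (2048 * m ^ 4))) ≤ 1 / 8 := by
    have hpi : Real.pi ≤ 3.15 := Real.pi_lt_d2.le
    calc (Λ.card : ℝ) * (2 * Real.pi * (1 / (2048 * m ^ 4)))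
        ≤ 33 * m ^ 3 * (2 * 3.15 * (1 / (2048 * m ^ 4))) := by gcongr
      _ = (207.9 / 2048) * (1 / m) := by field_simp; norm_num
      _ ≤ (207.9 / 2048) * 1 := by
          have : 1 / m ≤ 1 := by rw [div_le_one (by linarith)]; exact hm
          gcongr
      _ ≤ 1 / 8 := by norm_num
  linarith

lemma il_omega (z : ℂ) : ∃ w : ℂ, ‖w‖ = 1 ∧ w * z = ‖z‖ := by
  by_cases h : z = 0
  · exact ⟨1, by simp, by simp [h]⟩
  · have h' : ‖z‖ ≠ 0 := by simpa using h
    refine ⟨conj z / ‖z‖, ?_, ?_⟩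
    · rw [norm_div, Complex.norm_conj, Complex.norm_real, norm_norm, div_self h']
    · have h2 : (‖z‖ : ℂ) ≠ 0 := by exact_mod_cast h'
      rw [div_mul_eq_mul_div, div_eq_iff h2, Complex.conj_mul', sq]

lemma ilP_shift {N : ℕ} [NeZero N] (ω : ZMod N → ℂ) (hω : ∀ l, ‖ω l‖ = 1) (S : Finset (ZMod N))
    (r : ℝ) (a y : ZMod N) (hy : y ∈ bohr N S r) (hr0 : 0 ≤ r) (hr : 2 * Real.pi * r ≤ 1) :
    (1 - S.card * (2 * Real.pi * r)) * ilP ω S a ≤ ilP ω S (a - y) := by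
  have hX : ∀ l x, |(ω l * ilE (l * x)).re| ≤ 1 := by
    intro l x
    refine (Complex.abs_re_le_norm _).trans ?_
    rw [norm_mul, hω, ilE_norm, one_mul]
  set v := 2 * Real.pi * r with hv
  have hv0 : 0 ≤ v := by have := Real.pi_pos; positivity
  have h1 : (1 - v) ^ S.card * ilP ω S a ≤ ilP ω S (a - y) := by
    unfold ilP
    rw [← Finset.prod_const, ← Finset.prod_mul_distrib]
    apply Finset.prod_le_prod
    · intro l _
      have := abs_le.mp (hX l a)
      apply mul_nonneg <;> linarith
    · intro l hl
      have h2 : |(ω l * ilE (l * a)).re - (ω l * ilE (l * (a - y))).re| ≤ v := by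
        rw [← Complex.sub_re]
        refine (Complex.abs_re_le_norm _).trans ?_
        have e : ω l * ilE (l * a) - ω l * ilE (l * (a - y)) =
            ω l * ilE (l * (a - y)) * (ilE (l * y) - 1) := by
          have : l * a = l * (a - y) + l * y := by ring
          conv_lhs => rw [this, ilE_add]
          ring
        rw [e, norm_mul, norm_mul, hω, ilE_norm, one_mul, one_mul]
        refine (ilE_sub_one _).trans ?_
        have := il_mem_bohr.mp hy l hl
        have := Real.pi_pos
        rw [hv]; gcongr
      have h3 := abs_le.mp h2
      have h4 := abs_le.mp (hX l a)
      nlinarith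
  have hP0 : 0 ≤ ilP ω S a := by
    apply Finset.prod_nonneg
    intro l _
    have := abs_le.mp (hX l a)
    linarith
  have h5 : 1 - S.card * v ≤ (1 - v) ^ S.card := by
    have := one_add_mul_le_pow (a := -v) (by linarith) S.card
    calc 1 - S.card * v = 1 + S.card * (-v) := by ring
      _ ≤ _ := this
      _ = _ := by ring
  exact (mul_le_mul_of_nonneg_right h5 hP0).trans h1

lemma il_num0 {m g δ : ℝ} (hm : 1 ≤ m) (hg0 : 0 ≤ g) (hδ : 0 < δ) :
    0 < δ / (2 ^ 17 * (1 + g) * m ^ 2) ∧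
    66 * m * (δ / (2 ^ 17 * (1 + g) * m ^ 2)) = 66 / (2 ^ 17 * (1 + g) * m) * δ := by
  have hm0 : 0 < m := by linarith
  constructor
  · positivity
  · field_simp

lemma il_num1 {m g η : ℝ} (hm : 1 ≤ m) (hg0 : 0 ≤ g) (h4 : η ≤ 66 / (2 ^ 17 * (1 + g) * m)) :
    16 * g * η ≤ 1 / (64 * m) := by
  have hm0 : 0 < m := by linarith
  calc 16 * g * η ≤ 16 * g * (66 / (2 ^ 17 * (1 + g) * m)) := by gcongr
    _ = (16 * 66 / 2 ^ 17) * (g / (1 + g)) * (1 / m) := by field_simp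
    _ ≤ (16 * 66 / 2 ^ 17) * 1 * (1 / m) := by
        have : g / (1 + g) ≤ 1 := by
          rw [div_le_one (by positivity)]; linarith
        gcongr
    _ ≤ 1 / 64 * (1 / m) := mul_le_mul_of_nonneg_right (by norm_num) (by positivity)
    _ = 1 / (64 * m) := by field_simp

lemma il_num2 {m s r : ℝ} (hm : 1 ≤ m) (hs0 : 0 ≤ s) (hs : s ≤ 65 * m) (hr : 0 ≤ r)
    (hδm : r * (2 ^ 17 * m ^ 2) ≤ 1) : s * (2 * Real.pi * r) ≤ 1 / (64 * m) := by
  have hm0 : 0 < m := by linarith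
  have hpi : Real.pi ≤ 3.15 := Real.pi_lt_d2.le
  have hpi0 := Real.pi_pos
  have : r ≤ 1 / (2 ^ 17 * m ^ 2) := by rw [le_div_iff₀ (by positivity)]; exact hδm
  calc s * (2 * Real.pi * r) ≤ 65 * m * (2 * 3.15 * (1 / (2 ^ 17 * m ^ 2))) := by gcongr
    _ = (65 * 2 * 3.15 / 2 ^ 17) * (1 / m) := by field_simp
    _ ≤ 1 / 64 * (1 / m) := mul_le_mul_of_nonneg_right (by norm_num) (by positivity)
    _ = 1 / (64 * m) := by field_simp

set_option maxHeartbeats 1000000 in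
lemma il_large {N : ℕ} [NeZero N] (Γ : Finset (ZMod N)) {δ δ₁ δ₀ m α : ℝ} (hδ : 0 < δ)
    (hδ' : δ ≤ 1) (h1 : 0 < δ₁) (hm : 1 ≤ m) (hδ₀ : δ₀ = δ / (2 ^ 17 * (1 + Γ.card) * m ^ 2))
    (h10 : δ₁ ≤ δ₀) (hreg : BohrRegular N Γ δ) (A : Finset (ZMod N))
    (hα : α = ((A ∩ bohr N Γ δ).card : ℝ) / (bohr N Γ δ).card) (hα0 : 0 < α)
    (Λ : Finset (ZMod N))
    (hΛ : ∀ l ∈ Λ, ((A ∩ bohr N Γ δ).card : ℝ) ^ 2 ≤ 4 * m ^ 4 * ‖ilF (A ∩ bohr N Γ δ) l‖ ^ 2)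
    (hd : SDissociated {t | ((bohr N Γ δ₁).card : ℝ) / 3 ≤ ‖ilF (bohr N Γ δ₁) t‖} Λ)
    (hd1 : 32 * m ^ 3 ≤ Λ.card) (hd2 : (Λ.card : ℝ) ≤ 33 * m ^ 3) :
    ∃ (Γ' : Finset (ZMod N)) (δ'' : ℝ), δ₀ / 16 ≤ δ'' ∧
      (Γ'.card : ℝ) ≤ Γ.card + 65 * m ∧ BohrRegular N Γ' δ'' ∧
      ∃ x : ZMod N, α * (1 + 1 / (128 * m)) * (bohr N Γ' δ'').card ≤
                ((A ∩ (bohr N Γ' δ'').image (fun y => x + y)).card : ℝ) := by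
  classical
  have hm0 : 0 < m := by linarith
  have hb : 0 < ((bohr N Γ δ).card : ℝ) := il_bohr_pos hδ.le
  obtain ⟨A', hA'⟩ : ∃ A', A' = A ∩ bohr N Γ δ := ⟨_, rfl⟩
  have hAs : A' ⊆ A := by rw [hA']; exact Finset.inter_subset_left
  have hAb : A' ⊆ bohr N Γ δ := by rw [hA']; exact Finset.inter_subset_right
  rw [← hA'] at hα hΛ
  clear hA'
  have hcard : (A'.card : ℝ) = α * (bohr N Γ δ).card := by rw [hα]; exact (div_mul_cancel₀ _ hb.ne').symm
  have hA'pos : 0 < (A'.card : ℝ) := by rw [hcard]; exact mul_pos hα0 hb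
  have hA'ne : A'.Nonempty := Finset.card_pos.mp (by exact_mod_cast hA'pos)
  have hg0 : (0 : ℝ) ≤ Γ.card := Nat.cast_nonneg _
  have hδ₀pos : 0 < δ₀ := by rw [hδ₀]; exact (il_num0 hm hg0 hδ).1
  -- phases
  choose ω hω1 hω2 using fun l => il_omega (ilF A' l)
  have hX : ∀ l x, |(ω l * ilE (l * x)).re| ≤ 1 := by
    intro l x
    refine (Complex.abs_re_le_norm _).trans ?_
    rw [norm_mul, hω1, ilE_norm, one_mul]
  set s₀ := ⌈64 * m⌉₊ with hs₀
  have hs1 : 64 * m ≤ s₀ := Nat.le_ceil _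
  have hs2 : (s₀ : ℝ) ≤ 65 * m := by
    have := Nat.ceil_lt_add_one (show 0 ≤ 64 * m by positivity)
    linarith
  obtain ⟨S, hSΛ, hScard, hSsum⟩ := il_choose A' hA'ne Λ (fun l a => (ω l * ilE (l * a)).re) hX m hm
    hd1 hd2 (by
      intro l hl
      have e : ∑ a ∈ A', (ω l * ilE (l * a)).re = ‖ilF A' l‖ := by
        rw [← Complex.re_sum, ← Finset.mul_sum]
        have := hω2 l
        rw [show ∑ a ∈ A', ilE (l * a) = ilF A' l from rfl, this, Complex.ofReal_re]
      rw [e, div_le_iff₀ (by positivity)]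
      apply le_of_sq_le_sq _ (by positivity)
      have := hΛ l hl
      calc (A'.card : ℝ) ^ 2 ≤ _ := this
        _ = _ := by ring) s₀ hs1
  obtain ⟨κ, hκ0, hκs, hκ1, hκf⟩ := il_kernel Γ h1 s₀
  obtain ⟨δ'', hδa, hδb, hreg'⟩ := il_regular (Γ ∪ S) hδ₀pos
  have hδ''0 : 0 < δ'' := by linarith
  have hScard' : (S.card : ℝ) ≤ 65 * m := by
    have : (S.card : ℝ) ≤ s₀ := by exact_mod_cast hScard
    linarith
  refine ⟨Γ ∪ S, δ'', hδa, ?_, hreg', ?_⟩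
  · have : ((Γ ∪ S).card : ℝ) ≤ Γ.card + S.card := by exact_mod_cast Finset.card_union_le _ _
    linarith
  by_contra hcon
  push Not at hcon
  set u : ℝ := 1 / (64 * m) with hu
  have hu0 : 0 < u := by positivity
  have hu1 : u ≤ 1 / 64 := by
    rw [hu, div_le_div_iff₀ (by positivity) (by norm_num)]; linarith
  have hum : u * m = 1 / 64 := by rw [hu]; field_simp
  have e128 : 1 / (128 * m) = u / 2 := by rw [hu]; field_simp; norm_num
  have e2m : 1 / (2 * m) = 32 * u := by rw [hu]; field_simp; norm_num
  rw [e128] at hcon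
  rw [e2m] at hSsum
  have hDpos : 0 < ((bohr N Γ δ₁).card : ℝ) := il_bohr_pos h1.le
  -- Riesz product convolution
  have hP : ∀ x, ∑ z, κ z * ilP ω S (x + z) ≤ 1 + u := by
    intro x
    have h := il_riesz2 _ κ ((1 / 3) ^ s₀) (by positivity) hκ1 (by
      intro t ht
      rw [Set.mem_ofPred_eq, not_le] at ht
      rw [hκf, norm_pow, norm_div, Complex.norm_natCast]
      apply pow_le_pow_left₀ (div_nonneg (norm_nonneg _) hDpos.le)
      rw [div_le_iff₀ hDpos]; linarith) ω hω1 x S (il_diss_mono hd hSΛ)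
    have h2 : (3 / 2 : ℝ) ^ S.card * (1 / 3) ^ s₀ ≤ u := by
      calc (3 / 2 : ℝ) ^ S.card * (1 / 3) ^ s₀ ≤ (3 / 2) ^ s₀ * (1 / 3) ^ s₀ := by
            gcongr
            norm_num
        _ = 1 / 2 ^ s₀ := by rw [← mul_pow, ← one_div_pow]; norm_num
        _ ≤ u := by
            rw [hu]
            apply one_div_le_one_div_of_le (by positivity)
            have : (s₀ : ℝ) < 2 ^ s₀ := by exact_mod_cast Nat.lt_two_pow_self
            linarith
    have h3 : ∑ z, (κ z : ℂ) * ilP ω S (x + z) - 1 =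
        ((∑ z, κ z * ilP ω S (x + z) - 1 : ℝ) : ℂ) := by push_cast; rfl
    rw [h3, Complex.norm_real, Real.norm_eq_abs] at h
    have := (abs_le.mp h).2
    linarith
  have hP0 : ∀ x, 0 ≤ ilP ω S x := by
    intro x
    apply Finset.prod_nonneg
    intro l _
    have := abs_le.mp (hX l x)
    linarith
  set η := (s₀ * δ₁ + δ'') / δ with hη
  have hη0 : 0 ≤ η := by positivity
  have hηδ : (1 + η) * δ = δ + δ'' + s₀ * δ₁ := by rw [hη]; field_simp; ring
  have hη1 : 16 * Γ.card * η ≤ u := by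
    have h3 : s₀ * δ₁ + δ'' ≤ 66 * m * δ₀ := by
      have : s₀ * δ₁ ≤ 65 * m * δ₀ := by gcongr
      nlinarith
    have h4 : η ≤ 66 / (2 ^ 17 * (1 + Γ.card) * m) := by
      rw [hη, div_le_iff₀ hδ]
      refine h3.trans (le_of_eq ?_)
      rw [hδ₀]; exact (il_num0 hm hg0 hδ).2
    exact il_num1 hm hg0 h4
  have hB1 : ((bohr N Γ (δ + δ'' + s₀ * δ₁)).card : ℝ) ≤ (1 + u) * (bohr N Γ δ).card := by
    have := (hreg η (by rw [abs_of_nonneg hη0]; norm_num; linarith)).2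
    rw [hηδ, abs_of_nonneg hη0] at this
    exact this.trans (mul_le_mul_of_nonneg_right (by linarith) hb.le)
  have hpi : Real.pi ≤ 3.15 := Real.pi_lt_d2.le
  have hpi0 := Real.pi_pos
  have hδm : δ'' * (2 ^ 17 * m ^ 2) ≤ 1 := by
    have h3 : δ₀ ≤ 1 / (2 ^ 17 * m ^ 2) := by
      rw [hδ₀]
      apply div_le_div₀ (by norm_num) hδ' (by positivity)
      nlinarith [mul_nonneg hg0 (sq_nonneg m)]
    calc δ'' * (2 ^ 17 * m ^ 2) ≤ 1 / (2 ^ 17 * m ^ 2) * (2 ^ 17 * m ^ 2) := by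
          gcongr; linarith
      _ = 1 := by field_simp
  have hδs : δ'' ≤ 1 / 2 ^ 17 := by
    rw [le_div_iff₀ (by norm_num)]
    nlinarith [one_le_pow₀ hm (n := 2)]
  have hv1 : 2 * Real.pi * δ'' ≤ 1 := by
    calc 2 * Real.pi * δ'' ≤ 2 * 3.15 * (1 / 2 ^ 17) := by gcongr
      _ ≤ 1 := by norm_num
  have hSv : S.card * (2 * Real.pi * δ'') ≤ u := by
    exact il_num2 hm (Nat.cast_nonneg _) hScard' hδ''0.le hδm
  have hfin := il_final κ (ilP ω S) A A' (bohr N Γ (δ + δ'')) (bohr N Γ (δ + δ'' + s₀ * δ₁))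
    (bohr N (Γ ∪ S) δ'') (α * (1 + u / 2)) u u hκ0 hκ1 hP0 hP
    (fun z hz y hy => il_bohr_sub hy (hκs z hz))
    (fun a ha y hy => il_bohr_sub (hAb ha)
      (il_bohr_anti Finset.subset_union_left hy))
    hAs
    (by
      intro a ha y hy
      refine le_trans ?_ (ilP_shift ω hω1 S δ'' a y (il_bohr_anti Finset.subset_union_right hy)
        hδ''0.le hv1)
      apply mul_le_mul_of_nonneg_right _ (hP0 a)
      linarith)
    ⟨0, il_zero_mem hδ''0.le⟩ (by positivity) (fun x => (hcon x).le)
  have hSsum' : (1 + 32 * u) * (α * (bohr N Γ δ).card) ≤ ∑ a ∈ A', ilP ω S a := by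
    rw [← hcard]; exact hSsum
  have c1 : (1 - u) * ((1 + 32 * u) * (α * (bohr N Γ δ).card)) ≤
      α * (1 + u / 2) * (1 + u) * ((1 + u) * (bohr N Γ δ).card) := by
    calc _ ≤ (1 - u) * ∑ a ∈ A', ilP ω S a :=
          mul_le_mul_of_nonneg_left hSsum' (by linarith)
      _ ≤ _ := hfin
      _ ≤ _ := mul_le_mul_of_nonneg_left hB1 (by positivity)
  have c2 : 0 < α * (bohr N Γ δ).card := mul_pos hα0 hb
  have c3 : (1 - u) * (1 + 32 * u) ≤ (1 + u / 2) * (1 + u) * (1 + u) := by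
    apply le_of_mul_le_mul_right _ c2
    linarith
  nlinarith [mul_pos hu0 hu0, mul_pos (mul_pos hu0 hu0) hu0]

lemma il_bound {P K g δ δ₂ m : ℝ} (hδ : 0 < δ) (hm : 1 ≤ m) (hmK : m ^ 4 = K) (hg : 0 ≤ g)
    (hP2 : 2 ≤ P) (hPK : K ≤ P) (hPg : 1 + g ≤ P)
    (h : δ / (2 ^ 29 * (1 + g) ^ 2 * m ^ 2) ≤ δ₂) : δ₂⁻¹ ≤ P ^ (4096 : ℝ) * δ⁻¹ := by
  have hpos : 0 < δ / (2 ^ 29 * (1 + g) ^ 2 * m ^ 2) := by positivity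
  have h1 : δ₂⁻¹ ≤ (2 ^ 29 * (1 + g) ^ 2 * m ^ 2) * δ⁻¹ := by
    refine (inv_anti₀ hpos h).trans (le_of_eq ?_)
    rw [inv_div, div_eq_mul_inv]
  refine h1.trans ?_
  have hmK' : m ^ 2 ≤ K := by rw [← hmK]; exact pow_le_pow_right₀ hm (by norm_num)
  have h2 : 2 ^ 29 * (1 + g) ^ 2 * m ^ 2 ≤ P ^ (32 : ℕ) := by
    calc 2 ^ 29 * (1 + g) ^ 2 * m ^ 2 ≤ P ^ 29 * P ^ 2 * P := by
          gcongr
          linarith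
      _ = P ^ 32 := by ring
  have h3 : P ^ (32 : ℕ) ≤ P ^ (4096 : ℝ) := by
    rw [← Real.rpow_natCast]
    exact Real.rpow_le_rpow_of_exponent_le (by linarith) (by norm_num)
  gcongr
  linarith

/-- **The iteration lemma (Lemma 4.1).** There is an absolute constant `C > 0` such that: if
`B(Γ,δ)` is a regular Bohr set, `A` has relative density `α > 0` in `B(Γ,δ)`, and `B` is a
nonempty set with `|A + B| ≤ K|B|` (`K ≥ 1`), then either `(A-A)+(B-B)` contains an
intersection `B(Γ,δ'') ∩ B(Λ,ε)` with `|Λ| ≤ C K^{3/4}(1 + log α⁻¹)`,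
`δ''⁻¹ ≤ (2α⁻¹K(1+|Γ|))^C δ⁻¹` and `ε⁻¹ ≤ C K (1 + log α⁻¹)`; or there is a regular Bohr set
`B(Γ',δ'')` with `|Γ'| ≤ |Γ| + C K^{1/4}`, `δ''⁻¹ ≤ (2α⁻¹K(1+|Γ|))^C δ⁻¹` on a translate of
which `A` has density at least `α(1 + 2⁻⁷ K^{-1/4})`. -/
theorem iteration_lemma :
    ∃ C : ℝ, 0 < C ∧
      ∀ (N : ℕ) [NeZero N] (Γ : Finset (ZMod N)) (δ : ℝ),
        0 < δ → δ ≤ 1 → BohrRegular N Γ δ →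
        ∀ (A B : Finset (ZMod N)) (K : ℝ) (α : ℝ),
          α = ((A ∩ bohr N Γ δ).card : ℝ) / (bohr N Γ δ).card → 0 < α →
          B.Nonempty → 1 ≤ K → ((A + B).card : ℝ) ≤ K * B.card →
          (∃ (Λ : Finset (ZMod N)) (δ'' ε : ℝ), 0 < δ'' ∧ 0 < ε ∧
            (Λ.card : ℝ) ≤ C * K ^ ((3 : ℝ) / 4) * (1 + Real.log α⁻¹) ∧
            δ''⁻¹ ≤ (2 * α⁻¹ * K * (1 + Γ.card)) ^ C * δ⁻¹ ∧
            ε⁻¹ ≤ C * K * (1 + Real.log α⁻¹) ∧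
            bohr N Γ δ'' ∩ bohr N Λ ε ⊆ (A - A) + (B - B)) ∨
          (∃ (Γ' : Finset (ZMod N)) (δ'' : ℝ), 0 < δ'' ∧
            (Γ'.card : ℝ) ≤ Γ.card + C * K ^ ((1 : ℝ) / 4) ∧
            δ''⁻¹ ≤ (2 * α⁻¹ * K * (1 + Γ.card)) ^ C * δ⁻¹ ∧
            BohrRegular N Γ' δ'' ∧
            ∃ x : ZMod N,
              α * (1 + 2⁻¹ ^ 7 * K ^ (-(1 : ℝ) / 4)) * (bohr N Γ' δ'').card ≤
                ((A ∩ (bohr N Γ' δ'').image (fun y => x + y)).card : ℝ)) := by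
  refine ⟨4096, by norm_num, ?_⟩
  intro N _ Γ δ hδ hδ1 hreg A B K α hα hα0 hB hK hAB
  have hb : 0 < ((bohr N Γ δ).card : ℝ) := il_bohr_pos hδ.le
  have hK0 : 0 < K := by linarith
  have hα1 : α ≤ 1 := by
    rw [hα, div_le_one hb]
    exact_mod_cast Finset.card_le_card Finset.inter_subset_right
  have hαi : 1 ≤ α⁻¹ := (one_le_inv₀ hα0).mpr hα1
  have hlog : 0 ≤ Real.log α⁻¹ := Real.log_nonneg hαi
  obtain ⟨m, hmdef⟩ : ∃ m : ℝ, m = K ^ ((1 : ℝ) / 4) := ⟨_, rfl⟩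
  have hm : 1 ≤ m := by rw [hmdef]; exact Real.one_le_rpow hK (by norm_num)
  have hm0 : 0 < m := by linarith
  have hm4 : m ^ 4 = K := by
    rw [hmdef, ← Real.rpow_natCast, ← Real.rpow_mul hK0.le]; norm_num
  have hm3 : K ^ ((3 : ℝ) / 4) = m ^ 3 := by
    rw [hmdef, ← Real.rpow_natCast, ← Real.rpow_mul hK0.le]; norm_num
  have hmi : K ^ (-(1 : ℝ) / 4) = 1 / m := by
    rw [hmdef, show (-(1 : ℝ) / 4) = -(1 / 4) by norm_num, Real.rpow_neg hK0.le, inv_eq_one_div]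
  rw [← hmdef, hm3, hmi]
  have hm31 : 1 ≤ m ^ 3 := one_le_pow₀ hm
  obtain ⟨g, hgdef⟩ : ∃ g : ℝ, g = Γ.card := ⟨_, rfl⟩
  have hg0 : 0 ≤ g := by rw [hgdef]; exact Nat.cast_nonneg _
  obtain ⟨P, hPdef⟩ : ∃ P : ℝ, P = 2 * α⁻¹ * K * (1 + g) := ⟨_, rfl⟩
  have hαK : 1 ≤ α⁻¹ * K := one_le_mul_of_one_le_of_one_le hαi hK
  have hαK' : K ≤ α⁻¹ * K := le_mul_of_one_le_left hK0.le hαi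
  have hP2 : 2 ≤ P := by rw [hPdef]; nlinarith
  have hPK : K ≤ P := by rw [hPdef]; nlinarith
  have hPg : 1 + g ≤ P := by rw [hPdef]; nlinarith
  obtain ⟨δ₀, hδ₀⟩ : ∃ δ₀ : ℝ, δ₀ = δ / (2 ^ 17 * (1 + g) * m ^ 2) := ⟨_, rfl⟩
  have hδ₀pos : 0 < δ₀ := by rw [hδ₀]; exact (il_num0 hm hg0 hδ).1
  obtain ⟨δ₁, h1a, h1b, h1reg⟩ := il_regular Γ hδ₀pos
  have h1 : 0 < δ₁ := by linarith
  have hδ₀' : δ₀ / 16 / (256 * (1 + g)) = δ / (2 ^ 29 * (1 + g) ^ 2 * m ^ 2) := by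
    rw [hδ₀]; field_simp; norm_num
  have hA'ne : (A ∩ bohr N Γ δ).Nonempty := by
    rw [Finset.nonempty_iff_ne_empty]
    intro h
    rw [h] at hα
    simp at hα
    linarith
  obtain ⟨Λ, hΛQ, hΛd, hΛm⟩ := il_maxdiss
    {t | ((bohr N Γ δ₁).card : ℝ) / 3 ≤ ‖ilF (bohr N Γ δ₁) t‖}
    (fun l => ((A ∩ bohr N Γ δ).card : ℝ) ^ 2 ≤ 4 * m ^ 4 * ‖ilF (A ∩ bohr N Γ δ) l‖ ^ 2)
  rw [← hgdef, ← hPdef]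
  have hd1 : 32 * m ^ 3 ≤ (⌈32 * m ^ 3⌉₊ : ℝ) := Nat.le_ceil _
  have hd2 : (⌈32 * m ^ 3⌉₊ : ℝ) ≤ 33 * m ^ 3 := by
    have := Nat.ceil_lt_add_one (show 0 ≤ 32 * m ^ 3 by positivity)
    linarith
  rcases le_total Λ.card ⌈32 * m ^ 3⌉₊ with hc | hc
  · left
    have hc' : (Λ.card : ℝ) ≤ 33 * m ^ 3 := by
      have : (Λ.card : ℝ) ≤ (⌈32 * m ^ 3⌉₊ : ℝ) := by exact_mod_cast hc
      linarith
    refine ⟨Λ, δ₁ / (256 * (1 + g)), 1 / (2048 * m ^ 4), by positivity, by positivity, ?_, ?_, ?_, ?_⟩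
    · nlinarith [mul_nonneg (by positivity : 0 ≤ m ^ 3) hlog]
    · apply il_bound hδ hm hm4 hg0 hP2 hPK hPg
      rw [← hδ₀']
      gcongr
    · rw [one_div, inv_inv, hm4]
      nlinarith [mul_nonneg hK0.le hlog]
    · rw [hgdef]
      refine (il_small Γ h1 hm h1reg (A ∩ bohr N Γ δ) B hA'ne hB ?_ Λ hΛd hΛm hc').trans ?_
      · rw [hm4]
        refine le_trans ?_ hAB
        exact_mod_cast Finset.card_le_card
          (Finset.add_subset_add_right Finset.inter_subset_left)
      · exact Finset.add_subset_add_right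
          (Finset.sub_subset_sub Finset.inter_subset_left Finset.inter_subset_left)
  · right
    obtain ⟨Λ', hΛ', hcard⟩ := Finset.exists_subset_card_eq hc
    obtain ⟨Γ', δ'', ha, hb', hr, x, hx⟩ := il_large Γ hδ hδ1 h1 hm (by rw [hδ₀, hgdef]) h1b hreg A hα hα0
      Λ' (fun l hl => hΛQ l (hΛ' hl)) (il_diss_mono hΛd hΛ') (by rw [hcard]; exact hd1)
      (by rw [hcard]; exact hd2)
    refine ⟨Γ', δ'', by linarith, ?_, ?_, hr, x, ?_⟩
    · rw [← hgdef] at hb'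
      linarith
    · apply il_bound hδ hm hm4 hg0 hP2 hPK hPg
      rw [← hδ₀']
      refine le_trans ?_ ha
      apply div_le_self (by positivity)
      linarith
    · refine le_trans (le_of_eq ?_) hx
      congr 2
      rw [one_div, one_div, mul_inv]; norm_num
end

section
/- There is an absolute constant C > 0 with the following property. Let A ⊆ ℤ be a finite nonempty set with |A + A| ≤ K·|A| for a real K ≥ 2. Then there exist a positive integer N with N ≤ K^C·|A| and a subset A' ⊆ A with |A'| ≥ |A|/8 such that A' is Freiman 8-isomorphic to a subset of ℤ/Nℤ. -/
open scoped Pointwise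

lemma rm_bad_card (p N : ℕ) (hp : p.Prime) (u : ℤ) (hu : ¬ (p : ℤ) ∣ u) :
    ((Finset.Ioc 0 (p-1)).filter (fun l : ℕ => (N : ℤ) ∣ ((l : ℤ) * u) % p)).card
      ≤ (p - 1) / N := by
  rw [← Nat.Ioc_filter_dvd_card_eq_div]
  have hp0 : (0 : ℤ) < p := by exact_mod_cast hp.pos
  have hpi : Prime (p : ℤ) := Nat.prime_iff_prime_int.mp hp
  apply Finset.card_le_card_of_injOn (fun l : ℕ => (((l : ℤ) * u) % p).toNat)
  · intro l hl
    simp only [Finset.coe_filter, Finset.mem_Ioc, Set.mem_setOf_eq] at hl ⊢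
    obtain ⟨⟨h1, h2⟩, h3⟩ := hl
    have a1 := Int.emod_nonneg ((l : ℤ) * u) hp0.ne'
    have a2 := Int.emod_lt_of_pos ((l : ℤ) * u) hp0
    have a3 : ((l : ℤ) * u) % p ≠ 0 := by
      intro h
      rcases hpi.dvd_or_dvd (Int.dvd_of_emod_eq_zero h) with h | h
      · have := Nat.le_of_dvd h1 (by exact_mod_cast h)
        have := hp.pos
        omega
      · exact hu h
    refine ⟨⟨by omega, by omega⟩, ?_⟩
    zify
    rwa [Int.toNat_of_nonneg a1]
  · intro l hl m hm h
    simp only [Finset.coe_filter, Finset.mem_Ioc, Set.mem_setOf_eq] at hl hm h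
    have a1 := Int.emod_nonneg ((l : ℤ) * u) hp0.ne'
    have b1 := Int.emod_nonneg ((m : ℤ) * u) hp0.ne'
    have h' : ((l : ℤ) * u) % p = ((m : ℤ) * u) % p := by omega
    have h2 := Int.ModEq.dvd (show (l : ℤ) * u ≡ m * u [ZMOD p] from h')
    rw [← sub_mul] at h2
    have h3 := (hpi.dvd_or_dvd h2).resolve_right hu
    have := Int.eq_zero_of_abs_lt_dvd h3 (by rw [abs_lt]; omega)
    omega

lemma rm_exists (p : ℕ) (hp : p.Prime) (S : Finset ℤ) (h0 : 0 ∈ S)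
    (hS : ∀ u ∈ S, u ≠ 0 → ¬ (p : ℤ) ∣ u) :
    ∃ l : ℕ, 0 < l ∧ l < p ∧ ∀ u ∈ S, u ≠ 0 → ¬ ((S.card : ℕ) : ℤ) ∣ ((l : ℤ) * u) % p := by
  by_contra! H
  have hsub : Finset.Ioc 0 (p-1) ⊆ (S.erase 0).biUnion (fun u =>
      (Finset.Ioc 0 (p-1)).filter (fun l : ℕ => (S.card : ℤ) ∣ ((l : ℤ) * u) % p)) := by
    intro l hl
    have hl' := Finset.mem_Ioc.mp hl
    obtain ⟨u, hu, hu0, hd⟩ := H l hl'.1 (by omega)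
    simp only [Finset.mem_biUnion, Finset.mem_erase, Finset.mem_filter]
    exact ⟨u, ⟨hu0, hu⟩, hl, hd⟩
  have h1 := Finset.card_le_card hsub
  have h2 := Finset.card_biUnion_le_card_mul (S.erase 0) (fun u =>
      (Finset.Ioc 0 (p-1)).filter (fun l : ℕ => (S.card : ℤ) ∣ ((l : ℤ) * u) % p))
      ((p-1)/S.card) (by
        intro u hu
        have := Finset.mem_erase.mp hu
        exact rm_bad_card p _ hp u (hS u this.2 this.1))
  rw [Nat.card_Ioc, Nat.sub_zero] at h1
  rw [Finset.card_erase_of_mem h0] at h2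
  have hc : 0 < S.card := Finset.card_pos.mpr ⟨0, h0⟩
  have h3 := Nat.div_mul_le_self (p-1) S.card
  have hp2 := hp.two_le
  obtain ⟨c, hc'⟩ : ∃ c, S.card = c + 1 := ⟨S.card - 1, by omega⟩
  rw [hc'] at h2 h3
  rw [hc'] at h1
  simp only [Nat.add_sub_cancel] at h2
  have h4 := h1.trans h2
  set q := (p-1)/(c+1)
  have : q = 0 := by nlinarith
  rw [this] at h4
  omega

lemma rm_sum_mem (A : Finset ℤ) (s : Multiset ℤ) (hs : ∀ x ∈ s, x ∈ A) :
    s.sum ∈ Multiset.card s • A := by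
  induction s using Multiset.induction_on with
  | empty => simp
  | cons a s ih =>
    rw [Multiset.sum_cons, Multiset.card_cons, succ_nsmul']
    exact Finset.add_mem_add (hs a (by simp)) (ih fun x hx => hs x (by simp [hx]))

lemma rm_sum_modEq (p l : ℤ) (s : Multiset ℤ) :
    (s.map (fun x => (l * x) % p)).sum ≡ l * s.sum [ZMOD p] := by
  induction s using Multiset.induction_on with
  | empty => simp
  | cons a s ih =>
    rw [Multiset.map_cons, Multiset.sum_cons, Multiset.sum_cons, mul_add]
    exact (Int.mod_modEq _ _).add ih

lemma rm_sum_bound (p j : ℤ) (f : ℤ → ℤ) (s : Multiset ℤ)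
    (hs : ∀ x ∈ s, j * p ≤ 8 * f x ∧ 8 * f x + 1 ≤ (j + 1) * p) :
    Multiset.card s * (j * p) ≤ 8 * (s.map f).sum ∧
      8 * (s.map f).sum + Multiset.card s ≤ Multiset.card s * ((j + 1) * p) := by
  induction s using Multiset.induction_on with
  | empty => simp
  | cons a s ih =>
    rw [Multiset.map_cons, Multiset.sum_cons, Multiset.card_cons]
    have := ih fun x hx => hs x (by simp [hx])
    have h2 := hs a (by simp)
    push_cast
    constructor <;> linarith

lemma rm_cast_sum (N : ℕ) (f : ℤ → ℤ) (s : Multiset ℤ) :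
    (s.map (fun x => ((f x : ℤ) : ZMod N))).sum = (((s.map f).sum : ℤ) : ZMod N) := by
  induction s using Multiset.induction_on with
  | empty => simp
  | cons a s ih =>
    rw [Multiset.map_cons, Multiset.sum_cons, Multiset.map_cons, Multiset.sum_cons, Int.cast_add, ih]

/-- **Ruzsa's model lemma.** There is an absolute constant `C > 0` such that every finite
nonempty `A ⊆ ℤ` with `|A + A| ≤ K|A|` (`K ≥ 2`) admits a positive integer `N ≤ K^C |A|` and a
subset `A' ⊆ A` with `|A'| ≥ |A|/8` which is Freiman 8-isomorphic to a subset of `ℤ/Nℤ`. -/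
theorem ruzsa_model :
    ∃ C : ℝ, 0 < C ∧
      ∀ (A : Finset ℤ) (K : ℝ), A.Nonempty → 2 ≤ K →
        ((A + A).card : ℝ) ≤ K * A.card →
        ∃ N : ℕ, 0 < N ∧ (N : ℝ) ≤ K ^ C * A.card ∧
          ∃ A' : Finset ℤ, A' ⊆ A ∧ (A.card : ℝ) / 8 ≤ A'.card ∧
            ∃ φ : ℤ → ZMod N, IsAddFreimanIso 8 (A' : Set ℤ) (φ '' A') φ := by
  refine ⟨16, by norm_num, ?_⟩
  intro A K hA hK hAA
  have hPR := Finset.pluennecke_ruzsa_inequality_nsmul_sub_nsmul_add hA A 8 8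
  set S : Finset ℤ := 8 • A - 8 • A with hSdef
  have hApos : (0 : ℝ) < A.card := by exact_mod_cast Finset.card_pos.mpr hA
  obtain ⟨a0, ha0⟩ := hA
  have hmem : ∀ s t : Multiset ℤ, (∀ x ∈ s, x ∈ A) → (∀ x ∈ t, x ∈ A) → Multiset.card s = 8 →
      Multiset.card t = 8 → s.sum - t.sum ∈ S := by
    intro s t hs ht hs8 ht8
    have h1 := rm_sum_mem A s hs
    have h2 := rm_sum_mem A t ht
    rw [hs8] at h1
    rw [ht8] at h2
    exact Finset.sub_mem_sub h1 h2
  have h0 : (0 : ℤ) ∈ S := by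
    have := hmem (Multiset.replicate 8 a0) (Multiset.replicate 8 a0)
      (fun x hx => by rw [Multiset.eq_of_mem_replicate hx]; exact ha0)
      (fun x hx => by rw [Multiset.eq_of_mem_replicate hx]; exact ha0) (by simp) (by simp)
    simpa using this
  have hSpos : 0 < S.card := Finset.card_pos.mpr ⟨0, h0⟩
  have hScard : (S.card : ℝ) ≤ K ^ (16 : ℝ) * A.card := by
    have h1 : (S.card : ℝ) ≤ (((A + A).card : ℝ) / A.card) ^ 16 * A.card := by
      have := (NNRat.cast_le (K := ℝ)).mpr hPR
      push_cast at this
      simpa using this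
    refine h1.trans ?_
    rw [show (16 : ℝ) = ((16 : ℕ) : ℝ) by norm_num, Real.rpow_natCast]
    gcongr
    rwa [div_le_iff₀ hApos]
  obtain ⟨p, hpge, hp⟩ := Nat.exists_infinite_primes (∑ u ∈ S, u.natAbs + 1)
  have hp0 : (0 : ℤ) < p := by exact_mod_cast hp.pos
  have hSp : ∀ u ∈ S, u ≠ 0 → ¬ (p : ℤ) ∣ u := by
    intro u hu hu0 hd
    have h1 : u.natAbs ≤ ∑ u ∈ S, u.natAbs :=
      Finset.single_le_sum (f := fun u : ℤ => u.natAbs) (fun _ _ => Nat.zero_le _) hu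
    have h2 := Nat.le_of_dvd (Int.natAbs_pos.mpr hu0) (Int.natCast_dvd.mp hd)
    omega
  obtain ⟨l, hl0, hlp, hl⟩ := rm_exists p hp S h0 hSp
  refine ⟨S.card, hSpos, hScard, ?_⟩
  set f : ℤ → ℤ := fun x => ((l : ℤ) * x) % p with hf
  have hf0 : ∀ x, 0 ≤ f x := fun x => Int.emod_nonneg _ hp0.ne'
  have hfp : ∀ x, f x < p := fun x => Int.emod_lt_of_pos _ hp0
  -- pigeonhole
  obtain ⟨j, hj, hcard⟩ : ∃ j ∈ Finset.Ico (0 : ℤ) 8,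
      A.card ≤ 8 * (A.filter (fun x => (8 * f x) / p = j)).card := by
    by_contra! H
    have h1 := Finset.card_eq_sum_card_fiberwise (s := A) (t := Finset.Ico (0 : ℤ) 8)
      (f := fun x => (8 * f x) / p) (by
        intro x hx
        simp only [Finset.coe_Ico, Set.mem_Ico]
        constructor
        · exact Int.ediv_nonneg (by have := hf0 x; omega) hp0.le
        · apply Int.ediv_lt_of_lt_mul hp0
          have := hfp x
          linarith)
    have h2 : ∑ j ∈ Finset.Ico (0 : ℤ) 8, 8 * (A.filter (fun x => (8 * f x) / p = j)).card
        < ∑ j ∈ Finset.Ico (0 : ℤ) 8, A.card :=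
      Finset.sum_lt_sum_of_nonempty ⟨0, by simp⟩ H
    rw [← Finset.mul_sum, ← h1] at h2
    simp at h2
  refine ⟨A.filter (fun x => (8 * f x) / p = j), Finset.filter_subset _ _, ?_,
    fun x => ((f x : ℤ) : ZMod S.card), ?_⟩
  · rw [div_le_iff₀ (by norm_num)]
    have : (A.card : ℝ) ≤ 8 * (A.filter (fun x => (8 * f x) / p = j)).card := by
      exact_mod_cast hcard
    linarith
  set A' := A.filter (fun x => (8 * f x) / p = j) with hA'
  have hA'A : ∀ x ∈ A', x ∈ A := fun x hx => (Finset.mem_filter.mp hx).1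
  have hb : ∀ x ∈ A', j * p ≤ 8 * f x ∧ 8 * f x + 1 ≤ (j + 1) * p := by
    intro x hx
    have := (Finset.mem_filter.mp hx).2
    rw [← this]
    constructor
    · exact Int.ediv_mul_le _ hp0.ne'
    · exact Int.lt_ediv_add_one_mul_self _ hp0
  -- positive difference is impossible
  have hpos : ∀ s t : Multiset ℤ, (∀ x ∈ s, x ∈ A') → (∀ x ∈ t, x ∈ A') → Multiset.card s = 8 →
      Multiset.card t = 8 → 0 < (s.map f).sum - (t.map f).sum →
      s.sum ≠ t.sum ∧ ¬ ((S.card : ℕ) : ℤ) ∣ (s.map f).sum - (t.map f).sum := by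
    intro s t hs ht hs8 ht8 hD
    have b1 := rm_sum_bound p j f s (fun x hx => hb x (hs x hx))
    have b2 := rm_sum_bound p j f t (fun x hx => hb x (ht x hx))
    rw [hs8] at b1
    rw [ht8] at b2
    push_cast at b1 b2
    have hDp : (s.map f).sum - (t.map f).sum < p := by linarith
    have hmod : (s.map f).sum - (t.map f).sum ≡ l * (s.sum - t.sum) [ZMOD p] := by
      rw [mul_sub]
      exact (rm_sum_modEq p l s).sub (rm_sum_modEq p l t)
    have hDe : (s.map f).sum - (t.map f).sum = (l * (s.sum - t.sum)) % p := by
      rw [← hmod.eq, Int.emod_eq_of_lt hD.le hDp]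
    have hne : s.sum ≠ t.sum := by
      intro h
      rw [h, sub_self, mul_zero, Int.zero_emod] at hDe
      omega
    refine ⟨hne, ?_⟩
    rw [hDe]
    exact hl _ (hmem s t (fun x hx => hA'A x (hs x hx)) (fun x hx => hA'A x (ht x hx)) hs8 ht8)
      (sub_ne_zero.mpr hne)
  have key : ∀ s t : Multiset ℤ, (∀ x ∈ s, x ∈ A') → (∀ x ∈ t, x ∈ A') → Multiset.card s = 8 →
      Multiset.card t = 8 →
      ((s.map (fun x => ((f x : ℤ) : ZMod S.card))).sum =
        (t.map (fun x => ((f x : ℤ) : ZMod S.card))).sum ↔ s.sum = t.sum) := by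
    intro s t hs ht hs8 ht8
    rw [rm_cast_sum, rm_cast_sum]
    rcases lt_trichotomy ((s.map f).sum) ((t.map f).sum) with h | h | h
    · obtain ⟨h1, h2⟩ := hpos t s ht hs ht8 hs8 (by omega)
      rw [ZMod.intCast_eq_intCast_iff_dvd_sub]
      exact ⟨fun h' => absurd h' h2, fun h' => absurd h'.symm h1⟩
    · refine ⟨fun _ => ?_, fun _ => by rw [h]⟩
      by_contra hne
      have hmod : (s.map f).sum - (t.map f).sum ≡ l * (s.sum - t.sum) [ZMOD p] := by
        rw [mul_sub]
        exact (rm_sum_modEq p l s).sub (rm_sum_modEq p l t)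
      rw [h, sub_self] at hmod
      have h3 : (l * (s.sum - t.sum)) % (p : ℤ) = 0 := by
        rw [← hmod.eq, Int.zero_emod]
      refine hl _ (hmem s t (fun x hx => hA'A x (hs x hx)) (fun x hx => hA'A x (ht x hx)) hs8 ht8)
        (sub_ne_zero.mpr hne) ?_
      rw [h3]
      exact dvd_zero _
    · obtain ⟨h1, h2⟩ := hpos s t hs ht hs8 ht8 (by omega)
      rw [eq_comm, ZMod.intCast_eq_intCast_iff_dvd_sub]
      exact ⟨fun h' => absurd h' h2, fun h' => absurd h' h1⟩
  refine ⟨Set.InjOn.bijOn_image ?_, ?_⟩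
  · intro x hx y hy hxy
    have := (key (Multiset.replicate 8 x) (Multiset.replicate 8 y)
      (fun z hz => by rw [Multiset.eq_of_mem_replicate hz]; exact hx)
      (fun z hz => by rw [Multiset.eq_of_mem_replicate hz]; exact hy) (by simp) (by simp)).mp (by
        have hxy' : ((f x : ℤ) : ZMod S.card) = ((f y : ℤ) : ZMod S.card) := hxy
        rw [Multiset.map_replicate, Multiset.map_replicate, hxy'])
    rw [Multiset.sum_replicate, Multiset.sum_replicate] at this
    simp only [nsmul_eq_mul] at this
    push_cast at this
    omega
  · intro s t hs ht hs8 ht8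
    exact key s t (fun x hx => hs hx) (fun x hx => ht hx) hs8 ht8
end

section
/- There is an absolute constant C > 0 with the following property. Let A ⊆ ℤ be a finite nonempty set with |A + A| ≤ K·|A| for a real K ≥ 2, and let η ∈ (0,1]. Suppose 2A − 2A contains a multidimensional arithmetic progression Q of dimension d with |Q| ≥ η·|A|. Then there exists a multidimensional arithmetic progression P with A ⊆ P, of dimension at most C·(d + K·log(K·η⁻¹)) and with |P| ≤ exp(C·(d + K·log(K·η⁻¹)))·|A|. -/
open scoped Pointwise BigOperators

def iterAdd {G : Type} [AddCommGroup G] [DecidableEq G] (A : Finset G) : ℕ → Finset G → Finset G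
  | 0, T => T
  | t+1, T => iterAdd A t (T + A)

lemma iterAdd_mono {G : Type} [AddCommGroup G] [DecidableEq G] (A : Finset G) (t : ℕ) :
    ∀ (T T' : Finset G), T ⊆ T' → iterAdd A t T ⊆ iterAdd A t T' := by
  induction t with
  | zero => intro T T' h; exact h
  | succ t ih => intro T T' h; exact ih _ _ (Finset.add_subset_add_right h)

lemma greedy {G : Type} [AddCommGroup G] [DecidableEq G] (A : Finset G) (s : ℕ) :
    ∀ (t : ℕ) (T : Finset G), T.Nonempty → (iterAdd A t T).card < s^t * T.card →
    ∃ (ι : Type) (_ : Fintype ι) (f : ι → G), Fintype.card ι ≤ s * t ∧ (∀ i, f i ∈ A) ∧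
      ∀ a ∈ A, ∃ u ∈ T, ∃ v ∈ T, ∃ c : ι → ℤ, (∀ i, |c i| ≤ 1) ∧ a = u - v + ∑ i, c i • f i := by
  intro t
  induction t with
  | zero => intro T _ h; simp [iterAdd] at h
  | succ t ih =>
    intro T hT h
    -- maximal R
    let P : Finset (Finset G) := A.powerset.filter
      (fun R => ∀ r ∈ R, ∀ r' ∈ R, ∀ u ∈ T, ∀ u' ∈ T, r + u = r' + u' → r = r')
    have hP : P.Nonempty := ⟨∅, by simp [P]⟩
    obtain ⟨R, hRP, hmax⟩ := P.exists_max_image Finset.card hP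
    simp only [P, Finset.mem_filter, Finset.mem_powerset] at hRP hmax
    obtain ⟨hRA, hR⟩ := hRP
    have hcov : ∀ a ∈ A, ∃ r ∈ R, ∃ u ∈ T, ∃ v ∈ T, a = r + (u - v) := by
      intro a ha
      by_contra hcon
      push Not at hcon
      have haR : a ∉ R := by
        intro haR
        obtain ⟨u, hu⟩ := hT
        exact hcon a haR u hu u hu (by simp)
      have := hmax (insert a R) ⟨Finset.insert_subset ha hRA, ?_⟩
      · rw [Finset.card_insert_of_notMem haR] at this
        omega
      · intro r hr r' hr' u hu u' hu' he
        rw [Finset.mem_insert] at hr hr'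
        rcases hr with rfl | hr <;> rcases hr' with rfl | hr'
        · rfl
        · exact absurd (by rw [← add_sub_assoc, ← he]; abel) (hcon r' hr' u' hu' u hu)
        · exact absurd (by rw [← add_sub_assoc, he]; abel) (hcon r hr u hu u' hu')
        · exact hR r hr r' hr' u hu u' hu' he
    by_cases hRs : R.card < s
    · classical
      refine ⟨R, inferInstance, fun i => i.1, ?_, fun i => hRA i.2, ?_⟩
      · rw [Fintype.card_coe]; nlinarith
      · intro a ha
        obtain ⟨r, hr, u, hu, v, hv, rfl⟩ := hcov a ha
        refine ⟨u, hu, v, hv, fun i => if i.1 = r then 1 else 0, ?_, ?_⟩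
        · intro i; dsimp only; split_ifs <;> simp
        · have : ∑ i : R, (if i.1 = r then (1:ℤ) else 0) • i.1 = r := by
            rw [Finset.sum_eq_single (⟨r, hr⟩ : R)]
            · simp
            · intro b _ hb
              have : b.1 ≠ r := fun h => hb (Subtype.ext h)
              simp [this]
            · simp
          rw [this]; abel
    · push Not at hRs
      obtain ⟨S, hSR, hS⟩ := Finset.exists_subset_card_eq hRs
      have hcard : (T + S).card = T.card * s := by
        rw [← hS, Finset.card_add_iff]
        intro p hp q hq he
        simp only [Set.mem_prod, Finset.mem_coe] at hp hq
        have h1 : p.2 = q.2 := hR p.2 (hSR hp.2) q.2 (hSR hq.2) p.1 hp.1 q.1 hq.1 (by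
          have : p.1 + p.2 = q.1 + q.2 := he
          rw [add_comm, this, add_comm])
        have h2 : p.1 + p.2 = q.1 + q.2 := he
        rw [h1] at h2
        exact Prod.ext (add_right_cancel h2) h1
      have hspos : 0 < s := by
        by_contra h0
        have : s = 0 := by omega
        subst this
        simp at h
      have hSne : S.Nonempty := by rw [← Finset.card_pos]; omega
      obtain ⟨ι, hι, f, hf1, hf2, hf3⟩ := ih (T + S) (hT.add hSne) (by
        calc _ ≤ (iterAdd A (t+1) T).card := Finset.card_le_card
              (iterAdd_mono A t _ _ (Finset.add_subset_add_left (hSR.trans hRA)))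
          _ < _ := h
          _ = _ := by rw [hcard]; ring)
      refine ⟨ι ⊕ S, inferInstance, Sum.elim f (fun i => i.1), ?_, ?_, ?_⟩
      · rw [Fintype.card_sum, Fintype.card_coe, hS]; nlinarith
      · rintro (i | i)
        · exact hf2 i
        · exact hRA (hSR i.2)
      · intro a ha
        obtain ⟨u, hu, v, hv, c, hc, rfl⟩ := hf3 a ha
        obtain ⟨u1, hu1, s1, hs1, rfl⟩ := Finset.mem_add.1 hu
        obtain ⟨v1, hv1, s2, hs2, rfl⟩ := Finset.mem_add.1 hv
        refine ⟨u1, hu1, v1, hv1, Sum.elim c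
          (fun i => (if i.1 = s1 then 1 else 0) - (if i.1 = s2 then 1 else 0)), ?_, ?_⟩
        · rintro (i | i)
          · exact hc i
          · simp only [Sum.elim_inr]; split_ifs <;> simp
        · have key : ∀ r ∈ S, ∑ i : S, (if i.1 = r then (1:ℤ) else 0) • i.1 = r := by
            intro r hr
            rw [Finset.sum_eq_single (⟨r, hr⟩ : S)]
            · simp
            · intro b _ hb
              have : b.1 ≠ r := fun h => hb (Subtype.ext h)
              simp [this]
            · simp
          rw [Fintype.sum_sum_type]
          simp only [Sum.elim_inl, Sum.elim_inr, sub_smul, Finset.sum_sub_distrib]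
          rw [key s1 hs1, key s2 hs2]
          abel

def Gam {d : ℕ} {V : Type} [AddCommGroup V] [Module ℚ V] (π : (Fin d → ℚ) →ₗ[ℚ] V) :
    AddSubgroup V :=
  (π.toAddMonoidHom.comp ((Int.castAddHom ℚ).compLeft (Fin d))).range

lemma mem_Gam {d : ℕ} {V : Type} [AddCommGroup V] [Module ℚ V] {π : (Fin d → ℚ) →ₗ[ℚ] V}
    {x : V} : x ∈ Gam π ↔ ∃ a : Fin d → ℤ, π (fun i => (a i : ℚ)) = x := by
  rfl

def Bod {d : ℕ} {V : Type} [AddCommGroup V] [Module ℚ V] (π : (Fin d → ℚ) →ₗ[ℚ] V)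
    (L : Fin d → ℕ) (s : ℚ) : Set V :=
  {x | ∃ b : Fin d → ℚ, (∀ i, |b i| ≤ s * L i) ∧ π b = x}

section
variable {d : ℕ} {V : Type} [AddCommGroup V] [Module ℚ V] {π : (Fin d → ℚ) →ₗ[ℚ] V}
    {L : Fin d → ℕ}

lemma Bod_add {s t : ℚ} {x y : V} (hx : x ∈ Bod π L s) (hy : y ∈ Bod π L t) :
    x + y ∈ Bod π L (s + t) := by
  obtain ⟨b, hb, rfl⟩ := hx
  obtain ⟨c, hc, rfl⟩ := hy
  refine ⟨b + c, fun i => ?_, by simp⟩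
  calc |b i + c i| ≤ |b i| + |c i| := abs_add_le _ _
    _ ≤ _ := by rw [add_mul]; exact add_le_add (hb i) (hc i)

lemma Bod_smul {s : ℚ} (q : ℚ) {x : V} (hx : x ∈ Bod π L s) : q • x ∈ Bod π L (|q| * s) := by
  obtain ⟨b, hb, rfl⟩ := hx
  refine ⟨q • b, fun i => ?_, by simp⟩
  simp only [Pi.smul_apply, smul_eq_mul, abs_mul, mul_assoc]
  exact mul_le_mul_of_nonneg_left (hb i) (abs_nonneg _)

lemma Bod_sub {s t : ℚ} {x y : V} (hx : x ∈ Bod π L s) (hy : y ∈ Bod π L t) :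
    x - y ∈ Bod π L (s + t) := by
  have := Bod_add hx (Bod_smul (-1) hy)
  simpa [sub_eq_add_neg] using this

lemma Bod_mono {s t : ℚ} (h : s ≤ t) {x : V} (hx : x ∈ Bod π L s) : x ∈ Bod π L t := by
  obtain ⟨b, hb, rfl⟩ := hx
  exact ⟨b, fun i => (hb i).trans (mul_le_mul_of_nonneg_right h (by positivity)), rfl⟩

lemma cyc (H : AddSubgroup V) (hH : H ≤ Gam π) (f : V →ₗ[ℚ] ℚ) (v : V) (hv : v ∈ H)
    (hfv : f v = 1) :
    ∃ b ∈ H, ∃ g : ℚ, g ≠ 0 ∧ f b = g ∧ ∀ x ∈ H, ∃ n : ℤ, f x = n * g := by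
  classical
  -- common denominator
  let q : Fin d → ℚ := fun i => f (π (Pi.single i 1))
  let D : ℕ := ∏ i, (q i).den
  have hD : (D : ℚ) ≠ 0 := by
    simp only [D]
    exact_mod_cast Finset.prod_ne_zero_iff.2 (fun i _ => (q i).den_nz)
  have hq : ∀ i, ∃ m : ℤ, (D : ℚ) * q i = m := by
    intro i
    obtain ⟨r, hr⟩ : (q i).den ∣ D := Finset.dvd_prod_of_mem _ (Finset.mem_univ i)
    refine ⟨(q i).num * r, ?_⟩
    rw [hr]
    push_cast
    have := Rat.mul_den_eq_num (q i)
    calc ((q i).den * r : ℚ) * q i = (q i * (q i).den) * r := by ring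
      _ = _ := by rw [this]
  choose m hm using hq
  have hint : ∀ x ∈ Gam π, ∃ n : ℤ, (D : ℚ) * f x = n := by
    intro x hx
    obtain ⟨a, rfl⟩ := mem_Gam.1 hx
    refine ⟨∑ i, a i * m i, ?_⟩
    have : (fun i => (a i : ℚ)) = ∑ i, (a i : ℚ) • (Pi.single i 1 : Fin d → ℚ) := by
      rw [pi_eq_sum_univ' (fun i => (a i : ℚ))]
    rw [this, map_sum, map_sum, Finset.mul_sum]
    push_cast
    refine Finset.sum_congr rfl fun i _ => ?_
    rw [map_smul, map_smul, smul_eq_mul, ← hm i]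
    simp only [q]; ring
  let S : AddSubgroup ℤ :=
    { carrier := {n | ∃ x ∈ H, (D : ℚ) * f x = n}
      zero_mem' := ⟨0, H.zero_mem, by simp⟩
      add_mem' := by
        rintro a b ⟨x, hx, hx'⟩ ⟨y, hy, hy'⟩
        exact ⟨x + y, H.add_mem hx hy, by rw [map_add, mul_add, hx', hy']; push_cast; ring⟩
      neg_mem' := by
        rintro a ⟨x, hx, hx'⟩
        exact ⟨-x, H.neg_mem hx, by rw [map_neg, mul_neg, hx']; push_cast; ring⟩ }
  obtain ⟨g, hg⟩ := Int.subgroup_cyclic S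
  have hgS : g ∈ S := by rw [hg]; exact AddSubgroup.subset_closure (by simp)
  obtain ⟨b, hb, hbg⟩ := hgS
  have hall : ∀ x ∈ H, ∃ n : ℤ, f x = n * f b := by
    intro x hx
    obtain ⟨n, hn⟩ := hint x (hH hx)
    have hnS : n ∈ S := ⟨x, hx, hn⟩
    rw [hg, AddSubgroup.mem_closure_singleton] at hnS
    obtain ⟨k, hk⟩ := hnS
    refine ⟨k, ?_⟩
    apply mul_left_cancel₀ hD
    rw [hn, ← hk]
    rw [smul_eq_mul]; push_cast; rw [← hbg]; ring
  refine ⟨b, hb, f b, ?_, rfl, hall⟩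
  intro h0
  obtain ⟨n, hn⟩ := hall v hv
  rw [h0, hfv] at hn
  simp at hn

lemma count_step (U : Submodule ℚ V) (v : V) (hvU : v ∉ U) (hvG : v ∈ Gam π) (Bad : Set V)
    (N : ℕ) (hN : 0 < N) (hdiv : ∀ b ∈ Bad, ∃ z ∈ Gam π, z ∈ U ∧ b = N • z) (M : ℕ)
    (hcount : ∀ Y : Finset V, (∀ x ∈ Y, x ∈ Gam π ∧ x ∈ U) →
      (∀ x ∈ Y, ∀ y ∈ Y, x ≠ y → x - y ∉ Bad) → Y.card ≤ M)
    (Y : Finset V) (hY : ∀ x ∈ Y, x ∈ Gam π ∧ x ∈ U ⊔ Submodule.span ℚ {v})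
    (hY2 : ∀ x ∈ Y, ∀ y ∈ Y, x ≠ y → x - y ∉
      Bad ∪ {w | ∃ z ∈ Gam π, z ∈ U ⊔ Submodule.span ℚ {v} ∧ z ∉ U ∧ w = N • z}) :
    Y.card ≤ M * N := by
  classical
  obtain ⟨f0, hf0, hfU⟩ := Submodule.exists_le_ker_of_notMem hvU
  let f : V →ₗ[ℚ] ℚ := (f0 v)⁻¹ • f0
  have hfv : f v = 1 := by simp [f, hf0]
  have hfU : ∀ x ∈ U, f x = 0 := by
    intro x hx
    have : f0 x = 0 := hfU hx
    simp [f, this]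
  have hker : ∀ x ∈ U ⊔ Submodule.span ℚ {v}, f x = 0 → x ∈ U := by
    intro x hx h0
    obtain ⟨u, hu, w, hw, rfl⟩ := Submodule.mem_sup.1 hx
    obtain ⟨c, rfl⟩ := Submodule.mem_span_singleton.1 hw
    rw [map_add, hfU u hu, map_smul, hfv] at h0
    have : c = 0 := by simpa using h0
    simpa [this] using hu
  let H : AddSubgroup V := Gam π ⊓ (U ⊔ Submodule.span ℚ {v}).toAddSubgroup
  have hHmem : ∀ x, x ∈ H ↔ x ∈ Gam π ∧ x ∈ U ⊔ Submodule.span ℚ {v} := fun x => Iff.rfl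
  obtain ⟨b, hb, g, hg, hfb, hall⟩ := cyc (π := π) H inf_le_left f v
    ((hHmem v).2 ⟨hvG, Submodule.mem_sup_right (Submodule.mem_span_singleton_self v)⟩) hfv
  choose! θ hθ using hall
  have hYH : ∀ x ∈ Y, x ∈ H := fun x hx => (hHmem x).2 (hY x hx)
  have key : ∀ x ∈ Y, ∀ y ∈ Y, ∀ t : ℤ, θ x - θ y = N * t → 
      ∀ w : V, w ∈ H → w ∈ U → (x - θ x • b) - (y - θ y • b) = N • w → t = 0 := by
    intro x hx y hy t ht w hwH hwU hw
    by_contra ht0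
    have hxy : x - y = N • (w + t • b) := by
      have : x - y = N • w + (θ x - θ y) • b := by rw [← hw, sub_smul]; abel
      rw [this, ht, smul_add, mul_smul, natCast_zsmul]
    have hzU : w + t • b ∉ U := by
      intro hz
      have := hfU _ hz
      rw [map_add, hfU w hwU, map_zsmul, hfb] at this
      simp [ht0, hg] at this
    have hzH : w + t • b ∈ H := H.add_mem hwH (H.zsmul_mem hb t)
    have hne : x ≠ y := by
      rintro rfl
      rw [sub_self] at ht
      rcases mul_eq_zero.1 ht.symm with h | h
      · omega
      · exact ht0 h
    exact hY2 x hx y hy hne (Or.inr ⟨_, hzH.1, hzH.2, hzU, hxy⟩)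
  have := Finset.card_le_mul_card_image_of_maps_to (s := Y) (t := Finset.Ico (0:ℤ) N)
    (f := fun x => θ x % N) (by
      intro x hx
      rw [Finset.mem_Ico]
      exact ⟨Int.emod_nonneg _ (by omega), Int.emod_lt_of_pos _ (by omega)⟩) M (by
      intro ρ hρ
      set Z := Y.filter (fun x => θ x % N = ρ) with hZ
      have hZY : ∀ x ∈ Z, x ∈ Y := fun x hx => (Finset.mem_filter.1 hx).1
      have hmod : ∀ x ∈ Z, ∀ y ∈ Z, ∃ t : ℤ, θ x - θ y = N * t := by
        intro x hx y hy
        have h1 := (Finset.mem_filter.1 hx).2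
        have h2 := (Finset.mem_filter.1 hy).2
        exact Int.ModEq.dvd (show θ y ≡ θ x [ZMOD N] from h2.trans h1.symm)
      have hinj : Set.InjOn (fun x => x - θ x • b) (Z : Set V) := by
        intro x hx y hy hxy
        obtain ⟨t, ht⟩ := hmod x hx y hy
        have hxy' : x - θ x • b = y - θ y • b := hxy
        have t0 := key x (hZY x hx) y (hZY y hy) t ht 0 H.zero_mem U.zero_mem (by
          rw [hxy']; simp)
        rw [t0, mul_zero, sub_eq_zero] at ht
        rw [ht] at hxy'
        exact sub_left_injective hxy'
      rw [← Finset.card_image_of_injOn hinj]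
      apply hcount
      · intro x' hx'
        obtain ⟨x, hx, rfl⟩ := Finset.mem_image.1 hx'
        have hxH := hYH x (hZY x hx)
        have : x - θ x • b ∈ H := H.sub_mem hxH (H.zsmul_mem hb _)
        refine ⟨this.1, hker _ this.2 ?_⟩
        rw [map_sub, map_zsmul, hfb, hθ x hxH]; simp
      · intro x' hx' y' hy' hne hbad
        obtain ⟨x, hx, rfl⟩ := Finset.mem_image.1 hx'
        obtain ⟨y, hy, rfl⟩ := Finset.mem_image.1 hy'
        obtain ⟨t, ht⟩ := hmod x hx y hy
        obtain ⟨z, hzG, hzU, hz⟩ := hdiv _ hbad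
        have t0 := key x (hZY x hx) y (hZY y hy) t ht z
          ((hHmem z).2 ⟨hzG, Submodule.mem_sup_left hzU⟩) hzU hz
        rw [t0, mul_zero, sub_eq_zero] at ht
        rw [ht] at hbad
        have e : x - θ y • b - (y - θ y • b) = x - y := by abel
        rw [e] at hbad
        refine hY2 x (hZY x hx) y (hZY y hy) ?_ (Or.inl hbad)
        rintro rfl; exact hne rfl)
  simpa using this
end

def LSt {d : ℕ} {V : Type} [AddCommGroup V] [Module ℚ V] (π : (Fin d → ℚ) →ₗ[ℚ] V)
    (L : Fin d → ℕ) (n : ℕ) : Prop :=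
  ∃ (v : Fin n → V) (e : Fin n → ℕ) (J : ℕ) (Bad : Set V),
    LinearIndependent ℚ v ∧ (∀ l, v l ∈ Gam π ∧ v l ∈ Bod π L ((2:ℚ)^(e l))⁻¹) ∧
    (∀ b ∈ Bad, ∃ z ∈ Gam π, z ∈ Submodule.span ℚ (Set.range v) ∧ b = 2^(J+2) • z) ∧
    (∀ b ∈ Bad, b ∉ Bod π L 2) ∧
    (∀ Y : Finset V, (∀ x ∈ Y, x ∈ Gam π ∧ x ∈ Submodule.span ℚ (Set.range v)) →
      (∀ x ∈ Y, ∀ y ∈ Y, x ≠ y → x - y ∉ Bad) → Y.card ≤ ∏ l, 2^(e l + 2)) ∧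
    (∀ j, J < j → ∀ x ∈ Gam π, x ∈ Bod π L ((2:ℚ)^j)⁻¹ → x ∈ Submodule.span ℚ (Set.range v))

section
variable {d : ℕ} {V : Type} [AddCommGroup V] [Module ℚ V] {π : (Fin d → ℚ) →ₗ[ℚ] V}
    {L : Fin d → ℕ}

lemma LSt_zero (hfin : {x | x ∈ Gam π ∧ x ∈ Bod π L 1}.Finite) : LSt π L 0 := by
  refine ⟨Fin.elim0, Fin.elim0, hfin.toFinset.card, ∅, linearIndependent_empty_type, fun l => l.elim0,
    by simp, by simp, ?_, ?_⟩
  · intro Y hY _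
    have : Y ⊆ {0} := by
      intro x hx
      have := (hY x hx).2
      simpa using this
    simpa using Finset.card_le_card this
  · intro j hj x hx hxB
    by_contra hne
    have hx0 : x ≠ 0 := by rintro rfl; exact hne (Submodule.zero_mem _)
    have h1 : (Finset.range (2^j)).card ≤ hfin.toFinset.card := by
      apply Finset.card_le_card_of_injOn (fun i => i • x)
      · intro i hi
        simp only [Set.Finite.coe_toFinset, Set.mem_ofPred_eq]
        refine ⟨AddSubgroup.nsmul_mem _ hx i, ?_⟩
        have := Bod_smul (i:ℚ) hxB
        rw [Nat.cast_smul_eq_nsmul] at this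
        refine Bod_mono ?_ this
        have hi' : (i:ℚ) ≤ 2^j := by
          have := (Finset.mem_range.1 (Finset.mem_coe.1 hi)).le
          exact_mod_cast this
        rw [abs_of_nonneg (by positivity), ← div_eq_mul_inv, div_le_one (by positivity)]
        exact hi'
      · intro a _ b _ hab
        have hab' : (a:ℚ) • x = (b:ℚ) • x := by
          simpa [Nat.cast_smul_eq_nsmul] using hab
        exact_mod_cast smul_left_injective ℚ hx0 hab'
    rw [Finset.card_range] at h1
    have := Nat.lt_two_pow_self (n := j)
    omega

lemma LSt_succ (n : ℕ) (h : LSt π L n) :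
    LSt π L (n+1) ∨ ∃ (v : Fin n → V) (e : Fin n → ℕ), LinearIndependent ℚ v ∧
      (∀ l, v l ∈ Gam π ∧ v l ∈ Bod π L ((2:ℚ)^(e l))⁻¹) ∧
      ∀ Y : Finset V, (∀ x ∈ Y, x ∈ Gam π ∧ x ∈ Bod π L 1) → Y.card ≤ ∏ l, 2^(e l + 2) := by
  classical
  obtain ⟨v, e, J, Bad, h1, h2, h4, h5, h6, h7⟩ := h
  set U := Submodule.span ℚ (Set.range v) with hU
  by_cases hall : ∀ x ∈ Gam π, x ∈ Bod π L 1 → x ∈ U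
  · right
    refine ⟨v, e, h1, h2, fun Y hY => h6 Y (fun x hx => ⟨(hY x hx).1, hall x (hY x hx).1 (hY x hx).2⟩) ?_⟩
    intro x hx y hy _ hb
    refine h5 _ hb ?_
    have := Bod_sub (hY x hx).2 (hY y hy).2
    norm_num at this
    exact this
  · left
    push Not at hall
    let P : ℕ → Prop := fun j => ∃ x ∈ Gam π, x ∈ Bod π L ((2:ℚ)^j)⁻¹ ∧ x ∉ U
    have hP0 : P 0 := by
      obtain ⟨x, hx, hx1, hx2⟩ := hall
      exact ⟨x, hx, by simpa using hx1, hx2⟩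
    set j := Nat.findGreatest P J with hj
    have hPj : P j := Nat.findGreatest_spec (Nat.zero_le J) hP0
    have hjJ : j ≤ J := Nat.findGreatest_le J
    have hgr : ∀ i, j < i → ¬ P i := by
      intro i hi hPi
      by_cases hiJ : i ≤ J
      · exact Nat.findGreatest_is_greatest hi hiJ hPi
      · obtain ⟨x, hx, hx1, hx2⟩ := hPi
        exact hx2 (h7 i (by omega) x hx hx1)
    obtain ⟨w, hwG, hwB, hwU⟩ := hPj
    have hspan : Submodule.span ℚ (Set.range (Fin.cons w v : Fin (n+1) → V)) =
        U ⊔ Submodule.span ℚ {w} := by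
      rw [Fin.range_cons, Submodule.span_insert, sup_comm]
    refine ⟨Fin.cons w v, Fin.cons j e, j, Bad ∪ {x | ∃ z ∈ Gam π, z ∈ U ⊔ Submodule.span ℚ {w} ∧
      z ∉ U ∧ x = 2^(j+2) • z}, ?_, ?_, ?_, ?_, ?_, ?_⟩
    · rw [linearIndependent_finCons]
      exact ⟨h1, hwU⟩
    · intro l
      refine Fin.cases ?_ (fun l => ?_) l
      · simpa using ⟨hwG, hwB⟩
      · simpa using h2 l
    · rw [hspan]
      rintro b (hb | ⟨z, hz, hzU, _, rfl⟩)
      · obtain ⟨z, hz, hzU, rfl⟩ := h4 b hb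
        refine ⟨2^(J-j) • z, AddSubgroup.nsmul_mem _ hz _, Submodule.mem_sup_left (nsmul_mem hzU _), ?_⟩
        rw [← mul_smul, ← pow_add]
        congr 2; omega
      · exact ⟨z, hz, hzU, rfl⟩
    · rintro b (hb | ⟨z, hz, hzU, hzn, rfl⟩)
      · exact h5 b hb
      · intro hB
        apply hgr (j+1) (by omega)
        refine ⟨z, hz, ?_, hzn⟩
        have := Bod_smul (((2:ℚ)^(j+2))⁻¹) hB
        have e1 : (((2:ℚ)^(j+2))⁻¹) • ((2^(j+2) : ℕ) • z) = z := by
          rw [← Nat.cast_smul_eq_nsmul ℚ, ← mul_smul]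
          push_cast
          rw [inv_mul_cancel₀ (by positivity), one_smul]
        rw [e1] at this
        refine Bod_mono (le_of_eq ?_) this
        rw [abs_of_nonneg (by positivity)]
        rw [pow_succ 2 (j+1), mul_inv]; ring
    · rw [hspan]
      intro Y hY hY2
      rw [Fin.prod_univ_succ]
      simp only [Fin.cons_zero, Fin.cons_succ]
      rw [mul_comm]
      refine count_step U w hwU hwG Bad (2^(j+2)) (by positivity) ?_ _ h6 Y hY hY2
      intro b hb
      obtain ⟨z, hz, hzU, rfl⟩ := h4 b hb
      refine ⟨2^(J-j) • z, AddSubgroup.nsmul_mem _ hz _, nsmul_mem hzU _, ?_⟩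
      rw [← mul_smul, ← pow_add]
      congr 2; omega
    · rw [hspan]
      intro i hi x hx hxB
      by_contra hcon
      exact hgr i hi ⟨x, hx, hxB, fun h => hcon (Submodule.mem_sup_left h)⟩

lemma lemH (hπ : Function.Surjective π) (hfin : {x | x ∈ Gam π ∧ x ∈ Bod π L 1}.Finite) :
    ∃ n ≤ d, ∃ (v : Fin n → V) (e : Fin n → ℕ), LinearIndependent ℚ v ∧
      (∀ l, v l ∈ Gam π ∧ v l ∈ Bod π L ((2:ℚ)^(e l))⁻¹) ∧
      ∀ Y : Finset V, (∀ x ∈ Y, x ∈ Gam π ∧ x ∈ Bod π L 1) → Y.card ≤ 4^n * ∏ l, 2^(e l) := by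
  have hfd : Module.Finite ℚ V := Module.Finite.of_surjective π hπ
  have hrank : Module.finrank ℚ V ≤ d := by
    have := LinearMap.finrank_le_finrank_of_surjective hπ
    simpa using this
  have hle : ∀ n (v : Fin n → V), LinearIndependent ℚ v → n ≤ d := by
    intro n v hv
    have := hv.fintype_card_le_finrank
    simp at this
    omega
  by_contra hcon
  have hst : ∀ n, LSt π L n := by
    intro n
    induction n with
    | zero => exact LSt_zero hfin
    | succ n ih =>
      rcases LSt_succ n ih with h | ⟨v, e, h1, h2, h3⟩
      · exact h
      · exfalso
        refine hcon ⟨n, hle n v h1, v, e, h1, h2, fun Y hY => (h3 Y hY).trans (le_of_eq ?_)⟩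
        simp only [pow_add, Finset.prod_mul_distrib]
        simp [mul_comm]
  obtain ⟨v, e, J, Bad, h1, _⟩ := hst (d+1)
  have := hle _ v h1
  omega
end

lemma exists_quot (d : ℕ) (x : Fin d → ℤ) (L : Fin d → ℕ) (c : ℕ) :
    ∃ (V : Type) (_ : AddCommGroup V) (_ : Module ℚ V) (π : (Fin d → ℚ) →ₗ[ℚ] V),
      Function.Surjective π ∧
      (∀ a : Fin d → ℤ, π (fun i => (a i : ℚ)) = 0 → ∑ i, a i * x i = 0) ∧
      (∀ a : Fin d → ℤ, (∀ i, |a i| ≤ 2 * c * L i) → ∑ i, a i * x i = 0 →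
        π (fun i => (a i : ℚ)) = 0) ∧
      (∀ s : ℕ, ∀ y ∈ Gam π, y ∈ Bod π L s → ∃ a : Fin d → ℤ,
        (∀ i, |a i| ≤ ((s + 2 * c * d : ℕ) : ℤ) * L i) ∧ π (fun i => (a i : ℚ)) = y) := by
  classical
  let S : Set (Fin d → ℚ) := {w | ∃ a : Fin d → ℤ, (∀ i, |a i| ≤ 2 * c * L i) ∧
    ∑ i, a i * x i = 0 ∧ (fun i => (a i : ℚ)) = w}
  let W := Submodule.span ℚ S
  refine ⟨(Fin d → ℚ) ⧸ W, inferInstance, inferInstance, W.mkQ, W.mkQ_surjective, ?_, ?_, ?_⟩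
  · intro a ha
    have ha' : (fun i => (a i : ℚ)) ∈ W := by simpa using ha
    let ψ : (Fin d → ℚ) →ₗ[ℚ] ℚ := Fintype.linearCombination ℚ (fun i => (x i : ℚ))
    have hψ : ∀ w, ψ w = ∑ i, w i * x i := by
      intro w; simp [ψ, Fintype.linearCombination_apply]
    have hW : W ≤ LinearMap.ker ψ := by
      apply Submodule.span_le.2
      rintro w ⟨a, _, h0, rfl⟩
      show ψ _ = 0
      rw [hψ]; exact_mod_cast h0
    have : ψ _ = 0 := hW ha'
    rw [hψ] at this
    exact_mod_cast this
  · intro a ha h0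
    have : (fun i => (a i : ℚ)) ∈ W := Submodule.subset_span ⟨a, ha, h0, rfl⟩
    simpa using this
  · rintro s y hy ⟨b, hb, hby⟩
    obtain ⟨a0, rfl⟩ := mem_Gam.1 hy
    have hmem : (fun i => (a0 i : ℚ)) - b ∈ W := by
      have : W.mkQ ((fun i => (a0 i : ℚ)) - b) = 0 := by rw [map_sub, hby, sub_self]
      exact (Submodule.Quotient.mk_eq_zero W).1 this
    obtain ⟨t, htS, hspan, hli⟩ := exists_linearIndependent ℚ S
    have htf : t.Finite := hli.setFinite
    have hcard : htf.toFinset.card ≤ d := by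
      have hli' : LinearIndependent ℚ (fun w : htf.toFinset => (w : Fin d → ℚ)) := by
        refine hli.comp (fun w : htf.toFinset => (⟨w.1, htf.mem_toFinset.1 w.2⟩ : t)) ?_
        intro a b h
        exact Subtype.ext (congrArg (fun z : t => z.1) h)
      have := hli'.fintype_card_le_finrank
      simpa using this
    have hmem' : (fun i => (a0 i : ℚ)) - b ∈ Submodule.span ℚ (htf.toFinset : Set (Fin d → ℚ)) := by
      rw [Set.Finite.coe_toFinset, hspan]; exact hmem
    obtain ⟨q, _, hq⟩ := Submodule.mem_span_finset.1 hmem'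
    have hα : ∀ w ∈ htf.toFinset, ∃ a : Fin d → ℤ, (∀ i, |a i| ≤ 2 * c * L i) ∧
      ∑ i, a i * x i = 0 ∧ (fun i => (a i : ℚ)) = w := fun w hw => htS (by simpa using hw)
    choose! α hα1 hα2 hα3 using hα
    refine ⟨fun i => a0 i - ∑ w ∈ htf.toFinset, ⌊q w⌋ * α w i, ?_, ?_⟩
    · intro i
      have e1 : ((a0 i - ∑ w ∈ htf.toFinset, ⌊q w⌋ * α w i : ℤ) : ℚ) =
          b i + ∑ w ∈ htf.toFinset, Int.fract (q w) * α w i := by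
        have := congrFun hq i
        simp only [Finset.sum_apply, Pi.smul_apply, Pi.sub_apply, smul_eq_mul] at this
        have h2 : ∑ w ∈ htf.toFinset, q w * w i = ∑ w ∈ htf.toFinset, q w * α w i := by
          refine Finset.sum_congr rfl fun w hw => ?_
          rw [← congrFun (hα3 w hw) i]
        rw [h2] at this
        push_cast
        simp only [Int.fract, sub_mul, Finset.sum_sub_distrib]
        linarith
      have : |((a0 i - ∑ w ∈ htf.toFinset, ⌊q w⌋ * α w i : ℤ) : ℚ)| ≤ ((s + 2 * c * d : ℕ) : ℚ) * L i := by
        rw [e1]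
        calc _ ≤ |b i| + |∑ w ∈ htf.toFinset, Int.fract (q w) * α w i| := abs_add_le _ _
          _ ≤ s * L i + ∑ w ∈ htf.toFinset, (2 * c * L i : ℚ) := by
            refine add_le_add (hb i) ((Finset.abs_sum_le_sum_abs _ _).trans
              (Finset.sum_le_sum fun w hw => ?_))
            rw [abs_mul, abs_of_nonneg (Int.fract_nonneg _)]
            have h1 : (|α w i| : ℚ) ≤ 2 * c * L i := by exact_mod_cast hα1 w hw i
            calc _ ≤ 1 * |(α w i : ℚ)| :=
                  mul_le_mul_of_nonneg_right (Int.fract_lt_one _).le (abs_nonneg _)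
              _ ≤ _ := by rw [one_mul]; exact h1
          _ ≤ s * L i + d * (2 * c * L i : ℚ) := by
            rw [Finset.sum_const, nsmul_eq_mul]
            gcongr
          _ = _ := by push_cast; ring
      exact_mod_cast this
    · have : (fun i => ((a0 i - ∑ w ∈ htf.toFinset, ⌊q w⌋ * α w i : ℤ) : ℚ)) =
          (fun i => (a0 i : ℚ)) - ∑ w ∈ htf.toFinset, (⌊q w⌋ : ℚ) • w := by
        ext i
        simp only [Pi.sub_apply, Finset.sum_apply, Pi.smul_apply, smul_eq_mul]
        push_cast
        congr 1
        refine Finset.sum_congr rfl fun w hw => ?_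
        rw [← congrFun (hα3 w hw) i]
      rw [this, map_sub]
      have : W.mkQ (∑ w ∈ htf.toFinset, (⌊q w⌋ : ℚ) • w) = 0 := by
        have : ∑ w ∈ htf.toFinset, (⌊q w⌋ : ℚ) • w ∈ W :=
          W.sum_mem fun w hw => W.smul_mem _ (Submodule.subset_span (htS (by simpa using hw)))
        exact (Submodule.Quotient.mk_eq_zero W).2 this
      rw [this, sub_zero]

noncomputable def IB {d : ℕ} (L : Fin d → ℕ) (n : ℕ) : Finset (Fin d → ℤ) :=
  Fintype.piFinset (fun i => Finset.Icc (-((n:ℤ) * L i)) ((n:ℤ) * L i))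

lemma mem_IB {d : ℕ} {L : Fin d → ℕ} {n : ℕ} {a : Fin d → ℤ} :
    a ∈ IB L n ↔ ∀ i, |a i| ≤ (n:ℤ) * L i := by
  simp [IB, abs_le]

def phi {d : ℕ} (x : Fin d → ℤ) : (Fin d → ℤ) →+ ℤ where
  toFun a := ∑ i, a i * x i
  map_zero' := by simp
  map_add' a b := by simp [add_mul, Finset.sum_add_distrib]

section
variable {d : ℕ} {V : Type} [AddCommGroup V] [DecidableEq V] (L : Fin d → ℕ)
    (ψ : (Fin d → ℤ) →+ V)

noncomputable def Qt (n : ℕ) : Finset V := (IB L n).image ψ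

variable {L ψ}
lemma mem_Qt {n : ℕ} {x : V} : x ∈ Qt L ψ n ↔ ∃ a ∈ IB L n, ψ a = x := by simp [Qt]

lemma Qt_nonempty (n : ℕ) : (Qt L ψ n).Nonempty :=
  ⟨0, mem_Qt.2 ⟨0, mem_IB.2 (fun i => by simp; positivity), map_zero _⟩⟩

lemma IB_mono {m n : ℕ} (h : m ≤ n) : IB L m ⊆ IB L n := by
  intro a ha
  rw [mem_IB] at *
  intro i
  refine (ha i).trans ?_
  gcongr

lemma Qt_mono {m n : ℕ} (h : m ≤ n) : Qt L ψ m ⊆ Qt L ψ n :=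
  Finset.image_subset_image (IB_mono h)

lemma IB_add {m n : ℕ} {a b : Fin d → ℤ} (ha : a ∈ IB L m) (hb : b ∈ IB L n) :
    a + b ∈ IB L (m + n) := by
  rw [mem_IB] at *
  intro i
  calc |a i + b i| ≤ |a i| + |b i| := abs_add_le _ _
    _ ≤ _ := add_le_add (ha i) (hb i)
    _ = _ := by push_cast; ring

lemma IB_sub {m n : ℕ} {a b : Fin d → ℤ} (ha : a ∈ IB L m) (hb : b ∈ IB L n) :
    a - b ∈ IB L (m + n) := by
  rw [sub_eq_add_neg]
  refine IB_add ha ?_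
  rw [mem_IB] at *
  intro i; simpa using hb i

lemma Qt_add {m n : ℕ} : Qt L ψ m + Qt L ψ n ⊆ Qt L ψ (m + n) := by
  intro z hz
  obtain ⟨x, hx, y, hy, rfl⟩ := Finset.mem_add.1 hz
  obtain ⟨a, ha, rfl⟩ := mem_Qt.1 hx
  obtain ⟨b, hb, rfl⟩ := mem_Qt.1 hy
  exact mem_Qt.2 ⟨a + b, IB_add ha hb, map_add _ _ _⟩

lemma Qt_sub {m n : ℕ} : Qt L ψ m - Qt L ψ n ⊆ Qt L ψ (m + n) := by
  intro z hz
  obtain ⟨x, hx, y, hy, rfl⟩ := Finset.mem_sub.1 hz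
  obtain ⟨a, ha, rfl⟩ := mem_Qt.1 hx
  obtain ⟨b, hb, rfl⟩ := mem_Qt.1 hy
  exact mem_Qt.2 ⟨a - b, IB_sub ha hb, map_sub _ _ _⟩

lemma iterAdd_Qt (t : ℕ) : ∀ (N : ℕ) (T : Finset V), T ⊆ Qt L ψ N →
    iterAdd (Qt L ψ 1) t T ⊆ Qt L ψ (N + t) := by
  induction t with
  | zero => intro N T h; exact h
  | succ t ih =>
    intro N T h
    have := ih (N+1) (T + Qt L ψ 1) ((Finset.add_subset_add_right h).trans Qt_add)
    rw [show N + (t+1) = N + 1 + t by ring]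
    exact this

lemma cover1 (l : ℤ) (n : ℕ) : ∀ a : ℤ, |a| ≤ ((n+1:ℕ):ℤ) * l → 
    ∃ j ∈ Finset.range (n+1), |a - (2*j+1-((n+1:ℕ):ℤ))*l| ≤ l := by
  induction n with
  | zero => intro a ha; exact ⟨0, by simp, by simpa using ha⟩
  | succ n ih =>
    intro a ha
    rw [abs_le] at ha
    push_cast at ha
    by_cases h : a ≤ -(n*l)
    · refine ⟨0, by simp, ?_⟩
      rw [abs_le]; push_cast
      constructor <;> nlinarith
    · obtain ⟨j, hj, hj2⟩ := ih (a - l) (by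
        rw [abs_le]; push_cast; constructor <;> nlinarith)
      refine ⟨j+1, by simpa using hj, ?_⟩
      rw [abs_le] at *
      push_cast at *
      constructor <;> nlinarith

lemma g4 (n : ℕ) (hn : 1 ≤ n) : (Qt L ψ n).card ≤ n^d * (Qt L ψ 1).card := by
  classical
  obtain ⟨n, rfl⟩ : ∃ m, n = m + 1 := ⟨n-1, by omega⟩
  let Z : Finset (Fin d → ℕ) := Fintype.piFinset (fun _ => Finset.range (n+1))
  let X : Finset V := Z.image (fun j => ψ (fun i => (2*j i+1-((n+1:ℕ):ℤ))*L i))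
  have hsub : Qt L ψ (n+1) ⊆ X + Qt L ψ 1 := by
    intro y hy
    obtain ⟨a, ha, rfl⟩ := mem_Qt.1 hy
    rw [mem_IB] at ha
    have := fun i => cover1 (L i) n (a i) (ha i)
    choose j hj1 hj2 using this
    rw [Finset.mem_add]
    refine ⟨_, Finset.mem_image_of_mem _ (Fintype.mem_piFinset.2 hj1), _, mem_Qt.2
      ⟨fun i => a i - (2*j i+1-((n+1:ℕ):ℤ))*L i, mem_IB.2 (by simpa using hj2), rfl⟩, ?_⟩
    rw [← map_add]
    congr 1; ext i; simp
  calc _ ≤ _ := Finset.card_le_card hsub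
    _ ≤ _ := Finset.card_add_le
    _ ≤ _ := by
      gcongr
      refine Finset.card_image_le.trans ?_
      simp [Z]

lemma g5 (p n : ℕ) (hn : 1 ≤ n) :
    (Qt L ψ (p*n)).card * (Qt L ψ 1).card ≤ (Qt L ψ (p+1)).card * (Qt L ψ (3*n)).card := by
  classical
  have hpos : (0:ℝ) < (Qt L ψ 1).card := by
    exact_mod_cast Finset.card_pos.2 (Qt_nonempty 1)
  obtain ⟨F, hF, hFc, hcov⟩ := Finset.ruzsa_covering_add (K := ((Qt L ψ (p+1)).card : ℝ) / (Qt L ψ 1).card)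
    (A := Qt L ψ p) (B := Qt L ψ 1) (Qt_nonempty 1) (by
      rw [div_mul_cancel₀ _ hpos.ne']
      exact_mod_cast Finset.card_le_card Qt_add)
  have hsub : Qt L ψ (p*n) ⊆ F.image (fun y => n • y) + Qt L ψ (3*n) := by
    intro y hy
    obtain ⟨a, ha, rfl⟩ := mem_Qt.1 hy
    rw [mem_IB] at ha
    have h1 : (fun i => (a i).tdiv n) ∈ IB L p := by
      rw [mem_IB]; intro i
      have hh := ha i
      have e0 : |(a i).tdiv n| = |a i|.tdiv n := by
        rw [Int.abs_eq_natAbs, Int.abs_eq_natAbs, Int.natAbs_tdiv, Int.natAbs_natCast]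
        rfl
      rw [e0]
      have : |a i| < ((p:ℤ) * L i + 1) * n := by
        push_cast at hh; nlinarith
      have h2 := Int.ediv_lt_of_lt_mul (by omega : (0:ℤ) < n) this
      have h3 : |a i|.tdiv (n:ℤ) = |a i| / n := Int.tdiv_eq_ediv_of_nonneg (abs_nonneg _)
      omega
    have h2 : (fun i => (a i).tmod n) ∈ IB L n := by
      rw [mem_IB]; intro i
      have hh := ha i
      rcases Nat.eq_zero_or_pos (L i) with h0 | h0
      · rw [h0] at hh
        have : a i = 0 := by simpa using hh
        simp [this]; positivity
      · have h4 : |(a i).tmod n| < n := by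
          rw [Int.abs_eq_natAbs, Int.natAbs_tmod]
          have := Nat.mod_lt (a i).natAbs (by omega : 0 < (n:ℤ).natAbs)
          rw [Int.natAbs_natCast] at this ⊢
          exact_mod_cast this
        have : (n:ℤ) * 1 ≤ n * L i := by gcongr; exact_mod_cast h0
        omega
    have h3 := hcov (mem_Qt.2 ⟨_, h1, rfl⟩)
    obtain ⟨f, hf, w, hw, hfw⟩ := Finset.mem_add.1 h3
    obtain ⟨b, hb, rfl⟩ := mem_Qt.1 (Qt_sub hw)
    rw [Finset.mem_add]
    refine ⟨n • f, Finset.mem_image_of_mem _ hf, ψ (n • b + fun i => (a i).tmod n), mem_Qt.2 ⟨_, ?_, rfl⟩, ?_⟩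
    · rw [show 3 * n = 2 * n + n by ring]
      refine IB_add ?_ h2
      rw [mem_IB] at *
      intro i
      have := hb i
      simp only [Pi.smul_apply, nsmul_eq_mul, abs_mul, Nat.abs_cast]
      push_cast at *
      nlinarith
    · have : a = n • (fun i => (a i).tdiv n) + fun i => (a i).tmod n := by
        ext i
        simp only [Pi.add_apply, nsmul_eq_mul]
        exact (Int.mul_tdiv_add_tmod (a i) n).symm
      conv_rhs => rw [this]
      rw [map_add, map_add, map_nsmul, map_nsmul, ← hfw]
      rw [smul_add, add_assoc]
  have h1 : (Qt L ψ (p*n)).card ≤ F.card * (Qt L ψ (3*n)).card :=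
    (Finset.card_le_card hsub).trans (Finset.card_add_le.trans (Nat.mul_le_mul_right _ Finset.card_image_le))
  have h2 : F.card * (Qt L ψ 1).card ≤ (Qt L ψ (p+1)).card := by
    rw [le_div_iff₀ hpos] at hFc
    exact_mod_cast hFc
  nlinarith [Nat.zero_le (Qt L ψ (3*n)).card, Nat.zero_le (Qt L ψ 1).card]
end

lemma card_image_le_image {α β γ : Type} [DecidableEq β] [DecidableEq γ] (s : Finset α)
    (f : α → β) (g : α → γ) (h : ∀ a ∈ s, ∀ b ∈ s, f a = f b → g a = g b) :
    (s.image g).card ≤ (s.image f).card := by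
  classical
  have h1 : ∀ y ∈ s.image g, ∃ a ∈ s, g a = y := fun y hy => by simpa using hy
  rcases s.eq_empty_or_nonempty with rfl | ⟨a0, _⟩
  · simp
  have : Nonempty α := ⟨a0⟩
  choose! r hr1 hr2 using h1
  apply Finset.card_le_card_of_injOn (fun y => f (r y))
  · intro y hy
    exact Finset.mem_image_of_mem _ (hr1 y hy)
  · intro y hy z hz hyz
    rw [← hr2 y hy, ← hr2 z hz]
    exact h _ (hr1 y hy) _ (hr1 z hz) hyz

lemma interface (d : ℕ) (x : Fin d → ℤ) (L : Fin d → ℕ) (c : ℕ) :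
    ∃ G : ℕ → ℕ,
      (∀ n ≤ c, G n ≤ (Qt L (phi x) n).card) ∧
      (Qt L (phi x) 1).card ≤ G 1 ∧ Monotone G ∧
      (∀ n, 1 ≤ n → G n ≤ n^d * G 1) ∧
      (∀ p n, 1 ≤ n → G (p*n) * G 1 ≤ G (p+1) * G (3*n)) ∧
      (∀ t, 4^d * G ((2*c+1)*d + t) < 2^t * G 1 →
        ∃ (ι : Type) (_ : Fintype ι) (y : ι → ℤ) (M : ι → ℕ), Fintype.card ι ≤ d + 2*t ∧
          ∏ i, (2 * M i + 1) ≤ 2^d * 9^t * G ((2*c+1)*d) ∧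
          ∀ q ∈ Qt L (phi x) 1, ∃ b : ι → ℤ, (∀ i, |b i| ≤ M i) ∧ q = ∑ i, b i * y i) := by
  classical
  obtain ⟨V, _, _, π, hsurj, k1, k2, k3⟩ := exists_quot d x L c
  let ψ : (Fin d → ℤ) →+ V := π.toAddMonoidHom.comp ((Int.castAddHom ℚ).compLeft (Fin d))
  have hψ : ∀ a, ψ a = π (fun i => (a i : ℚ)) := fun a => rfl
  have k1' : ∀ a b, ψ a = ψ b → phi x a = phi x b := by
    intro a b hab
    have : ψ (a - b) = 0 := by rw [map_sub, hab, sub_self]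
    have h2 : phi x (a - b) = 0 := k1 _ this
    rw [map_sub] at h2
    exact sub_eq_zero.1 h2
  refine ⟨fun n => (Qt L ψ n).card, ?_, ?_, fun m n h => Finset.card_le_card (Qt_mono h),
    fun n hn => g4 n hn, fun p n hn => g5 p n hn, ?_⟩
  · intro n hn
    apply card_image_le_image
    intro a ha b hb hab
    have h1 : phi x (a - b) = 0 := by rw [map_sub, hab, sub_self]
    have h2 := mem_IB.1 (IB_mono (by omega : n + n ≤ 2 * c) (IB_sub ha hb))
    have h3 : ψ (a - b) = 0 := k2 _ (by simpa using h2) h1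
    rw [map_sub] at h3
    exact sub_eq_zero.1 h3
  · apply card_image_le_image
    intro a _ b _ hab
    exact k1' a b hab
  · intro t ht
    have k3' : ∀ s : ℕ, ∀ y ∈ Gam π, y ∈ Bod π L s → y ∈ Qt L ψ (s + 2*c*d) := by
      intro s y hy hyB
      obtain ⟨a, ha, rfl⟩ := k3 s y hy hyB
      exact mem_Qt.2 ⟨a, mem_IB.2 ha, rfl⟩
    have hfin : {x | x ∈ Gam π ∧ x ∈ Bod π L 1}.Finite := by
      refine (Qt L ψ (1 + 2*c*d)).finite_toSet.subset ?_
      rintro y ⟨hy, hyB⟩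
      exact k3' 1 y hy (by simpa using hyB)
    obtain ⟨n, hn, v, e, hli, hv, hcount⟩ := lemH hsurj hfin
    have hG1 : (Qt L ψ 1).card ≤ 4^n * ∏ l, 2^(e l) := by
      apply hcount
      intro y hy
      obtain ⟨a, ha, rfl⟩ := mem_Qt.1 hy
      refine ⟨⟨a, rfl⟩, ⟨fun i => (a i : ℚ), fun i => ?_, rfl⟩⟩
      have := mem_IB.1 ha i
      show |(a i : ℚ)| ≤ _
      exact_mod_cast this
    let Z : Finset (Fin n → ℕ) := Fintype.piFinset (fun l => Finset.range (2^(e l)))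
    let T : Finset V := Z.image (fun u => ∑ l, u l • v l)
    have hTcard : T.card = ∏ l, 2^(e l) := by
      rw [Finset.card_image_of_injective]
      · simp [Z]
      · intro u u' huu
        have := Fintype.linearIndependent_iff.1 hli (fun l => (u l : ℚ) - u' l) (by
          simp only [sub_smul, Finset.sum_sub_distrib, Nat.cast_smul_eq_nsmul]
          exact sub_eq_zero.2 huu)
        ext l
        have h := this l
        rw [sub_eq_zero] at h
        exact_mod_cast h
    have hTN : T ⊆ Qt L ψ ((2*c+1)*d) := by
      intro y hy
      obtain ⟨u, hu, rfl⟩ := Finset.mem_image.1 hy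
      rw [show (2*c+1)*d = d + 2*c*d by ring]
      refine k3' d _ (AddSubgroup.sum_mem _ fun l _ => AddSubgroup.nsmul_mem _ (hv l).1 _) ?_
      have : ∀ s : Finset (Fin n), ∑ l ∈ s, u l • v l ∈ Bod π L (s.card : ℚ) := by
        intro s
        induction s using Finset.induction_on with
        | empty => exact ⟨0, fun i => by simp, by simp⟩
        | insert l s hl ih =>
          rw [Finset.sum_insert hl, Finset.card_insert_of_notMem hl]
          push_cast
          rw [add_comm (s.card : ℚ)]
          refine Bod_add ?_ ih
          have h1 := Bod_smul (u l : ℚ) (hv l).2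
          rw [Nat.cast_smul_eq_nsmul] at h1
          refine Bod_mono ?_ h1
          have hi' : (u l:ℚ) ≤ 2^(e l) := by
            have := (Finset.mem_range.1 (Fintype.mem_piFinset.1 hu l)).le
            exact_mod_cast this
          rw [abs_of_nonneg (by positivity), ← div_eq_mul_inv, div_le_one (by positivity)]
          exact hi'
      refine Bod_mono ?_ (this Finset.univ)
      simpa using hn
    have hTne : T.Nonempty := by
      rw [← Finset.card_pos, hTcard]
      positivity
    have h4 : 4^n ≤ 4^d := Nat.pow_le_pow_right (by norm_num) hn
    have hlt : (iterAdd (Qt L ψ 1) t T).card < 2^t * T.card := by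
      have h1 := Finset.card_le_card (iterAdd_Qt (L := L) (ψ := ψ) t _ T hTN)
      rw [← hTcard] at hG1
      have h2 : 4^d * (iterAdd (Qt L ψ 1) t T).card < 4^d * (2^t * T.card) := by
        calc _ ≤ _ := Nat.mul_le_mul_left _ h1
          _ < _ := ht
          _ ≤ 2^t * (4^d * T.card) := by gcongr; exact hG1.trans (by gcongr)
          _ = _ := by ring
      exact lt_of_mul_lt_mul_left h2 (by positivity)
    obtain ⟨ι, hι, f, hf1, hf2, hf3⟩ := greedy (Qt L ψ 1) 2 t T hTne hlt
    have hf' : ∀ i, ∃ b, ψ b = f i := fun i => by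
      obtain ⟨b, _, hb⟩ := mem_Qt.1 (hf2 i)
      exact ⟨b, hb⟩
    choose β hβ using hf'
    have hv' : ∀ l, ∃ b, ψ b = v l := fun l => (hv l).1
    choose α hα using hv'
    refine ⟨Fin n ⊕ ι, inferInstance, Sum.elim (fun l => phi x (α l)) (fun i => phi x (β i)),
      Sum.elim (fun l => 2^(e l) - 1) (fun _ => 1), ?_, ?_, ?_⟩
    · rw [Fintype.card_sum, Fintype.card_fin]; omega
    · rw [Fintype.prod_sum_type]
      simp only [Sum.elim_inl, Sum.elim_inr]
      have h1 : ∏ l, (2 * (2^(e l) - 1) + 1) ≤ 2^n * ∏ l, 2^(e l) := by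
        calc _ ≤ ∏ l : Fin n, 2 * 2^(e l) := by
              apply Finset.prod_le_prod'
              intro l _
              have : 1 ≤ 2^(e l) := Nat.one_le_two_pow
              omega
          _ = _ := by rw [Finset.prod_mul_distrib]; simp
      rw [← hTcard] at h1
      have h2 : ∏ _i : ι, (2 * 1 + 1) ≤ 9^t := by
        rw [Finset.prod_const, Finset.card_univ, show (9:ℕ) = 3^2 by norm_num, ← pow_mul]
        exact Nat.pow_le_pow_right (by norm_num) hf1
      have h3 := Finset.card_le_card hTN
      have h5 : 2^n ≤ 2^d := Nat.pow_le_pow_right (by norm_num) hn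
      calc _ ≤ (2^n * T.card) * 9^t := Nat.mul_le_mul h1 h2
        _ ≤ (2^d * (Qt L ψ ((2*c+1)*d)).card) * 9^t := by gcongr
        _ = _ := by ring
    · intro q hq
      obtain ⟨a, ha, rfl⟩ := mem_Qt.1 hq
      obtain ⟨u', hu', w', hw', b, hb, hab⟩ := hf3 (ψ a) (mem_Qt.2 ⟨a, ha, rfl⟩)
      obtain ⟨u, hu, rfl⟩ := Finset.mem_image.1 hu'
      obtain ⟨w, hw, rfl⟩ := Finset.mem_image.1 hw'
      refine ⟨Sum.elim (fun l => (u l : ℤ) - w l) b, ?_, ?_⟩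
      · rintro (l | i)
        · have h1 := Finset.mem_range.1 (Fintype.mem_piFinset.1 hu l)
          have h2 := Finset.mem_range.1 (Fintype.mem_piFinset.1 hw l)
          simp only [Sum.elim_inl]
          rw [abs_le]; constructor <;> omega
        · simpa using hb i
      · have : ψ a = ψ (∑ l, ((u l : ℤ) - w l) • α l + ∑ i, b i • β i) := by
          rw [hab, map_add, map_sum, map_sum]
          simp only [map_zsmul, map_sub, map_nsmul, hα, hβ, sub_smul, Finset.sum_sub_distrib, natCast_zsmul]
        rw [k1' _ _ this, map_add, map_sum, map_sum, Fintype.sum_sum_type]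
        simp only [map_zsmul, Sum.elim_inl, Sum.elim_inr, smul_eq_mul]

def smf (A : Finset ℤ) : ℕ → Finset ℤ
  | 0 => {0}
  | n+1 => smf A n + A

lemma smf_eq (A : Finset ℤ) (n : ℕ) : smf A n = n • A := by
  induction n with
  | zero => rw [zero_nsmul]; rfl
  | succ n ih => rw [smf, ih, succ_nsmul]

lemma smf_add (A : Finset ℤ) (m n : ℕ) : smf A m + smf A n = smf A (m + n) := by
  simp only [smf_eq, add_nsmul]

lemma smf_one (A : Finset ℤ) : smf A 1 = A := by simp [smf_eq]
lemma smf_two (A : Finset ℤ) : smf A 2 = A + A := by rw [smf_eq, two_nsmul]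

lemma plun (A : Finset ℤ) (hA : A.Nonempty) (K : ℝ) (hK : ((A + A).card : ℝ) ≤ K * A.card)
    (m n : ℕ) : ((smf A m - smf A n).card : ℝ) ≤ K^(m+n) * A.card := by
  have h := Finset.pluennecke_ruzsa_inequality_nsmul_sub_nsmul_add hA A m n
  rw [← smf_eq, ← smf_eq] at h
  have h' : ((smf A m - smf A n).card : ℝ) ≤ (((A+A).card : ℝ) / A.card)^(m+n) * A.card := by
    have h2 := (NNRat.cast_le (K := ℝ)).2 h
    push_cast at h2
    exact h2
  refine h'.trans ?_
  have hp : (0:ℝ) < A.card := by exact_mod_cast hA.card_pos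
  gcongr
  rw [div_le_iff₀ hp]; exact hK

lemma smf_sub (A : Finset ℤ) (n : ℕ) : smf A n - smf A n ⊆ smf (A - A) n := by
  induction n with
  | zero => simp [smf]
  | succ n ih =>
    simp only [smf]
    rw [add_sub_add_comm]
    exact Finset.add_subset_add_right ih

lemma smf_card (F : Finset ℤ) (n : ℕ) : (smf F n).card ≤ (n+1)^F.card := by
  have hsub : smf F n ⊆ (Fintype.piFinset (fun _ : F => Finset.range (n+1))).image
      (fun c => ∑ f : F, (c f : ℤ) * f) := by
    induction n with
    | zero => simp [smf]
    | succ n ih =>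
      intro y hy
      obtain ⟨u, hu, f, hf, rfl⟩ := Finset.mem_add.1 hy
      obtain ⟨c, hc, rfl⟩ := Finset.mem_image.1 (ih hu)
      rw [Fintype.mem_piFinset] at hc
      refine Finset.mem_image.2 ⟨fun g => c g + if g = ⟨f, hf⟩ then 1 else 0, ?_, ?_⟩
      · rw [Fintype.mem_piFinset]
        intro g
        have := Finset.mem_range.1 (hc g)
        rw [Finset.mem_range]
        split_ifs <;> omega
      · push_cast
        simp [add_mul, Finset.sum_add_distrib]
  refine (Finset.card_le_card hsub).trans (Finset.card_image_le.trans ?_)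
  simp

lemma growth2 (A : Finset ℤ) (hA : A.Nonempty) (K : ℝ) (hK : ((A + A).card : ℝ) ≤ K * A.card) :
    ∃ F : ℕ, (F : ℝ) ≤ K^5 ∧ ∀ n : ℕ, 1 ≤ n →
      ((smf A n - smf A n).card : ℝ) ≤ (n:ℝ)^F * (K^2 * A.card) := by
  have e1 : (A - A) + (A - A) = smf A 2 - smf A 2 := by
    rw [smf_two, add_sub_add_comm]
  obtain ⟨F, -, hF, hcov⟩ := Finset.ruzsa_covering_add (K := K^5) (A := smf A 2 - smf A 2) (B := A) hA (by
    have := plun A hA K hK 3 2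
    have e : smf A 2 - smf A 2 + A = smf A 3 - smf A 2 := by
      rw [show smf A 3 = smf A 2 + A from rfl]
      simp only [sub_eq_add_neg]; rw [add_right_comm]
    rw [e]; exact this)
  rw [← e1] at hcov
  refine ⟨F.card, hF, ?_⟩
  have hind : ∀ n, smf (A - A) (n+1) ⊆ smf F n + (A - A) := by
    intro n
    induction n with
    | zero => simp [smf]
    | succ n ih =>
      calc smf (A - A) (n+1+1) = smf (A-A) (n+1) + (A - A) := rfl
        _ ⊆ (smf F n + (A - A)) + (A - A) := Finset.add_subset_add_right ih
        _ = smf F n + ((A - A) + (A - A)) := add_assoc _ _ _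
        _ ⊆ smf F n + (F + (A - A)) := Finset.add_subset_add_left hcov
        _ = _ := (add_assoc _ _ _).symm
  intro n hn
  obtain ⟨m, rfl⟩ : ∃ m, n = m + 1 := ⟨n-1, by omega⟩
  have h1 := plun A hA K hK 1 1
  rw [smf_one] at h1
  have h2 : (smf A (m+1) - smf A (m+1)).card ≤ (m+1)^F.card * (A - A).card := by
    refine (Finset.card_le_card ((smf_sub A (m+1)).trans (hind m))).trans (Finset.card_add_le.trans ?_)
    exact Nat.mul_le_mul_right _ (smf_card F m)
  calc _ ≤ (((m+1)^F.card * (A - A).card : ℕ) : ℝ) := by exact_mod_cast h2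
    _ = ((m+1:ℕ):ℝ)^F.card * (A - A).card := by push_cast; ring
    _ ≤ _ := by gcongr

lemma iterAdd_smf (A : Finset ℤ) (t : ℕ) : ∀ (m : ℕ) (T : Finset ℤ), T ⊆ smf A m - smf A 2 →
    iterAdd A t T ⊆ smf A (m + t) - smf A 2 := by
  induction t with
  | zero => intro m T h; exact h
  | succ t ih =>
    intro m T h
    rw [show m + (t+1) = m + 1 + t by ring]
    refine ih (m+1) (T + A) ((Finset.add_subset_add_right h).trans (le_of_eq ?_))
    rw [show smf A (m+1) = smf A m + A from rfl]
    simp only [sub_eq_add_neg]; rw [add_right_comm]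

section
variable {d : ℕ} (L : Fin d → ℕ) (x : Fin d → ℤ) 

lemma Qt_succ (n : ℕ) : Qt L (phi x) (n+1) ⊆ Qt L (phi x) n + Qt L (phi x) 1 := by
  intro y hy
  obtain ⟨a, ha, rfl⟩ := mem_Qt.1 hy
  rw [mem_IB] at ha
  have hb : ∀ i, ∃ b : ℤ, |b| ≤ (n:ℤ) * L i ∧ |a i - b| ≤ L i := by
    intro i
    have h := ha i
    have h0 : 0 ≤ (n:ℤ) * L i := by positivity
    push_cast at h
    rw [add_mul, one_mul] at h
    generalize (n:ℤ) * L i = m at *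
    refine ⟨max (-m) (min (a i) m), ?_, ?_⟩ <;> rw [abs_le] at * <;> constructor <;> omega
  choose b hb1 hb2 using hb
  rw [Finset.mem_add]
  refine ⟨_, mem_Qt.2 ⟨b, mem_IB.2 hb1, rfl⟩, _, mem_Qt.2 ⟨a - b, mem_IB.2 (by simpa using hb2), rfl⟩, ?_⟩
  rw [← map_add]; simp

lemma Qt_smf (A : Finset ℤ) (h1 : Qt L (phi x) 1 ⊆ smf A 4 - smf A 4) (n : ℕ) :
    Qt L (phi x) n ⊆ smf A (4*n) - smf A (4*n) := by
  induction n with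
  | zero =>
    intro y hy
    obtain ⟨a, ha, rfl⟩ := mem_Qt.1 hy
    have : a = 0 := by ext i; simpa using mem_IB.1 ha i
    simp [this, smf]
  | succ n ih =>
    refine (Qt_succ L x n).trans ((Finset.add_subset_add ih h1).trans (le_of_eq ?_))
    rw [mul_add, ← smf_add, mul_one, add_sub_add_comm]
end

lemma Q_facts (A Q : Finset ℤ) (d : ℕ) (a : ℤ) (x : Fin d → ℤ) (L : Fin d → ℕ)
    (hQ : ∀ q : ℤ, q ∈ Q ↔ ∃ l : Fin d → ℕ, (∀ i, l i < L i) ∧ q = a + ∑ i, (l i : ℤ) * x i)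
    (hQA : Q ⊆ A + A - A - A) (hne : Q.Nonempty) :
    Qt (fun i => L i - 1) (phi x) 1 ⊆ smf A 4 - smf A 4 ∧
    Q.card ≤ (Qt (fun i => L i - 1) (phi x) 1).card ∧
    (∀ q ∈ Q, ∀ q' ∈ Q, q - q' ∈ Qt (fun i => L i - 1) (phi x) 1) ∧ Q ⊆ smf A 2 - smf A 2 := by
  have hQA2 : Q ⊆ smf A 2 - smf A 2 := by
    rw [smf_two]
    refine hQA.trans (le_of_eq ?_)
    simp only [sub_eq_add_neg, neg_add, add_assoc]
  have hdiff : ∀ q ∈ Q, ∀ q' ∈ Q, q - q' ∈ Qt (fun i => L i - 1) (phi x) 1 := by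
    intro q hq q' hq'
    obtain ⟨l, hl, rfl⟩ := (hQ q).1 hq
    obtain ⟨l', hl', rfl⟩ := (hQ q').1 hq'
    refine mem_Qt.2 ⟨fun i => (l i : ℤ) - l' i, mem_IB.2 fun i => ?_, ?_⟩
    · have := hl i
      have := hl' i
      rw [abs_le]; constructor <;> omega
    · show ∑ i, ((l i : ℤ) - l' i) * x i = _
      simp only [sub_mul, Finset.sum_sub_distrib]; ring
  obtain ⟨q0, hq0⟩ := hne
  have hLpos : ∀ i, 0 < L i := by
    obtain ⟨l, hl, _⟩ := (hQ q0).1 hq0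
    intro i; have := hl i; omega
  refine ⟨?_, ?_, hdiff, hQA2⟩
  · intro y hy
    obtain ⟨b, hb, rfl⟩ := mem_Qt.1 hy
    rw [mem_IB] at hb
    have h1 : a + ∑ i, ((b i).toNat : ℤ) * x i ∈ Q := (hQ _).2 ⟨fun i => (b i).toNat, fun i => by
      have := hb i; have := hLpos i; rw [abs_le] at *; dsimp only; omega, rfl⟩
    have h2 : a + ∑ i, ((-b i).toNat : ℤ) * x i ∈ Q := (hQ _).2 ⟨fun i => (-b i).toNat, fun i => by
      have := hb i; have := hLpos i; rw [abs_le] at *; dsimp only; omega, rfl⟩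
    have e : phi x b = (a + ∑ i, ((b i).toNat : ℤ) * x i) - (a + ∑ i, ((-b i).toNat : ℤ) * x i) := by
      rw [add_sub_add_left_eq_sub, ← Finset.sum_sub_distrib]
      show ∑ i, b i * x i = _
      refine Finset.sum_congr rfl fun i _ => ?_
      rw [← sub_mul, Int.toNat_sub_toNat_neg]
    rw [e]
    have := Finset.sub_mem_sub (hQA2 h1) (hQA2 h2)
    have e2 : smf A 2 - smf A 2 - (smf A 2 - smf A 2) = smf A 4 - smf A 4 := by
      rw [← smf_add A 2 2]
      simp only [sub_eq_add_neg, neg_add, neg_neg]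
      generalize smf A 2 = X
      generalize -X = Y
      rw [add_comm Y X, add_add_add_comm]
    rwa [e2] at this
  · apply Finset.card_le_card_of_injOn (fun q => q - q0)
    · intro q hq; exact hdiff q hq q0 hq0
    · intro q _ q' _ h; exact sub_left_injective h

lemma num_a (K k E a : ℝ) (d z : ℕ) (G : ℕ → ℝ) (hK : 2 ≤ K) (hKk : K ≤ Real.exp k) (ha : 0 < a)
    (hk : (1/2:ℝ) ≤ k) (hE : E = d + K * k) (hd : (d:ℝ)^2 ≤ k) (hz : (z:ℝ) ≤ 100020 * E) (hz1 : 1 ≤ z)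
    (h1 : G 1 ≤ K^8 * a) (g4 : ∀ n : ℕ, 1 ≤ n → G n ≤ (n:ℝ)^d * G 1) :
    G z ≤ Real.exp (20000 * E) * a := by
  have hd0 : (0:ℝ) ≤ d := by positivity
  have hEk : 2 * k ≤ E := by nlinarith
  have hE1 : 1 ≤ E := by nlinarith
  have hdE : (d:ℝ) ≤ E := by nlinarith
  have hz0 : (0:ℝ) < z := by exact_mod_cast hz1
  have hs := Real.sqrt_nonneg E
  have hs2 := Real.sq_sqrt (by linarith : 0 ≤ E)
  have hds : (d:ℝ) ≤ Real.sqrt E := Real.le_sqrt_of_sq_le (by linarith)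
  have hspos : 0 < Real.sqrt E := Real.sqrt_pos.2 (by linarith)
  -- z ≤ exp (12 + 2 sqrt E)
  have he : (100020:ℝ) ≤ Real.exp 12 := by
    have h := Real.exp_one_gt_d9
    have : Real.exp 12 = (Real.exp 1)^12 := by rw [← Real.exp_nat_mul]; norm_num
    rw [this]
    calc (100020:ℝ) ≤ 2.7^12 := by norm_num
      _ ≤ _ := by gcongr; linarith
  have hE2 : E ≤ Real.exp (2 * Real.sqrt E) := by
    have h := Real.add_one_le_exp (Real.sqrt E)
    calc E = Real.sqrt E ^ 2 := hs2.symm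
      _ ≤ (Real.exp (Real.sqrt E))^2 := by gcongr; linarith
      _ = _ := by rw [← Real.exp_nat_mul]; norm_num
  have hz2 : (z:ℝ) ≤ Real.exp (12 + 2 * Real.sqrt E) := by
    rw [Real.exp_add]
    refine hz.trans ?_
    gcongr
  have hzd : (z:ℝ)^d ≤ Real.exp (14 * E) := by
    calc (z:ℝ)^d ≤ (Real.exp (12 + 2 * Real.sqrt E))^d := by gcongr
      _ = Real.exp (d * (12 + 2 * Real.sqrt E)) := by rw [← Real.exp_nat_mul]
      _ ≤ _ := by apply Real.exp_le_exp.2; nlinarith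
  have hK8 : K^8 ≤ Real.exp (8 * E) := by
    calc K^8 ≤ (Real.exp k)^8 := by gcongr
      _ = Real.exp (8 * k) := by rw [← Real.exp_nat_mul]; norm_num
      _ ≤ _ := by apply Real.exp_le_exp.2; nlinarith
  calc G z ≤ (z:ℝ)^d * G 1 := g4 z hz1
    _ ≤ (z:ℝ)^d * (K^8 * a) := by gcongr
    _ ≤ Real.exp (14 * E) * (Real.exp (8*E) * a) := by gcongr
    _ = Real.exp (22 * E) * a := by rw [← mul_assoc, ← Real.exp_add]; ring_nf
    _ ≤ _ := by gcongr; norm_num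

lemma num_b (K η k E a : ℝ) (d z : ℕ) (G : ℕ → ℝ) (hK : 2 ≤ K) (hη : 0 < η) (hKk : K ≤ Real.exp k)
    (hηk : η⁻¹ ≤ Real.exp k) (ha : 0 < a)
    (hk : (1/2:ℝ) ≤ k) (hE : E = d + K * k) (hd : k < (d:ℝ)^2) (hdK : (d:ℝ) ≤ Real.exp K)
    (hz : (z:ℝ) ≤ 100020 * E)
    (h1 : η * a ≤ G 1) (h9 : G 9 ≤ K^72 * a) (hG : Monotone G)
    (g5 : ∀ n : ℕ, 1 ≤ n → G (8*n) * G 1 ≤ G 9 * G (3*n)) :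
    G z ≤ Real.exp (20000 * E) * a := by
  have hG1 : 0 < G 1 := lt_of_lt_of_le (by positivity) h1
  have hK72 : K^72 ≤ Real.exp (72 * k) := by
    calc K^72 ≤ (Real.exp k)^72 := by gcongr
      _ = Real.exp (72 * k) := by rw [← Real.exp_nat_mul]; norm_num
  have h9' : G 9 ≤ Real.exp (73 * k) * G 1 := by
    have : a ≤ η⁻¹ * G 1 := by
      rw [inv_mul_eq_div, le_div_iff₀ hη]; linarith
    calc G 9 ≤ K^72 * a := h9
      _ ≤ Real.exp (72 * k) * (Real.exp k * G 1) := by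
        gcongr
        exact this.trans (by gcongr)
      _ = _ := by rw [← mul_assoc, ← Real.exp_add]; ring_nf
  have hstep : ∀ n : ℕ, 1 ≤ n → G (8*n) ≤ Real.exp (73*k) * G (4*n) := by
    intro n hn
    have h2 : G (3*n) ≤ G (4*n) := hG (by omega)
    have h3 : 0 < G (3*n) := lt_of_lt_of_le hG1 (hG (by omega))
    have : G (8*n) * G 1 ≤ (Real.exp (73*k) * G (4*n)) * G 1 := by
      calc _ ≤ _ := g5 n hn
        _ ≤ (Real.exp (73 * k) * G 1) * G (4*n) := by gcongr
        _ = _ := by ring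
    exact le_of_mul_le_mul_right this hG1
  have hind : ∀ i : ℕ, G (2^(i+2)) ≤ Real.exp (73 * k * (i+1)) * a := by
    intro i
    induction i with
    | zero =>
      calc G (2^(0+2)) ≤ G 9 := hG (by norm_num)
        _ ≤ Real.exp (72*k) * a := h9.trans (by gcongr)
        _ ≤ _ := by
          refine mul_le_mul_of_nonneg_right (Real.exp_le_exp.2 ?_) ha.le
          norm_num; linarith
    | succ i ih =>
      have := hstep (2^i) Nat.one_le_two_pow
      rw [show 2^(i+1+2) = 8 * 2^i by ring]
      rw [show 2^(i+2) = 4 * 2^i by ring] at ih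
      calc _ ≤ _ := this
        _ ≤ Real.exp (73*k) * (Real.exp (73 * k * (i+1)) * a) := by gcongr
        _ = _ := by rw [← mul_assoc, ← Real.exp_add]; push_cast; ring_nf
  set i := ⌈20*K⌉₊ with hi
  have hi1 : 20 * K ≤ i := Nat.le_ceil _
  have hi2 : (i:ℝ) < 20 * K + 1 := Nat.ceil_lt_add_one (by linarith)
  have hzi : z ≤ 2^(i+2) := by
    have hd1 : (1:ℝ) ≤ d := by
      have : (d:ℝ) ≠ 0 := by rintro h; rw [h] at hd; norm_num at hd; linarith
      have : d ≠ 0 := by exact_mod_cast this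
      exact_mod_cast Nat.one_le_iff_ne_zero.2 this
    have hKe : K ≤ Real.exp K := by have := Real.add_one_le_exp K; linarith
    have hE2 : E ≤ 2 * (K * d^2) := by nlinarith
    have he : (200040:ℝ) ≤ Real.exp (7*K) := by
      have h := Real.exp_one_gt_d9
      calc (200040:ℝ) ≤ 2.7^14 := by norm_num
        _ ≤ (Real.exp 1)^14 := by gcongr; linarith
        _ = Real.exp 14 := by rw [← Real.exp_nat_mul]; norm_num
        _ ≤ _ := Real.exp_le_exp.2 (by linarith)
    have : (z:ℝ) ≤ 2^(i+2) := by
      calc (z:ℝ) ≤ 100020 * E := hz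
        _ ≤ 200040 * (K * d^2) := by linarith
        _ ≤ Real.exp (7*K) * (Real.exp K * (Real.exp K)^2) := by gcongr
        _ = Real.exp (10*K) := by rw [← Real.exp_nat_mul, ← Real.exp_add, ← Real.exp_add]; push_cast; ring_nf
        _ ≤ Real.exp (Real.log 2 * i) := by
          apply Real.exp_le_exp.2
          have := Real.log_two_gt_d9
          nlinarith
        _ = 2^i := by rw [mul_comm, Real.exp_nat_mul, Real.exp_log (by norm_num)]
        _ ≤ _ := by gcongr <;> norm_num
    exact_mod_cast this
  calc G z ≤ _ := hG hzi
    _ ≤ _ := hind i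
    _ ≤ _ := by
      refine mul_le_mul_of_nonneg_right (Real.exp_le_exp.2 ?_) ha.le
      have : (d:ℝ) ≥ 0 := by positivity
      have : (i:ℝ) + 1 ≤ 21 * K := by linarith
      have h3 : 73 * k * (i+1) ≤ 73 * k * (21 * K) := by gcongr
      nlinarith

lemma num_c (K η k E a : ℝ) (d z F w : ℕ) (G : ℕ → ℝ) (hK : 2 ≤ K) (hη : 0 < η) (hKk : K ≤ Real.exp k)
    (hηk : η⁻¹ ≤ Real.exp k) (ha : 0 < a)
    (hk : (1/2:ℝ) ≤ k) (hE : E = d + K * k) (hd : k < (d:ℝ)^2) (hdK : Real.exp K < d)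
    (hw : w = 10^5 * d^2)
    (hz : (z:ℝ) ≤ (6*w+1)*d + 100001 * E) (hF : (F:ℝ) ≤ K^5)
    (h1 : η * a ≤ G 1) (hc : G (3*w) ≤ (4 * (3 * w : ℝ))^F * (K^2*a)) (hG : Monotone G)
    (g5 : G ((3*w-1)*w) * G 1 ≤ G (3*w-1+1) * G (3*w)) :
    G z ≤ Real.exp (20000 * E) * a := by
  have hG1 : 0 < G 1 := lt_of_lt_of_le (by positivity) h1
  have hK1 := Real.add_one_le_exp K
  have hd3 : (3:ℝ) ≤ d := by linarith
  have hd3' : 3 ≤ d := by exact_mod_cast hd3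
  have hd0 : (0:ℝ) < d := by linarith
  set l := Real.log d with hl
  have hlK : K ≤ l := by
    rw [hl, Real.le_log_iff_exp_le hd0]; exact hdK.le
  have hle : Real.exp l = d := Real.exp_log hd0
  have hl6 : l^6 ≤ 720 * d := by
    have := Real.pow_div_factorial_le_exp l (by linarith) 6
    rw [hle, div_le_iff₀ (by positivity)] at this
    norm_num [Nat.factorial] at this
    linarith
  have hld : l ≤ d := by have := Real.add_one_le_exp l; linarith
  have hw1 : 1 ≤ w := by rw [hw]; nlinarith
  have hwR : (w:ℝ) = 10^5 * d^2 := by rw [hw]; push_cast; ring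
  have hz2 : z ≤ (3*w-1)*w := by
    have h2 : 2*w*w ≤ (3*w-1)*w := Nat.mul_le_mul_right _ (by omega)
    refine le_trans ?_ h2
    have : (z:ℝ) ≤ 2 * w * w := by
      have hKd : K ≤ d := by linarith
      have hE3 : E ≤ d + d * d^2 := by
        rw [hE]; gcongr
      have h9 : (3:ℝ) * d^3 ≤ d * d^3 := by gcongr
      have h8 : (d:ℝ) ≤ d^3 := by nlinarith
      rw [hwR] at hz ⊢
      nlinarith
    exact_mod_cast this
  rw [Nat.sub_add_cancel (by omega)] at g5
  have he : (4 * (3 * w : ℝ)) ≤ Real.exp (10 * l) := by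
    have h := Real.exp_one_gt_d9
    have h15 : (1200000:ℝ) ≤ Real.exp (8*l) := by
      calc (1200000:ℝ) ≤ 2.7^16 := by norm_num
        _ ≤ (Real.exp 1)^16 := by gcongr; linarith
        _ = Real.exp 16 := by rw [← Real.exp_nat_mul]; norm_num
        _ ≤ _ := Real.exp_le_exp.2 (by linarith)
    calc 4 * (3 * w : ℝ) = 1200000 * d^2 := by rw [hwR]; ring
      _ ≤ Real.exp (8*l) * (Real.exp l)^2 := by rw [hle]; gcongr
      _ = _ := by rw [← Real.exp_nat_mul, ← Real.exp_add]; push_cast; ring_nf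
  have hcc : G (3*w) ≤ Real.exp (7200 * d + 2*k) * a := by
    refine hc.trans ?_
    rw [← mul_assoc, Real.exp_add]
    gcongr
    · calc (4 * (3 * w : ℝ))^F ≤ (Real.exp (10*l))^F := by gcongr
        _ = Real.exp (F * (10 * l)) := by rw [← Real.exp_nat_mul]
        _ ≤ _ := by
          apply Real.exp_le_exp.2
          have : (F:ℝ) ≤ l^5 := hF.trans (by gcongr)
          have h5 : (F:ℝ) * (10 * l) ≤ l^5 * (10 * l) := by gcongr
          nlinarith
    · calc K^2 ≤ (Real.exp k)^2 := by gcongr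
        _ = _ := by rw [← Real.exp_nat_mul]; norm_num
  have hGc : 0 < G (3*w) := lt_of_lt_of_le hG1 (hG (by omega))
  have hfin : G ((3*w-1)*w) * (η * a) ≤ (Real.exp (20000 * E) * a) * (η * a) := by
    have hp : 0 < G ((3*w-1)*w) := lt_of_lt_of_le hG1 (hG (by nlinarith [Nat.sub_add_cancel (by omega : 1 ≤ 3*w)]))
    calc _ ≤ G ((3*w-1)*w) * G 1 := by gcongr
      _ ≤ _ := g5
      _ ≤ (Real.exp (7200 * d + 2*k) * a) * (Real.exp (7200 * d + 2*k) * a) := by gcongr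
      _ = (Real.exp (14400 * d + 4*k) * η⁻¹ * a) * (η * a) := by
        have : Real.exp (14400 * d + 4*k) = Real.exp (7200 * d + 2*k) * Real.exp (7200 * d + 2*k) := by
          rw [← Real.exp_add]; ring_nf
        rw [this]; field_simp
      _ ≤ _ := by
        gcongr
        calc Real.exp (14400 * d + 4*k) * η⁻¹ ≤ Real.exp (14400 * d + 4*k) * Real.exp k := by gcongr
          _ = Real.exp (14400 * d + 5*k) := by rw [← Real.exp_add]; ring_nf
          _ ≤ _ := by apply Real.exp_le_exp.2; nlinarith
  exact (hG hz2).trans (le_of_mul_le_mul_right hfin (by positivity))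

lemma phase1 (K η k E : ℝ) (A : Finset ℤ) (hA : A.Nonempty) (d : ℕ) (x : Fin d → ℤ) (L : Fin d → ℕ)
    (hK : 2 ≤ K) (hη : 0 < η) (hKk : K ≤ Real.exp k) (hηk : η⁻¹ ≤ Real.exp k)
    (hk : (1/2:ℝ) ≤ k) (hE : E = d + K * k) (hAK : ((A + A).card : ℝ) ≤ K * A.card)
    (hQA : Qt L (phi x) 1 ⊆ smf A 4 - smf A 4) (hQ : η * A.card ≤ (Qt L (phi x) 1).card) :
    ∃ (ι : Type) (_ : Fintype ι) (y : ι → ℤ) (M : ι → ℕ),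
      (Fintype.card ι : ℝ) ≤ 300000 * E ∧
      ((∏ i, (2 * M i + 1) : ℕ) : ℝ) ≤ Real.exp (400000 * E) * A.card ∧
      ∀ q ∈ Qt L (phi x) 1, ∃ b : ι → ℤ, (∀ i, |b i| ≤ M i) ∧ q = ∑ i, b i * y i := by
  have ha : (0:ℝ) < A.card := by exact_mod_cast hA.card_pos
  have hd0 : (0:ℝ) ≤ d := by positivity
  have hE1 : 1 ≤ E := by nlinarith
  have hdE : (d:ℝ) ≤ E := by nlinarith
  have hkE : k ≤ E := by nlinarith
  have hsub := Qt_smf L x A hQA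
  have hq1 : ∀ n, ((Qt L (phi x) n).card : ℝ) ≤ K^(8*n) * A.card := by
    intro n
    have h1 := plun A hA K hAK (4*n) (4*n)
    rw [show 4*n+4*n = 8*n by ring] at h1
    refine le_trans ?_ h1
    exact_mod_cast Finset.card_le_card (hsub n)
  obtain ⟨F, hF, hq2⟩ := growth2 A hA K hAK
  have hq2 : ∀ n : ℕ, 1 ≤ n → ((Qt L (phi x) n).card : ℝ) ≤ (4*(n:ℝ))^F * (K^2 * A.card) := by
    intro n hn
    have h1 := hq2 (4*n) (by omega)
    push_cast at h1
    refine le_trans ?_ h1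
    exact_mod_cast Finset.card_le_card (hsub n)
  set t := ⌈100000 * E⌉₊ with ht
  have ht1 : 100000 * E ≤ t := Nat.le_ceil _
  have ht2 : (t:ℝ) < 100000 * E + 1 := Nat.ceil_lt_add_one (by linarith)
  have ht3 : 1 ≤ t := by
    have : (1:ℝ) ≤ t := by linarith
    exact_mod_cast this
  suffices hmain : ∃ c : ℕ, ∀ G : ℕ → ℕ, (∀ n ≤ c, G n ≤ (Qt L (phi x) n).card) →
      (Qt L (phi x) 1).card ≤ G 1 → Monotone G → (∀ n, 1 ≤ n → G n ≤ n^d * G 1) →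
      (∀ p n, 1 ≤ n → G (p*n) * G 1 ≤ G (p+1) * G (3*n)) →
      (G ((2*c+1)*d+t) : ℝ) ≤ Real.exp (20000*E) * A.card by
    obtain ⟨c, hc⟩ := hmain
    obtain ⟨G, h1, h2, h3, h4, h5, h6⟩ := interface d x L c
    have hG := hc G h1 h2 h3 h4 h5
    obtain ⟨ι, hι, y, M, hcard, hprod, hcov⟩ := h6 t (by
      have hlt : (4:ℝ)^d * G ((2*c+1)*d+t) < 2^t * G 1 := by
        have e4 : (4:ℝ)^d ≤ Real.exp (2*E) := by
          have h := Real.exp_one_gt_d9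
          calc (4:ℝ)^d ≤ (Real.exp 2)^d := by
                gcongr
                rw [show (2:ℝ) = 1 + 1 by norm_num, Real.exp_add]; nlinarith
            _ = Real.exp (d * 2) := by rw [← Real.exp_nat_mul]
            _ ≤ _ := Real.exp_le_exp.2 (by linarith)
        have e2 : Real.exp (60000 * E) ≤ 2^t := by
          calc _ ≤ Real.exp (t * Real.log 2) := by
                apply Real.exp_le_exp.2
                have := Real.log_two_gt_d9
                nlinarith
            _ = _ := by rw [Real.exp_nat_mul, Real.exp_log (by norm_num)]
        have eη : (A.card : ℝ) ≤ Real.exp E * G 1 := by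
          have hh : η * A.card ≤ G 1 := hQ.trans (by exact_mod_cast h2)
          have : (A.card : ℝ) ≤ η⁻¹ * G 1 := by
            rw [inv_mul_eq_div, le_div_iff₀ hη]; linarith
          refine this.trans ?_
          gcongr
          exact hηk.trans (Real.exp_le_exp.2 hkE)
        have hG1 : (0:ℝ) < G 1 := by
          by_contra hcon
          have : Real.exp E * G 1 ≤ 0 := mul_nonpos_of_nonneg_of_nonpos (Real.exp_pos _).le (not_lt.1 hcon)
          linarith
        calc (4:ℝ)^d * G ((2*c+1)*d+t) ≤ Real.exp (2*E) * (Real.exp (20000*E) * A.card) := by gcongr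
          _ ≤ Real.exp (2*E) * (Real.exp (20000*E) * (Real.exp E * G 1)) := by gcongr
          _ = Real.exp (20003*E) * G 1 := by
            rw [← mul_assoc, ← mul_assoc, ← Real.exp_add, ← Real.exp_add]; ring_nf
          _ < Real.exp (60000*E) * G 1 := by
            apply mul_lt_mul_of_pos_right _ hG1
            exact Real.exp_lt_exp.2 (by linarith)
          _ ≤ _ := by gcongr
      exact_mod_cast hlt)
    refine ⟨ι, hι, y, M, ?_, ?_, hcov⟩
    · have : (Fintype.card ι : ℝ) ≤ d + 2 * t := by exact_mod_cast hcard
      linarith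
    · have hp : ((∏ i, (2 * M i + 1) : ℕ) : ℝ) ≤ 2^d * 9^t * G ((2*c+1)*d) := by exact_mod_cast hprod
      have hGN : (G ((2*c+1)*d) : ℝ) ≤ Real.exp (20000*E) * A.card :=
        le_trans (by exact_mod_cast h3 (by omega)) hG
      have h := Real.exp_one_gt_d9
      have e2 : (2:ℝ)^d ≤ Real.exp E := by
        calc (2:ℝ)^d ≤ (Real.exp 1)^d := by gcongr; linarith
          _ = Real.exp (d * 1) := by rw [← Real.exp_nat_mul]
          _ ≤ _ := Real.exp_le_exp.2 (by linarith)
      have e9 : (9:ℝ)^t ≤ Real.exp (300003*E) := by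
        calc (9:ℝ)^t ≤ (Real.exp 3)^t := by
              gcongr
              have : Real.exp 3 = (Real.exp 1)^3 := by rw [← Real.exp_nat_mul]; norm_num
              rw [this]
              calc (9:ℝ) ≤ 2.7^3 := by norm_num
                _ ≤ _ := by gcongr; linarith
          _ = Real.exp (t * 3) := by rw [← Real.exp_nat_mul]
          _ ≤ _ := Real.exp_le_exp.2 (by linarith)
      calc _ ≤ _ := hp
        _ ≤ Real.exp E * Real.exp (300003*E) * (Real.exp (20000*E) * A.card) := by gcongr
        _ = Real.exp (320004*E) * A.card := by
          rw [← mul_assoc, ← Real.exp_add, ← Real.exp_add]; ring_nf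
        _ ≤ _ := by
          refine mul_le_mul_of_nonneg_right (Real.exp_le_exp.2 ?_) ha.le
          linarith
  by_cases hkd : (d:ℝ)^2 ≤ k
  · refine ⟨1, fun G h1 h2 h3 h4 h5 => ?_⟩
    refine num_a K k E A.card d _ (fun n => (G n : ℝ)) hK hKk ha hk hE hkd ?_ (by omega) ?_ ?_
    · push_cast; linarith
    · have := hq1 1
      have h := h1 1 le_rfl
      refine le_trans (by exact_mod_cast h) this
    · intro n hn
      exact_mod_cast h4 n hn
  push Not at hkd
  have hη1 : ∀ G : ℕ → ℕ, (Qt L (phi x) 1).card ≤ G 1 → η * A.card ≤ G 1 := by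
    intro G h2
    exact hQ.trans (by exact_mod_cast h2)
  have hmono : ∀ G : ℕ → ℕ, Monotone G → Monotone (fun n => (G n : ℝ)) := by
    intro G h m n hmn
    show (G m : ℝ) ≤ G n
    exact_mod_cast h hmn
  by_cases hdK : (d:ℝ) ≤ Real.exp K
  · refine ⟨9, fun G h1 h2 h3 h4 h5 => ?_⟩
    refine num_b K η k E A.card d _ (fun n => (G n : ℝ)) hK hη hKk hηk ha hk hE hkd hdK ?_
      (hη1 G h2) ?_ (hmono G h3) ?_
    · push_cast; linarith
    · have := hq1 9
      have h := h1 9 le_rfl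
      refine le_trans (by exact_mod_cast h) this
    · intro n hn
      exact_mod_cast h5 8 n hn
  push Not at hdK
  have hd1 : 1 ≤ d := by
    have h1 := Real.add_one_le_exp K
    have : (1:ℝ) ≤ d := by linarith
    exact_mod_cast this
  set w := 10^5 * d^2 with hw
  have hw1 : 1 ≤ w := by nlinarith
  refine ⟨3*w, fun G h1 h2 h3 h4 h5 => ?_⟩
  refine num_c K η k E A.card d _ F w (fun n => (G n : ℝ)) hK hη hKk hηk ha hk hE hkd hdK hw ?_ hF
    (hη1 G h2) ?_ (hmono G h3) ?_
  · push_cast; linarith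
  · have := hq2 (3*w) (by omega)
    have h := h1 (3*w) le_rfl
    push_cast at this
    refine le_trans ?_ this
    exact_mod_cast h
  · exact_mod_cast h5 (3*w-1) w hw1

lemma phase2 (K η k : ℝ) (A Q : Finset ℤ) (hA : A.Nonempty)
    (hK : 2 ≤ K) (hη : 0 < η) (hKk : K ≤ Real.exp k) (hηk : η⁻¹ ≤ Real.exp k)
    (hk : (1/2:ℝ) ≤ k) (hAK : ((A + A).card : ℝ) ≤ K * A.card) (hne : Q.Nonempty)
    (hQA : Q ⊆ smf A 2 - smf A 2) (hQ : η * A.card ≤ Q.card) :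
    ∃ (ι : Type) (_ : Fintype ι) (f : ι → ℤ), (Fintype.card ι : ℝ) ≤ 36 * (K * k) ∧
      ∀ a ∈ A, ∃ u ∈ Q, ∃ v ∈ Q, ∃ c : ι → ℤ, (∀ i, |c i| ≤ 1) ∧ a = u - v + ∑ i, c i * f i := by
  have ha : (0:ℝ) < A.card := by exact_mod_cast hA.card_pos
  set s := ⌈2*K⌉₊ with hs
  have hs1 : 2*K ≤ s := Nat.le_ceil _
  have hs2 : (s:ℝ) < 2*K + 1 := Nat.ceil_lt_add_one (by linarith)
  obtain ⟨t, ht⟩ : ∃ t, t = ⌈8*k⌉₊ + 1 := ⟨_, rfl⟩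
  have ht1 : 8*k + 1 ≤ t := by rw [ht]; push_cast; linarith [Nat.le_ceil (8*k)]
  have ht2 : (t:ℝ) < 8*k + 2 := by
    rw [ht]; push_cast; linarith [Nat.ceil_lt_add_one (by linarith : 0 ≤ 8*k)]
  obtain ⟨ι, hι, f, h1, h2, h3⟩ := greedy A s t Q hne (by
    have hsub := iterAdd_smf A t 2 Q hQA
    have hc : ((iterAdd A t Q).card : ℝ) ≤ K^(2+t+2) * A.card :=
      le_trans (by exact_mod_cast Finset.card_le_card hsub) (plun A hA K hAK (2+t) 2)
    have key : K^4 * η⁻¹ < 2^t := by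
      calc K^4 * η⁻¹ ≤ (Real.exp k)^4 * Real.exp k := by gcongr
        _ = Real.exp (5*k) := by rw [← Real.exp_nat_mul, ← Real.exp_add]; push_cast; ring_nf
        _ < Real.exp (t * Real.log 2) := by
          apply Real.exp_lt_exp.2
          have := Real.log_two_gt_d9
          nlinarith
        _ = _ := by rw [Real.exp_nat_mul, Real.exp_log (by norm_num)]
    have : ((iterAdd A t Q).card : ℝ) < (s:ℝ)^t * Q.card := by
      calc _ ≤ _ := hc
        _ = (K^4 * η⁻¹) * (K^t * (η * A.card)) := by field_simp; ring
        _ < 2^t * (K^t * (η * A.card)) := by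
          apply mul_lt_mul_of_pos_right key; positivity
        _ = (2*K)^t * (η * A.card) := by rw [mul_pow]; ring
        _ ≤ _ := by gcongr
    exact_mod_cast this)
  refine ⟨ι, hι, f, ?_, ?_⟩
  · have : (Fintype.card ι : ℝ) ≤ s * t := by exact_mod_cast h1
    calc _ ≤ _ := this
      _ ≤ (3*K) * (12*k) := by gcongr <;> linarith
      _ = _ := by ring
  · intro a haA
    obtain ⟨u, hu, v, hv, c, hc, h⟩ := h3 a haA
    exact ⟨u, hu, v, hv, c, hc, by simpa using h⟩

/-- **Chang's pullback and covering argument.** There is an absolute constant `C > 0` such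
that: if `A ⊆ ℤ` is finite and nonempty with `|A + A| ≤ K|A|` (`K ≥ 2`), `η ∈ (0,1]`, and
`2A - 2A` contains a multidimensional arithmetic progression of dimension `d` and size at
least `η|A|`, then `A` is contained in a multidimensional arithmetic progression of dimension
at most `C(d + K log(Kη⁻¹))` and size at most `exp(C(d + K log(Kη⁻¹)))|A|`. -/
theorem chang_pullback_covering :
    ∃ C : ℝ, 0 < C ∧
      ∀ (A : Finset ℤ) (K : ℝ) (η : ℝ), A.Nonempty → 2 ≤ K → 0 < η → η ≤ 1 →
        ((A + A).card : ℝ) ≤ K * A.card →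
        ∀ (d : ℕ) (Q : Finset ℤ),
          (∃ (a : ℤ) (x : Fin d → ℤ) (L : Fin d → ℕ),
            ∀ q : ℤ, q ∈ Q ↔ ∃ l : Fin d → ℕ, (∀ i, l i < L i) ∧
              q = a + ∑ i, (l i : ℤ) * x i) →
          Q ⊆ A + A - A - A →
          η * A.card ≤ Q.card →
          ∃ (d' : ℕ) (a : ℤ) (x : Fin d' → ℤ) (L : Fin d' → ℕ),
            (∀ i, 0 < L i) ∧
            (∀ z ∈ A, ∃ l : Fin d' → ℕ, (∀ i, l i < L i) ∧
              z = a + ∑ i, (l i : ℤ) * x i) ∧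
            (d' : ℝ) ≤ C * (d + K * Real.log (K * η⁻¹)) ∧
            (∏ i, (L i : ℝ)) ≤ Real.exp (C * (d + K * Real.log (K * η⁻¹))) * A.card := by
  refine ⟨1000000, by norm_num, ?_⟩
  intro A K η hA hK hη hη1 hAK d Q hQ hQA hQc
  obtain ⟨a, x, L, hQ⟩ := hQ
  have ha : (0:ℝ) < A.card := by exact_mod_cast hA.card_pos
  have hne : Q.Nonempty := by
    rw [← Finset.card_pos]
    have : (0:ℝ) < Q.card := lt_of_lt_of_le (by positivity) hQc
    exact_mod_cast this
  have hηi : 1 ≤ η⁻¹ := (one_le_inv₀ hη).2 hη1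
  obtain ⟨k, hkdef⟩ : ∃ k, k = Real.log (K * η⁻¹) := ⟨_, rfl⟩
  have hek : Real.exp k = K * η⁻¹ := by rw [hkdef, Real.exp_log (by positivity)]
  have hKk : K ≤ Real.exp k := by rw [hek]; nlinarith
  have hηk : η⁻¹ ≤ Real.exp k := by rw [hek]; nlinarith
  have hk : (1/2:ℝ) ≤ k := by
    have h1 : Real.log 2 ≤ k := by
      rw [Real.log_le_iff_le_exp (by norm_num)]; linarith
    have := Real.log_two_gt_d9
    linarith
  rw [← hkdef]
  obtain ⟨E, hE⟩ : ∃ E : ℝ, E = d + K * k := ⟨_, rfl⟩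
  rw [← hE]
  have hd0 : (0:ℝ) ≤ d := by positivity
  have hE1 : 1 ≤ E := by nlinarith
  have hKE : K * k ≤ E := by linarith
  obtain ⟨f1, f2, f3, f4⟩ := Q_facts A Q d a x L hQ hQA hne
  obtain ⟨ι, _, y, M, hc1, hp1, hcov1⟩ := phase1 K η k E A hA d x (fun i => L i - 1) hK hη hKk hηk hk hE
    hAK f1 (hQc.trans (by exact_mod_cast f2))
  obtain ⟨κ, _, g, hc2, hcov2⟩ := phase2 K η k A Q hA hK hη hKk hηk hk hAK hne f4 hQc
  let Y : ι ⊕ κ → ℤ := Sum.elim y g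
  let N : ι ⊕ κ → ℕ := Sum.elim M (fun _ => 1)
  let e := Fintype.equivFin (ι ⊕ κ)
  refine ⟨Fintype.card (ι ⊕ κ), - ∑ i, (N i : ℤ) * Y i, fun j => Y (e.symm j),
    fun j => 2 * N (e.symm j) + 1, fun j => by positivity, ?_, ?_, ?_⟩
  · intro z hz
    obtain ⟨u, hu, v, hv, c, hc, rfl⟩ := hcov2 z hz
    obtain ⟨b, hb, hbq⟩ := hcov1 _ (f3 u hu v hv)
    let B : ι ⊕ κ → ℤ := Sum.elim b c
    have hB : ∀ i, |B i| ≤ N i := by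
      rintro (i | i)
      · exact hb i
      · simpa [B, N] using hc i
    refine ⟨fun j => (B (e.symm j) + N (e.symm j)).toNat, ?_, ?_⟩
    · intro j
      have := hB (e.symm j)
      rw [abs_le] at this
      dsimp only
      omega
    · rw [hbq]
      have h1 : ∑ j, ((B (e.symm j) + N (e.symm j)).toNat : ℤ) * Y (e.symm j) =
          ∑ i, (B i + N i) * Y i := by
        rw [Equiv.sum_comp e.symm (fun i => ((B i + N i).toNat : ℤ) * Y i)]
        refine Finset.sum_congr rfl fun i _ => ?_
        have := hB i
        rw [abs_le] at this
        rw [Int.toNat_of_nonneg (by linarith)]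
      rw [h1]
      simp only [add_mul, Finset.sum_add_distrib]
      have h2 : ∑ i, B i * Y i = ∑ i, b i * y i + ∑ i, c i * g i := by
        rw [Fintype.sum_sum_type]; rfl
      rw [h2]; ring
  · rw [Fintype.card_sum]
    push_cast
    linarith
  · have h1 : ∏ j, ((2 * N (e.symm j) + 1 : ℕ) : ℝ) =
        ((∏ i, (2 * M i + 1) : ℕ) : ℝ) * 3^(Fintype.card κ) := by
      rw [Equiv.prod_comp e.symm (fun i => ((2 * N i + 1 : ℕ) : ℝ)), Fintype.prod_sum_type]
      push_cast
      simp only [N, Sum.elim_inl, Sum.elim_inr]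
      norm_num
    rw [h1]
    have h := Real.exp_one_gt_d9
    have h3 : (3:ℝ)^(Fintype.card κ) ≤ Real.exp (72 * E) := by
      calc (3:ℝ)^(Fintype.card κ) ≤ (Real.exp 2)^(Fintype.card κ) := by
            gcongr
            rw [show (2:ℝ) = 1 + 1 by norm_num, Real.exp_add]; nlinarith
        _ = Real.exp (Fintype.card κ * 2) := by rw [← Real.exp_nat_mul]
        _ ≤ _ := Real.exp_le_exp.2 (by linarith)
    calc _ ≤ (Real.exp (400000 * E) * A.card) * Real.exp (72 * E) := by gcongr
      _ = Real.exp (400072 * E) * A.card := by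
        rw [mul_right_comm, ← Real.exp_add]; ring_nf
      _ ≤ _ := by
        refine mul_le_mul_of_nonneg_right (Real.exp_le_exp.2 ?_) ha.le
        linarith
end
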